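/- Assume additionally that φ(x) → 0 as |x| → ∞ and that a is normalized by ∫_{ℝ^d} a(x) dx = (∫_Γ exp[(s−1) Σ_{u∈γ} φ(u)] μ(dγ))^{−1}. Then for every f ∈ C_0(ℝ^d), with F(γ) := e^{⟨f,γ⟩}, one has H_ε F → H_0 F in L²(Γ,μ) as ε → 0+. -/

import Mathlib

open MeasureTheory Set Filter
open scoped ENNReal NNReal BigOperators Topology Classical

noncomputable section

abbrev EucSp (d : ℕ) := EuclideanSpace ℝ (Fin d)

/-- The configuration space `Γ` over `ℝ^d`: locally finite subsets. -/
def Config (d : ℕ) : Type :=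
  {γ : Set (EucSp d) // ∀ Λ : Set (EucSp d), IsCompact Λ → (γ ∩ Λ).Finite}

/-- The σ-algebra on `Γ` generated by the maps `γ ↦ |γ ∩ B|`, `B` Borel. -/
instance Config.instMS (d : ℕ) : MeasurableSpace (Config d) :=
  ⨆ (B : Set (EucSp d)) (_ : MeasurableSet B),
    MeasurableSpace.comap (fun γ : Config d => (γ.1 ∩ B).encard) (⊤ : MeasurableSpace ℕ∞)

/-- `γ ∪ {x}`. -/
def Config.ins {d : ℕ} (γ : Config d) (x : EucSp d) : Config d :=
  ⟨insert x γ.1, fun Λ hΛ => ((γ.2 Λ hΛ).insert x).subset fun y hy => by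
    rcases hy with ⟨h1, h2⟩
    rcases h1 with rfl | h1
    · exact Set.mem_insert _ _
    · exact Set.mem_insert_of_mem _ ⟨h1, h2⟩⟩

/-- `γ ∖ {x}`. -/
def Config.del {d : ℕ} (γ : Config d) (x : EucSp d) : Config d :=
  ⟨γ.1 \ {x}, fun Λ hΛ => (γ.2 Λ hΛ).subset fun y hy => ⟨hy.1.1, hy.2⟩⟩

/-- The pairing `⟨f, γ⟩ = ∑_{x ∈ γ} f x`. -/
def cpair {d : ℕ} (f : EucSp d → ℝ) (γ : Config d) : ℝ := ∑' x : γ.1, f x.1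

/-- `exp : [-∞,∞] → [0,∞]`. -/
def eexp (x : EReal) : ℝ≥0∞ :=
  if x = ⊤ then ⊤ else if x = ⊥ then 0 else ENNReal.ofReal (Real.exp x.toReal)

/-- real-valued exponential of an extended real (with `exp(±∞)` sent to junk value `0`). -/
def rexp (x : EReal) : ℝ := (eexp x).toReal

/-- The relative energy `E(x,γ) = ∑_{y ∈ γ} φ(x-y)` if absolutely convergent, `+∞` otherwise. -/
def energy {d : ℕ} (φ : EucSp d → EReal) (x : EucSp d) (γ : Set (EucSp d)) : EReal :=
  if (∀ y ∈ γ, φ (x - y) ≠ ⊤) ∧ Summable (fun y : γ => (φ (x - y.1)).toReal)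
  then (((∑' y : γ, (φ (x - y.1)).toReal) : ℝ) : EReal)
  else ⊤

/-- `∑_{u ∈ γ} φ(u)` if absolutely convergent, `+∞` otherwise. -/
def totPhi {d : ℕ} (φ : EucSp d → EReal) (γ : Set (EucSp d)) : EReal :=
  if (∀ y ∈ γ, φ y ≠ ⊤) ∧ Summable (fun y : γ => (φ y.1).toReal)
  then (((∑' y : γ, (φ y.1).toReal) : ℝ) : EReal)
  else ⊤

/-- A pair potential: Borel, even, with `φ(x) ∈ ℝ` off the origin. -/
structure IsPairPotential {d : ℕ} (φ : EucSp d → EReal) : Prop where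
  meas : Measurable φ
  even : ∀ x : EucSp d, x ≠ 0 → φ (-x) = φ x
  finite_off : ∀ x : EucSp d, x ≠ 0 → φ x ≠ ⊤
  ne_bot : ∀ x, φ x ≠ ⊥

/-- Stability (S): `∑_{{x,y} ⊆ η} φ(x-y) ≥ -B|η|` for all finite `η`
(stated with the sum over ordered pairs, which doubles both sides). -/
def Stable {d : ℕ} (φ : EucSp d → EReal) (B : ℝ) : Prop :=
  ∀ η : Finset (EucSp d),
    ((-(2 * B * η.card) : ℝ) : EReal) ≤ ∑ p ∈ η.offDiag, φ (p.1 - p.2)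

/-- Low activity–high temperature (LA-HT): `∫ |e^{-φ} - 1| z dx < (2 e^{1+2B})⁻¹`. -/
def LAHT {d : ℕ} (φ : EucSp d → EReal) (z B : ℝ) : Prop :=
  ∫⁻ x : EucSp d, ENNReal.ofReal (|rexp (-(φ x)) - 1| * z)
    < ENNReal.ofReal (2 * Real.exp (1 + 2 * B))⁻¹

/-- The Georgii–Nguyen–Zessin identity characterizing `μ ∈ G(z,φ)`. -/
def GNZ {d : ℕ} (z : ℝ) (φ : EucSp d → EReal) (μ : Measure (Config d)) : Prop :=
  ∀ F : Config d → EucSp d → ℝ≥0∞,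
    Measurable (Function.uncurry F) →
    ∫⁻ γ, ∑' x : γ.1, F γ x.1 ∂μ
      = ∫⁻ γ, ∫⁻ x, ENNReal.ofReal z * eexp (-(energy φ x γ.1)) * F (γ.ins x) x ∂volume ∂μ

/-- Ordered `n`-tuples of distinct points of `γ`. -/
def injTuples {d : ℕ} (n : ℕ) (γ : Set (EucSp d)) : Set (Fin n → EucSp d) :=
  {p | Function.Injective p ∧ ∀ i, p i ∈ γ}

/-- `(k_μ^{(n)})` is the family of correlation functions of `μ`: each `k n` is measurable,
nonnegative and symmetric, and for every measurable symmetric `f : (ℝ^d)^n → [0,∞]`,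
`∫_Γ ∑_{{x_1,…,x_n} ⊆ γ} f dμ = (1/n!) ∫ f·kₙ dx` (stated equivalently via the sum over
ordered tuples of distinct points, which absorbs the factor `1/n!`). -/
def HasCorrFns {d : ℕ} (μ : Measure (Config d)) (k : ∀ n : ℕ, (Fin n → EucSp d) → ℝ) : Prop :=
  (∀ n : ℕ, Measurable (k n) ∧ (∀ x, 0 ≤ k n x) ∧
      ∀ (σ : Equiv.Perm (Fin n)) (x : Fin n → EucSp d), k n (x ∘ σ) = k n x) ∧
  ∀ n : ℕ, 0 < n → ∀ f : (Fin n → EucSp d) → ℝ≥0∞, Measurable f →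
    (∀ (σ : Equiv.Perm (Fin n)) (x : Fin n → EucSp d), f (x ∘ σ) = f x) →
    ∫⁻ γ, ∑' p : injTuples n γ.1, f p.1 ∂μ
      = ∫⁻ x : Fin n → EucSp d, f x * ENNReal.ofReal (k n x)

/-- The Ruelle bound `k^{(n)} ≤ ξⁿ`. -/
def RuelleBound {d : ℕ} (k : ∀ n : ℕ, (Fin n → EucSp d) → ℝ) (ξ : ℝ) : Prop :=
  ∀ n : ℕ, 0 < n → ∀ x : Fin n → EucSp d, k n x ≤ ξ ^ n

/-- Translation invariance of a family of functions on tuples. -/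
def TransInvFns {d : ℕ} (k : ∀ n : ℕ, (Fin n → EucSp d) → ℝ) : Prop :=
  ∀ (n : ℕ) (a : EucSp d) (x : Fin n → EucSp d), k n (fun i => x i + a) = k n x

/-- `P` is a partition of `{0,…,n-1}` into nonempty pairwise disjoint blocks. -/
def IsPartOfUniv {n : ℕ} (P : Finset (Finset (Fin n))) : Prop :=
  (∀ b ∈ P, b.Nonempty) ∧ (P : Set (Finset (Fin n))).PairwiseDisjoint id ∧
    P.sup id = Finset.univ

/-- `u` is the family of Ursell functions of `k`:
`k(η) = ∑ u(η_1) ⋯ u(η_j)`, summing over all partitions of `η`. -/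
def IsUrsell {d : ℕ} (k u : ∀ n : ℕ, (Fin n → EucSp d) → ℝ) : Prop :=
  ∀ n : ℕ, 0 < n → ∀ x : Fin n → EucSp d,
    k n x = ∑ P : Finset (Finset (Fin n)),
      if IsPartOfUniv P then ∏ b ∈ P, u b.card (fun i => x (b.orderIsoOfFin rfl i).1) else 0

/-- `f ∈ C_0(ℝ^d)`: continuous with compact support. -/
def IsC0 {d : ℕ} (f : EucSp d → ℝ) : Prop := Continuous f ∧ HasCompactSupport f

/-- Cylinder functions `FC_b(C_0(ℝ^d),Γ)`. -/
def Cyl {d : ℕ} (F : Config d → ℝ) : Prop :=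
  ∃ (N : ℕ) (f : Fin N → EucSp d → ℝ) (g : (Fin N → ℝ) → ℝ),
    (∀ i, IsC0 (f i)) ∧ Continuous g ∧ (∃ C, ∀ y, |g y| ≤ C) ∧
    ∀ γ, F γ = g fun i => cpair (f i) γ

/-- `(D_x^- F)(γ) = F(γ∖x) - F(γ)`. -/
def Dminus {d : ℕ} (F : Config d → ℝ) (x : EucSp d) (γ : Config d) : ℝ := F (γ.del x) - F γ

/-- `(D_x^+ F)(γ) = F(γ∪x) - F(γ)`. -/
def Dplus {d : ℕ} (F : Config d → ℝ) (x : EucSp d) (γ : Config d) : ℝ := F (γ.ins x) - F γ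

/-- `(D_{xy}^{-+} F)(γ) = F(γ∖x∪y) - F(γ)`. -/
def Dpm {d : ℕ} (F : Config d → ℝ) (x y : EucSp d) (γ : Config d) : ℝ :=
  F ((γ.del x).ins y) - F γ

/-- The Glauber bilinear form `E_G`. -/
def glauberForm {d : ℕ} (s : ℝ) (φ : EucSp d → EReal) (μ : Measure (Config d))
    (F G : Config d → ℝ) : ℝ :=
  ∫ γ, (∑' x : γ.1,
      rexp ((s : EReal) * energy φ x.1 (γ.1 \ {x.1})) * Dminus F x.1 γ * Dminus G x.1 γ) ∂μ

/-- The Kawasaki bilinear form `E_K`. -/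
def kawasakiForm {d : ℕ} (s : ℝ) (a : EucSp d → ℝ) (φ : EucSp d → EReal)
    (μ : Measure (Config d)) (F G : Config d → ℝ) : ℝ :=
  (1 / 2) * ∫ γ, (∑' x : γ.1, ∫ y : EucSp d,
      a (x.1 - y) *
        rexp ((s : EReal) * energy φ x.1 (γ.1 \ {x.1}) +
          ((s - 1 : ℝ) : EReal) * energy φ y (γ.1 \ {x.1})) *
        Dpm F x.1 y γ * Dpm G x.1 y γ) ∂μ

/-- The Glauber generator `H_G`. -/
def HG {d : ℕ} (s z : ℝ) (φ : EucSp d → EReal) (F : Config d → ℝ) (γ : Config d) : ℝ :=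
  -(∑' x : γ.1, rexp ((s : EReal) * energy φ x.1 (γ.1 \ {x.1})) * Dminus F x.1 γ)
    - ∫ x : EucSp d, z * rexp (((s - 1 : ℝ) : EReal) * energy φ x γ.1) * Dplus F x γ

/-- The Kawasaki generator `H_K`. -/
def HK {d : ℕ} (s : ℝ) (a : EucSp d → ℝ) (φ : EucSp d → EReal) (F : Config d → ℝ)
    (γ : Config d) : ℝ :=
  -(∑' x : γ.1, ∫ y : EucSp d,
      a (x.1 - y) * rexp ((s : EReal) * energy φ x.1 (γ.1 \ {x.1}) +
        ((s - 1 : ℝ) : EReal) * energy φ y (γ.1 \ {x.1})) * Dpm F x.1 y γ)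

/-- The scaled jump kernel `a_ε(x) = ε^d a(ε x)`. -/
def aScaled {d : ℕ} (a : EucSp d → ℝ) (ε : ℝ) (x : EucSp d) : ℝ := ε ^ d * a (ε • x)

/-- `H_ε^-` (death part of the Kawasaki generator with kernel `aa`). -/
def HepsMinus {d : ℕ} (s : ℝ) (aa : EucSp d → ℝ) (φ : EucSp d → EReal)
    (F : Config d → ℝ) (γ : Config d) : ℝ :=
  -(∑' x : γ.1, Dminus F x.1 γ * ∫ y : EucSp d,
      aa (x.1 - y) * rexp ((s : EReal) * energy φ x.1 (γ.1 \ {x.1}) +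
        ((s - 1 : ℝ) : EReal) * energy φ y (γ.1 \ {x.1})))

/-- `H_ε^+` (birth part of the Kawasaki generator with kernel `aa`). -/
def HepsPlus {d : ℕ} (s : ℝ) (aa : EucSp d → ℝ) (φ : EucSp d → EReal)
    (F : Config d → ℝ) (γ : Config d) : ℝ :=
  -(∑' x : γ.1, ∫ y : EucSp d,
      aa (x.1 - y) * rexp ((s : EReal) * energy φ x.1 (γ.1 \ {x.1}) +
        ((s - 1 : ℝ) : EReal) * energy φ y (γ.1 \ {x.1})) * Dplus F y (γ.del x.1))

/-- `H_0^-` (death part of the Glauber generator). -/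
def H0Minus {d : ℕ} (s : ℝ) (φ : EucSp d → EReal) (F : Config d → ℝ) (γ : Config d) : ℝ :=
  -(∑' x : γ.1, rexp ((s : EReal) * energy φ x.1 (γ.1 \ {x.1})) * Dminus F x.1 γ)

/-- `H_0^+` (birth part of the Glauber generator). -/
def H0Plus {d : ℕ} (s z : ℝ) (φ : EucSp d → EReal) (F : Config d → ℝ) (γ : Config d) : ℝ :=
  -∫ x : EucSp d, z * rexp (((s - 1 : ℝ) : EReal) * energy φ x γ.1) * Dplus F x γ

/-- The standing assumptions of the paper: `s ∈ [0,1/2]`, a stable pair potential in the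
low activity–high temperature regime, bounded outside a ball, and `μ` the Gibbs measure
from Ruelle's theorem with its correlation and Ursell functions. -/
structure Setting (d : ℕ) (s z B ξ : ℝ) (φ : EucSp d → EReal) (μ : Measure (Config d))
    (k u : ∀ n : ℕ, (Fin n → EucSp d) → ℝ) : Prop where
  hd : 0 < d
  hs0 : 0 ≤ s
  hs1 : s ≤ 1 / 2
  pp : IsPairPotential φ
  hB : 0 ≤ B
  stable : Stable φ B
  hz : 0 < z
  laht : LAHT φ z B
  bddOutside : ∃ R C : ℝ, ∀ x : EucSp d, R ≤ ‖x‖ → ∃ r : ℝ, φ x = (r : EReal) ∧ |r| ≤ C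
  prob : IsProbabilityMeasure μ
  gnz : GNZ z φ μ
  corr : HasCorrFns μ k
  ti : TransInvFns k
  hξ : 0 < ξ
  ruelle : RuelleBound k ξ
  ursell : IsUrsell k u
  ursellInt : ∀ m : ℕ,
    Integrable (fun y : Fin (m + 1) → EucSp d => u (m + 2) (Fin.cons 0 y)) volume

/-- The jump kernel `a`: bounded, nonnegative, even, integrable. -/
structure GoodA {d : ℕ} (a : EucSp d → ℝ) : Prop where
  meas : Measurable a
  nonneg : ∀ x, 0 ≤ a x
  bdd : ∃ C, ∀ x, a x ≤ C
  even : ∀ x, a (-x) = a x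
  int : Integrable a volume

/-- `φ(x) → 0` as `|x| → ∞`. -/
def PhiVanishes {d : ℕ} (φ : EucSp d → EReal) : Prop :=
  Tendsto φ (cocompact (EucSp d)) (nhds (0 : EReal))

/-- The normalization `∫ a dx = (∫_Γ exp[(s-1) ∑_{u∈γ} φ(u)] dμ(γ))⁻¹`. -/
def NormalizedA {d : ℕ} (s : ℝ) (a : EucSp d → ℝ) (φ : EucSp d → EReal)
    (μ : Measure (Config d)) : Prop :=
  (∫ x : EucSp d, a x) = (∫ γ, rexp (((s - 1 : ℝ) : EReal) * totPhi φ γ.1) ∂μ)⁻¹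

section

open ProbabilityTheory

theorem Config.countable {d : ℕ} (γ : Config d) : γ.1.Countable := by
  have h : γ.1 ⊆ ⋃ n : ℕ, γ.1 ∩ Metric.closedBall 0 (n : ℝ) := by
    intro x hx
    obtain ⟨n, hn⟩ := exists_nat_ge ‖x‖
    exact mem_iUnion.2 ⟨n, hx, by simpa using hn⟩
  exact (countable_iUnion fun n => (γ.2 _ (isCompact_closedBall _ _)).countable).mono h

instance Config.countable_coe {d : ℕ} (γ : Config d) : Countable γ.1 := γ.countable.to_subtype

/-- The counting measure carried by a configuration. -/
def cmeas {d : ℕ} (γ : Config d) : Measure (EucSp d) := Measure.count.restrict γ.1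

theorem lintegral_cmeas {d : ℕ} (γ : Config d) (f : EucSp d → ℝ≥0∞) :
    ∫⁻ x, f x ∂cmeas γ = ∑' x : γ.1, f x := by
  rw [cmeas, lintegral_countable _ γ.countable]
  simp

theorem cmeas_apply {d : ℕ} (γ : Config d) {s : Set (EucSp d)} (hs : MeasurableSet s) :
    cmeas γ s = (γ.1 ∩ s).encard := by
  rw [cmeas, Measure.restrict_apply hs, Set.inter_comm,
    Measure.count_apply (γ.countable.measurableSet.inter hs)]

theorem measurable_encard_inter {d : ℕ} {s : Set (EucSp d)} (hs : MeasurableSet s) :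
    Measurable[_, ⊤] fun γ : Config d => (γ.1 ∩ s).encard := by
  rw [measurable_iff_comap_le]
  exact le_iSup₂_of_le s hs le_rfl

theorem measurable_cmeas {d : ℕ} : Measurable (cmeas (d := d)) := by
  refine Measure.measurable_of_measurable_coe _ fun s hs => ?_
  simp_rw [cmeas_apply _ hs]
  exact (measurable_from_top (f := fun n : ℕ∞ => (n : ℝ≥0∞))).comp (measurable_encard_inter hs)

theorem measurable_to_config {d : ℕ} {X : Type*} [MeasurableSpace X] {Γ : X → Config d}
    (h : ∀ s, MeasurableSet s → Measurable fun a => cmeas (Γ a) s) : Measurable Γ := by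
  rw [measurable_iff_comap_le]
  simp only [Config.instMS, MeasurableSpace.comap_iSup, MeasurableSpace.comap_comp]
  refine iSup₂_le fun s hs => ?_
  rw [← measurable_iff_comap_le]
  refine (@measurable_to_countable' _ _ ⊤ _ _ _) fun n => ?_
  have := h s hs (measurableSet_singleton (n : ℝ≥0∞))
  convert this using 1
  ext a
  simp [cmeas_apply _ hs]

/-- The counting measure of a configuration, as a kernel. -/
def cker (d : ℕ) : Kernel (Config d) (EucSp d) := ⟨cmeas, measurable_cmeas⟩

theorem cmeas_lt_top {d : ℕ} (γ : Config d) {s : Set (EucSp d)} (hs : MeasurableSet s)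
    (hb : Bornology.IsBounded s) : cmeas γ s < ⊤ := by
  rw [cmeas_apply _ hs]
  have : (γ.1 ∩ s).Finite := (γ.2 _ hb.isCompact_closure).subset
    (inter_subset_inter_right _ subset_closure)
  simpa using this

instance cker_sfinite (d : ℕ) : IsSFiniteKernel (cker d) := by
  set A : ℕ → Set (EucSp d) := fun n => {x | ⌊‖x‖⌋₊ = n} with hA
  have hAm : ∀ n, MeasurableSet (A n) := fun n =>
    (Nat.measurable_floor.comp measurable_norm) (measurableSet_singleton n)
  have hAb : ∀ n, Bornology.IsBounded (A n) := fun n => by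
    refine (Metric.isBounded_closedBall (x := (0 : EucSp d)) (r := n + 1)).subset fun x hx => ?_
    have := Nat.lt_floor_add_one ‖x‖
    have h2 : ⌊‖x‖⌋₊ = n := hx
    rw [h2] at this
    simpa using this.le
  have hS : ∀ n m : ℕ, MeasurableSet {γ : Config d | cmeas γ (A n) = m} := fun n m =>
    ((Measure.measurable_coe (hAm n)).comp measurable_cmeas)
      (measurableSet_singleton _)
  let κ : ℕ × ℕ → Kernel (Config d) (EucSp d) := fun p =>
    Kernel.piecewise (hS p.1 p.2) ((cker d).restrict (hAm p.1)) 0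
  have hfin : ∀ p, IsFiniteKernel (κ p) := fun p => by
    refine ⟨⟨p.2, by simp, fun γ => ?_⟩⟩
    simp only [κ, Kernel.piecewise_apply']
    split_ifs with h
    · have h' : cmeas γ (A p.1) = p.2 := h
      rw [Kernel.restrict_apply, Measure.restrict_apply_univ]
      exact h'.le
    · simp
  have : cker d = Kernel.sum κ := by
    ext γ s hs
    rw [Kernel.sum_apply' _ _ hs]
    refine Eq.trans ?_ (ENNReal.tsum_prod (f := fun n m => κ (n, m) γ s)).symm
    have h1 : ∀ n, ∑' m, κ (n, m) γ s = cmeas γ (A n ∩ s) := fun n => by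
      have hlt := cmeas_lt_top γ (hAm n) (hAb n)
      obtain ⟨m, hm⟩ : ∃ m : ℕ, cmeas γ (A n) = m := by
        rw [cmeas_apply _ (hAm n)] at hlt ⊢
        have : (γ.1 ∩ A n).encard ≠ ⊤ := by
          intro h; rw [h] at hlt; simp at hlt
        obtain ⟨m, hm⟩ := ENat.ne_top_iff_exists.1 this
        exact ⟨m, by rw [← hm]; simp⟩
      rw [tsum_eq_single m]
      · simp only [κ, Kernel.piecewise_apply']
        rw [if_pos (show γ ∈ {γ | cmeas γ (A n) = m} from hm), Kernel.restrict_apply,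
          Measure.restrict_apply hs, Set.inter_comm]
        rfl
      · intro m' hm'
        simp only [κ, Kernel.piecewise_apply']
        rw [if_neg]
        · simp
        · intro h
          have h' : cmeas γ (A n) = m' := h
          rw [hm] at h'
          exact hm' (by exact_mod_cast h'.symm)
    simp_rw [h1]
    rw [← measure_iUnion (fun i j hij => by
      refine Set.disjoint_left.2 fun x hx hx' => hij ?_
      have h1 : ⌊‖x‖⌋₊ = i := hx.1
      have h2 : ⌊‖x‖⌋₊ = j := hx'.1
      omega) fun i => (hAm i).inter hs, ← iUnion_inter]
    have : ⋃ i, A i = univ := by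
      ext x; simp [hA]
    rw [this, univ_inter]; rfl
  rw [this]
  exact Kernel.isSFiniteKernel_sum

theorem Measurable.tsum_config {d : ℕ} {X : Type*} [MeasurableSpace X] {Γ : X → Config d}
    (hΓ : Measurable Γ) {g : X → EucSp d → ℝ≥0∞} (hg : Measurable (Function.uncurry g)) :
    Measurable fun a => ∑' x : (Γ a).1, g a x := by
  simp_rw [← lintegral_cmeas]
  exact Measurable.lintegral_kernel_prod_right (κ := (cker d).comap Γ hΓ) hg

theorem tsum_eq_toReal_sub {α : Type*} (g : α → ℝ) (h : ∑' a, ‖g a‖ₑ ≠ ⊤) :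
    ∑' a, g a = (∑' a, ENNReal.ofReal (g a)).toReal - (∑' a, ENNReal.ofReal (-g a)).toReal := by
  have h1 : ∑' a, ENNReal.ofReal (g a) ≠ ⊤ :=
    ne_top_of_le_ne_top h (ENNReal.tsum_le_tsum fun a => Real.ofReal_le_enorm (g a))
  have h2 : ∑' a, ENNReal.ofReal (-g a) ≠ ⊤ :=
    ne_top_of_le_ne_top h (ENNReal.tsum_le_tsum fun a => by
      rw [← enorm_neg]; exact Real.ofReal_le_enorm (-g a))
  rw [ENNReal.tsum_toReal_eq fun a => ENNReal.ofReal_ne_top,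
    ENNReal.tsum_toReal_eq fun a => ENNReal.ofReal_ne_top,
    ← (ENNReal.summable_toReal h1).tsum_sub (ENNReal.summable_toReal h2)]
  refine tsum_congr fun a => ?_
  rcases le_total 0 (g a) with h | h
  · rw [ENNReal.toReal_ofReal h, ENNReal.ofReal_of_nonpos (by linarith)]; simp
  · rw [ENNReal.toReal_ofReal (by linarith : 0 ≤ -g a), ENNReal.ofReal_of_nonpos h]; simp

theorem summable_iff_tsum_enorm {α : Type*} (g : α → ℝ) :
    Summable g ↔ ∑' a, ‖g a‖ₑ ≠ ⊤ := by
  rw [← summable_norm_iff]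
  constructor
  · intro h
    have := h.tsum_ofReal_ne_top
    simpa only [ofReal_norm] using this
  · intro h
    simpa using ENNReal.summable_toReal h

theorem Measurable.tsum_config_real {d : ℕ} {X : Type*} [MeasurableSpace X] {Γ : X → Config d}
    (hΓ : Measurable Γ) {g : X → EucSp d → ℝ} (hg : Measurable (Function.uncurry g)) :
    Measurable fun a => ∑' x : (Γ a).1, g a x := by
  have h1 : Measurable fun a => ∑' x : (Γ a).1, ‖g a x‖ₑ :=
    hΓ.tsum_config (g := fun a x => ‖g a x‖ₑ) hg.enorm
  have h2 : Measurable fun a => ∑' x : (Γ a).1, ENNReal.ofReal (g a x) :=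
    hΓ.tsum_config (g := fun a x => ENNReal.ofReal (g a x)) hg.ennreal_ofReal
  have h3 : Measurable fun a => ∑' x : (Γ a).1, ENNReal.ofReal (-g a x) :=
    hΓ.tsum_config (g := fun a x => ENNReal.ofReal (-g a x)) hg.neg.ennreal_ofReal
  have : (fun a => ∑' x : (Γ a).1, g a x) = fun a =>
      if ∑' x : (Γ a).1, ‖g a x‖ₑ ≠ ⊤ then (∑' x : (Γ a).1, ENNReal.ofReal (g a x)).toReal
        - (∑' x : (Γ a).1, ENNReal.ofReal (-g a x)).toReal else 0 := by
    funext a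
    split_ifs with h
    · exact tsum_eq_toReal_sub _ h
    · exact tsum_eq_zero_of_not_summable (by rw [summable_iff_tsum_enorm]; exact h)
  rw [this]
  exact Measurable.ite (h1 (measurableSet_singleton _).compl)
    (h2.ennreal_toReal.sub h3.ennreal_toReal)
    measurable_const

theorem tsum_del {d : ℕ} (γ : Config d) (x : EucSp d) (g : EucSp d → ℝ≥0∞) :
    ∑' u : (γ.del x).1, g u = ∑' u : γ.1, if u.1 = x then 0 else g u := by
  rw [tsum_subtype (γ.del x).1 g, tsum_subtype γ.1 fun u => if u = x then 0 else g u]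
  refine tsum_congr fun u => ?_
  by_cases h : u ∈ γ.1 <;> by_cases h' : u = x <;> simp [Config.del, Set.indicator, h, h']

theorem tsum_ins {d : ℕ} (γ : Config d) (x : EucSp d) (g : EucSp d → ℝ≥0∞) :
    ∑' u : (γ.ins x).1, g u = g x + ∑' u : γ.1, if u.1 = x then 0 else g u := by
  rw [tsum_subtype (γ.ins x).1 g, tsum_subtype γ.1 fun u => if u = x then 0 else g u,
    ENNReal.tsum_eq_add_tsum_ite x]
  congr 1
  · simp [Config.ins]
  · refine tsum_congr fun u => ?_
    by_cases h : u ∈ γ.1 <;> by_cases h' : u = x <;> simp [Config.ins, Set.indicator, h, h']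

theorem cmeas_eq_tsum {d : ℕ} (γ : Config d) {s : Set (EucSp d)} (hs : MeasurableSet s) :
    cmeas γ s = ∑' u : γ.1, s.indicator 1 u.1 := by
  rw [← lintegral_cmeas, lintegral_indicator_one hs]

theorem Measurable.config_del {d : ℕ} {X : Type*} [MeasurableSpace X] {Γ : X → Config d}
    (hΓ : Measurable Γ) {x : X → EucSp d} (hx : Measurable x) :
    Measurable fun a => (Γ a).del (x a) := by
  refine measurable_to_config fun s hs => ?_
  simp_rw [cmeas_eq_tsum _ hs, tsum_del]
  refine hΓ.tsum_config (g := fun a u => if u = x a then 0 else s.indicator 1 u) ?_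
  exact Measurable.ite (measurableSet_eq_fun measurable_snd (hx.comp measurable_fst))
    measurable_const ((measurable_one.indicator hs).comp measurable_snd)

theorem Measurable.config_ins {d : ℕ} {X : Type*} [MeasurableSpace X] {Γ : X → Config d}
    (hΓ : Measurable Γ) {x : X → EucSp d} (hx : Measurable x) :
    Measurable fun a => (Γ a).ins (x a) := by
  refine measurable_to_config fun s hs => ?_
  simp_rw [cmeas_eq_tsum _ hs, tsum_ins]
  refine ((measurable_one.indicator hs).comp hx).add
    (hΓ.tsum_config (g := fun a u => if u = x a then 0 else s.indicator 1 u) ?_)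
  exact Measurable.ite (measurableSet_eq_fun measurable_snd (hx.comp measurable_fst))
    measurable_const ((measurable_one.indicator hs).comp measurable_snd)

theorem Measurable.tsum_config_pi {d : ℕ} (n : ℕ) :
    ∀ {X : Type} [MeasurableSpace X] {Γ : X → Config d} (_ : Measurable Γ)
    {f : X → (Fin n → EucSp d) → ℝ≥0∞} (_ : Measurable (Function.uncurry f)),
    Measurable fun a => ∑' p : Fin n → (Γ a).1, f a fun i => p i := by
  induction n with
  | zero =>
    intro X _ Γ hΓ f hf
    simp only [tsum_fintype, Finset.univ_unique, Finset.sum_singleton]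
    have : (fun a => f a fun i => ((default : Fin 0 → (Γ a).1) i).1) = fun a => f a default := by
      funext a; congr 1; exact Subsingleton.elim _ _
    rw [this]
    exact hf.comp (measurable_id.prodMk measurable_const)
  | succ n ih =>
    intro X _ Γ hΓ f hf
    have : (fun a => ∑' p : Fin (n + 1) → (Γ a).1, f a fun i => p i) = fun a =>
        ∑' u : (Γ a).1, ∑' p : Fin n → (Γ a).1, f a (Fin.cons u.1 fun i => (p i).1) := by
      funext a
      rw [← (Fin.consEquiv fun _ => (Γ a).1).tsum_eq]
      refine (ENNReal.tsum_prod (f := fun (u : (Γ a).1) (p : Fin n → (Γ a).1) =>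
        f a fun i => (Fin.cons (α := fun _ => (Γ a).1) u p i).1)).trans ?_
      refine tsum_congr fun u => tsum_congr fun p => ?_
      congr 1
      funext i
      refine Fin.cases ?_ (fun i => ?_) i <;> simp
    rw [this]
    refine hΓ.tsum_config (g := fun a u => ∑' p : Fin n → (Γ a).1,
      f a (Fin.cons u fun i => (p i).1)) ?_
    refine ih (X := X × EucSp d) (hΓ.comp measurable_fst)
      (f := fun b q => f b.1 (Fin.cons b.2 q)) ?_
    refine hf.comp ((measurable_fst.comp measurable_fst).prodMk ?_)
    refine measurable_pi_iff.2 fun i => ?_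
    refine Fin.cases ?_ (fun i => ?_) i
    · exact measurable_snd.comp measurable_fst
    · exact (measurable_pi_apply i).comp measurable_snd

theorem measurableSet_injective_pi {d n : ℕ} :
    MeasurableSet {p : Fin n → EucSp d | Function.Injective p} := by
  have : {p : Fin n → EucSp d | Function.Injective p} =
      ⋂ i, ⋂ j, ⋂ (_ : i ≠ j), {p | p i = p j}ᶜ := by
    ext p
    simp only [Set.mem_ofPred_eq, mem_iInter, mem_compl_iff]
    exact ⟨fun h i j hij h' => hij (h h'), fun h i j h' => by
      by_contra hij; exact h i j hij h'⟩
  rw [this]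
  exact .iInter fun i => .iInter fun j => .iInter fun _ =>
    (measurableSet_eq_fun (measurable_pi_apply i) (measurable_pi_apply j)).compl

theorem tsum_injTuples {d n : ℕ} (γ : Config d) (f : (Fin n → EucSp d) → ℝ≥0∞) :
    ∑' p : injTuples n γ.1, f p.1 =
      ∑' p : Fin n → γ.1, {p | Function.Injective p}.indicator f fun i => p i := by
  have hinj : Function.Injective fun (p : Fin n → γ.1) i => (p i : EucSp d) := fun p q h => by
    funext i; exact Subtype.ext (congrFun h i)
  rw [tsum_subtype (injTuples n γ.1) f]
  have : Function.support ((injTuples n γ.1).indicator f) ⊆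
      range fun (p : Fin n → γ.1) i => (p i : EucSp d) := by
    intro p hp
    have := Set.mem_of_indicator_ne_zero hp
    exact ⟨fun i => ⟨p i, this.2 i⟩, rfl⟩
  rw [← hinj.tsum_eq this]
  refine tsum_congr fun p => ?_
  by_cases h : Function.Injective fun i => (p i : EucSp d) <;>
    simp [injTuples, Set.indicator, h]

theorem measurable_tsum_injTuples {d n : ℕ} {f : (Fin n → EucSp d) → ℝ≥0∞} (hf : Measurable f) :
    Measurable fun γ : Config d => ∑' p : injTuples n γ.1, f p.1 := by
  simp_rw [tsum_injTuples]
  exact Measurable.tsum_config_pi n measurable_id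
    (f := fun _ p => {p | Function.Injective p}.indicator f p)
    ((hf.indicator measurableSet_injective_pi).comp measurable_snd)

end

theorem card_embedding_fiber {α : Type*} {n : ℕ} (t : Finset α) (ht : t.card = n) :
    Nat.card {p : Fin n ↪ α // Finset.univ.map p = t} = n.factorial := by
  have e : (Fin n ≃ t) ≃ {p : Fin n ↪ α // Finset.univ.map p = t} := by
    refine Equiv.ofBijective (fun σ => ⟨σ.toEmbedding.trans (Function.Embedding.subtype _), ?_⟩)
      ⟨?_, ?_⟩
    · ext a
      simp only [Finset.mem_map, Finset.mem_univ, true_and]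
      constructor
      · rintro ⟨i, rfl⟩; exact (σ i).2
      · intro ha; exact ⟨σ.symm ⟨a, ha⟩, by simp⟩
    · intro σ τ h
      ext i
      have := congrArg (fun q : {p : Fin n ↪ α // Finset.univ.map p = t} => q.1 i) h
      simpa using this
    · rintro ⟨p, rfl⟩
      refine ⟨Equiv.ofBijective (fun i => ⟨p i, Finset.mem_map_of_mem p (Finset.mem_univ i)⟩)
        ⟨fun i j h => p.injective (by simpa using h), ?_⟩, ?_⟩
      · rintro ⟨a, ha⟩
        obtain ⟨i, -, rfl⟩ := Finset.mem_map.1 ha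
        exact ⟨i, rfl⟩
      · ext i; rfl
  rw [← Nat.card_congr e, Nat.card_eq_fintype_card,
    Fintype.card_equiv (Fintype.equivOfCardEq (by simp [ht]))]
  simp

theorem finite_embedding_fiber {α : Type*} {n : ℕ} (t : Finset α) :
    Finite {p : Fin n ↪ α // Finset.univ.map p = t} := by
  by_cases h : t.card = n
  · exact Nat.finite_of_card_ne_zero (by rw [card_embedding_fiber t h]; exact n.factorial_ne_zero)
  · refine @Finite.of_subsingleton _ ⟨fun p => absurd ?_ h⟩
    rw [← p.2]; simp

theorem tsum_embedding_prod {α : Type*} {g : α → ℝ} (hg : Summable fun a => ‖g a‖) (n : ℕ) :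
    ∑' p : Fin n ↪ α, ∏ i, g (p i) =
      n.factorial * ∑' t : {t : Finset α // t.card = n}, ∏ a ∈ t.1, g a := by
  set F : (Fin n ↪ α) → {t : Finset α // t.card = n} := fun p => ⟨Finset.univ.map p, by simp⟩
  have hfin : ∀ t, Finite {p // F p = t} := fun t => by
    have := finite_embedding_fiber (n := n) t.1
    exact Finite.of_injective (fun p : {p // F p = t} =>
      (⟨p.1, congrArg Subtype.val p.2⟩ : {p : Fin n ↪ α // Finset.univ.map p = t.1}))
      fun p q h => Subtype.ext (by simpa using h)
  have hcard : ∀ t, Nat.card {p // F p = t} = n.factorial := fun t => by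
    rw [← card_embedding_fiber t.1 t.2]
    exact Nat.card_congr (Equiv.subtypeEquivRight fun p => Subtype.ext_iff)
  have hval : ∀ (h : α → ℝ) (t) (p : {p // F p = t}), ∏ i, h (p.1 i) = ∏ a ∈ t.1, h a := by
    rintro h t ⟨p, rfl⟩
    simp [F]
  have hfs : ∀ (h : α → ℝ) t, ∑' p : {p // F p = t}, ∏ i, h (p.1 i) =
      n.factorial * ∏ a ∈ t.1, h a := fun h t => by
    have := hfin t
    have := Fintype.ofFinite {p // F p = t}
    rw [tsum_congr (hval h t), tsum_fintype, Finset.sum_const, nsmul_eq_mul, Finset.card_univ,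
      ← Nat.card_eq_fintype_card, hcard]
  have hs : Summable fun q : Σ t, {p // F p = t} => ∏ i, g (q.2.1 i) := by
    refine Summable.of_norm ?_
    have hn : (fun q : Σ t, {p // F p = t} => ‖∏ i, g (q.2.1 i)‖) =
        fun q => ∏ i, ‖g (q.2.1 i)‖ := by
      funext q; exact norm_prod _ _
    rw [hn, summable_sigma_of_nonneg fun q => Finset.prod_nonneg fun i _ => norm_nonneg _]
    refine ⟨fun t => ?_, ?_⟩
    · have := hfin t
      exact Summable.of_finite
    · simp only [hfs fun a => ‖g a‖]
      refine Summable.mul_left _ ?_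
      have := (summable_finsetProd_of_summable_norm (f := fun a => ‖g a‖) (by simpa using hg))
      exact this.subtype _
  rw [← (Equiv.sigmaFiberEquiv F).tsum_eq, ← tsum_mul_left]
  simp only [Equiv.sigmaFiberEquiv, Equiv.coe_fn_mk]
  rw [hs.tsum_sigma' fun t => by have := hfin t; exact Summable.of_finite]
  exact tsum_congr (hfs g)

theorem tprod_one_add_eq_tsum {α : Type*} {g : α → ℝ} (hg : Summable fun a => ‖g a‖) :
    ∏' a, (1 + g a) = ∑' n : ℕ, ((n.factorial : ℝ))⁻¹ * ∑' p : Fin n ↪ α, ∏ i, g (p i) := by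
  have hs : Summable fun t : Finset α => ∏ a ∈ t, g a := summable_finsetProd_of_summable_norm hg
  rw [tprod_one_add hs, ← (Equiv.sigmaFiberEquiv (Finset.card (α := α))).tsum_eq]
  have hs' := (Equiv.sigmaFiberEquiv (Finset.card (α := α))).summable_iff.2 hs
  refine (hs'.tsum_sigma' fun n => hs'.comp_injective sigma_mk_injective).trans ?_
  refine tsum_congr fun n => ?_
  rw [tsum_embedding_prod hg, ← mul_assoc, inv_mul_cancel₀ (by positivity), one_mul]
  rfl

/-- Injective tuples of points of a set are embeddings. -/
def injTuplesEquiv {d : ℕ} (n : ℕ) (γ : Set (EucSp d)) : injTuples n γ ≃ (Fin n ↪ γ) where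
  toFun p := ⟨fun i => ⟨p.1 i, p.2.2 i⟩, fun i j h => p.2.1 (by simpa using h)⟩
  invFun p := ⟨fun i => p i, fun i j h => p.injective (Subtype.ext h), fun i => (p i).2⟩
  left_inv p := rfl
  right_inv p := rfl

theorem exp_tsum_eq {d : ℕ} (γ : Set (EucSp d)) (ψ : EucSp d → ℝ)
    (hψ : Summable fun u : γ => ψ u) (hg : Summable fun u : γ => Real.exp (ψ u) - 1) :
    Real.exp (∑' u : γ, ψ u) = ∑' n : ℕ, ((n.factorial : ℝ))⁻¹ *
      ∑' p : injTuples n γ, ∏ i, (Real.exp (ψ (p.1 i)) - 1) := by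
  have h1 := Real.rexp_tsum_eq_tprod (f := fun u : γ => Real.exp (ψ u))
    (fun u => Real.exp_pos _) (by simpa using hψ)
  simp only [Real.log_exp] at h1
  have h2 := tprod_one_add_eq_tsum (g := fun u : γ => Real.exp (ψ u) - 1) hg.norm
  simp only [add_sub_cancel] at h2
  rw [h1, h2]
  refine tsum_congr fun n => ?_
  congr 1
  exact ((injTuplesEquiv n γ).tsum_eq fun p : Fin n ↪ γ => ∏ i, (Real.exp (ψ (p i)) - 1)).symm

/-- The correlation functions, normalised by `k⁰ = 1`. -/
def kz {d : ℕ} (k : ∀ n : ℕ, (Fin n → EucSp d) → ℝ) (n : ℕ) (x : Fin n → EucSp d) : ℝ :=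
  if n = 0 then 1 else k n x

theorem kz_nonneg {d : ℕ} {μ : Measure (Config d)} {k : ∀ n : ℕ, (Fin n → EucSp d) → ℝ}
    (hk : HasCorrFns μ k) (n : ℕ) (x : Fin n → EucSp d) : 0 ≤ kz k n x := by
  unfold kz; split_ifs
  · exact zero_le_one
  · exact (hk.1 n).2.1 x

theorem measurable_kz {d : ℕ} {μ : Measure (Config d)} {k : ∀ n : ℕ, (Fin n → EucSp d) → ℝ}
    (hk : HasCorrFns μ k) (n : ℕ) : Measurable (kz k n) := by
  unfold kz; split_ifs
  · exact measurable_const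
  · exact (hk.1 n).1

theorem kz_le {d : ℕ} {k : ∀ n : ℕ, (Fin n → EucSp d) → ℝ} {ξ : ℝ} (hr : RuelleBound k ξ)
    (n : ℕ) (x : Fin n → EucSp d) : kz k n x ≤ ξ ^ n := by
  unfold kz; split_ifs with h
  · simp [h]
  · exact hr n (Nat.pos_of_ne_zero h) x

theorem corr_kz {d : ℕ} {μ : Measure (Config d)} [IsProbabilityMeasure μ]
    {k : ∀ n : ℕ, (Fin n → EucSp d) → ℝ} (hk : HasCorrFns μ k) (n : ℕ)
    {f : (Fin n → EucSp d) → ℝ≥0∞} (hf : Measurable f)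
    (hs : ∀ (σ : Equiv.Perm (Fin n)) (x : Fin n → EucSp d), f (x ∘ σ) = f x) :
    ∫⁻ γ, ∑' p : injTuples n γ.1, f p.1 ∂μ = ∫⁻ x, f x * ENNReal.ofReal (kz k n x) := by
  rcases Nat.eq_zero_or_pos n with rfl | hn
  · have : ∀ γ : Config d, ∑' p : injTuples 0 γ.1, f p.1 = f default := fun γ => by
      have : Unique (injTuples 0 γ.1) :=
        { default := ⟨default, fun i => i.elim0, fun i => i.elim0⟩
          uniq := fun p => Subtype.ext (Subsingleton.elim _ _) }
      rw [tsum_fintype, Fintype.sum_unique]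
      congr 1; exact Subsingleton.elim _ _
    simp_rw [this, kz]
    rw [lintegral_const, measure_univ, lintegral_unique]
    simp [volume_pi]
    exact congrArg f (Subsingleton.elim _ _)
  · simp only [kz, hn.ne', if_false]
    exact hk.2 n hn f hf hs

theorem campbell_le {d : ℕ} {μ : Measure (Config d)} [IsProbabilityMeasure μ]
    {k : ∀ n : ℕ, (Fin n → EucSp d) → ℝ} {ξ : ℝ} (hk : HasCorrFns μ k) (hr : RuelleBound k ξ)
    {h : EucSp d → ℝ≥0∞} (hh : Measurable h) :
    ∫⁻ γ, ∑' u : γ.1, h u ∂μ ≤ ENNReal.ofReal ξ * ∫⁻ x, h x := by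
  have h1 := corr_kz hk 1 (f := fun x => h (x 0)) (hh.comp (measurable_pi_apply 0))
    (fun σ x => by simp [Subsingleton.elim (σ 0) 0])
  have h2 : ∀ γ : Config d, ∑' p : injTuples 1 γ.1, h (p.1 0) = ∑' u : γ.1, h u := fun γ => by
    let e : γ.1 ≃ injTuples 1 γ.1 :=
      { toFun := fun u => ⟨fun _ => u.1, fun i j _ => Subsingleton.elim _ _, fun _ => u.2⟩
        invFun := fun p => ⟨p.1 0, p.2.2 0⟩
        left_inv := fun u => rfl
        right_inv := fun p => Subtype.ext (by
          funext i; rw [Subsingleton.elim i 0]) }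
    exact (e.tsum_eq fun p : injTuples 1 γ.1 => h (p.1 0)).symm
  simp_rw [h2] at h1
  rw [h1]
  calc ∫⁻ x : Fin 1 → EucSp d, h (x 0) * ENNReal.ofReal (kz k 1 x)
      ≤ ∫⁻ x : Fin 1 → EucSp d, h (x 0) * ENNReal.ofReal ξ := by
        refine lintegral_mono fun x => ?_
        gcongr
        simpa using kz_le hr 1 x
    _ = (∫⁻ x : Fin 1 → EucSp d, h (x 0)) * ENNReal.ofReal ξ := by
        exact lintegral_mul_const _ (hh.comp (measurable_pi_apply 0))
    _ = (∫⁻ x, h x) * ENNReal.ofReal ξ := by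
        congr 1
        exact (volume_preserving_funUnique (Fin 1) (EucSp d)).lintegral_comp hh
    _ = _ := mul_comm _ _

theorem lintegral_prod_pi {d n : ℕ} {g : Fin n → EucSp d → ℝ≥0∞} (hg : ∀ i, Measurable (g i)) :
    ∫⁻ x : Fin n → EucSp d, ∏ i, g i (x i) = ∏ i, ∫⁻ x, g i x := by
  induction n with
  | zero => simp [volume_pi]
  | succ n ih =>
    rw [← ((volume_preserving_piFinSuccAbove (fun _ : Fin (n + 1) => EucSp d)
      0).symm).lintegral_comp_emb
      (MeasurableEquiv.measurableEmbedding _)]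
    have : ∀ a : EucSp d × (Fin n → EucSp d), ∏ i, g i
        ((MeasurableEquiv.piFinSuccAbove (fun _ : Fin (n + 1) => EucSp d) 0).symm a i) =
        g 0 a.1 * ∏ i, g i.succ (a.2 i) := fun a => by
      rw [Fin.prod_univ_succ]; rfl
    simp_rw [this]
    rw [Measure.volume_eq_prod, lintegral_prod_mul (hg 0).aemeasurable
      (Finset.measurable_prod (f := fun (i : Fin n) (b : Fin n → EucSp d) => g i.succ (b i)) _
        fun i _ => (hg _).comp (measurable_pi_apply i)).aemeasurable,
      ih fun i => hg i.succ, Fin.prod_univ_succ]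

theorem corr_real {d : ℕ} {μ : Measure (Config d)} [IsProbabilityMeasure μ]
    {k : ∀ n : ℕ, (Fin n → EucSp d) → ℝ} (hk : HasCorrFns μ k) (n : ℕ)
    {f : (Fin n → EucSp d) → ℝ} (hf : Measurable f)
    (hs : ∀ (σ : Equiv.Perm (Fin n)) (x : Fin n → EucSp d), f (x ∘ σ) = f x)
    (hi : Integrable fun x => f x * kz k n x) :
    Integrable (fun γ : Config d => ∑' p : injTuples n γ.1, f p.1) μ ∧
      ∫ γ, ∑' p : injTuples n γ.1, f p.1 ∂μ = ∫ x, f x * kz k n x ∧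
      ∫ γ, ‖∑' p : injTuples n γ.1, f p.1‖ ∂μ ≤ ∫ x, ‖f x * kz k n x‖ := by
  have hk0 := kz_nonneg hk n
  have hT : ∫⁻ γ, ∑' p : injTuples n γ.1, ‖f p.1‖ₑ ∂μ = ∫⁻ x, ‖f x * kz k n x‖ₑ := by
    rw [corr_kz hk n (f := fun x => ‖f x‖ₑ) hf.enorm fun σ x => by rw [hs]]
    refine lintegral_congr fun x => ?_
    rw [enorm_mul, Real.enorm_of_nonneg (hk0 x)]
  have hT' : ∫⁻ γ, ∑' p : injTuples n γ.1, ‖f p.1‖ₑ ∂μ ≠ ⊤ := by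
    rw [hT]; exact hi.2.ne
  have hmA : Measurable fun γ : Config d => ∑' p : injTuples n γ.1, ‖f p.1‖ₑ :=
    measurable_tsum_injTuples (f := fun x => ‖f x‖ₑ) hf.enorm
  have hmP : Measurable fun γ : Config d => ∑' p : injTuples n γ.1, ENNReal.ofReal (f p.1) :=
    measurable_tsum_injTuples (f := fun x => ENNReal.ofReal (f x)) hf.ennreal_ofReal
  have hmN : Measurable fun γ : Config d => ∑' p : injTuples n γ.1, ENNReal.ofReal (-f p.1) :=
    measurable_tsum_injTuples (f := fun x => ENNReal.ofReal (-f x)) hf.neg.ennreal_ofReal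
  have hae := ae_lt_top hmA hT'
  have hP : ∫⁻ γ, ∑' p : injTuples n γ.1, ENNReal.ofReal (f p.1) ∂μ ≠ ⊤ :=
    ne_top_of_le_ne_top hT' (lintegral_mono fun γ => ENNReal.tsum_le_tsum fun p =>
      Real.ofReal_le_enorm _)
  have hN : ∫⁻ γ, ∑' p : injTuples n γ.1, ENNReal.ofReal (-f p.1) ∂μ ≠ ⊤ :=
    ne_top_of_le_ne_top hT' (lintegral_mono fun γ => ENNReal.tsum_le_tsum fun p => by
      rw [← enorm_neg]; exact Real.ofReal_le_enorm _)
  have hv : (fun γ : Config d => ∑' p : injTuples n γ.1, f p.1) =ᵐ[μ] fun γ =>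
      (∑' p : injTuples n γ.1, ENNReal.ofReal (f p.1)).toReal -
        (∑' p : injTuples n γ.1, ENNReal.ofReal (-f p.1)).toReal := by
    filter_upwards [hae] with γ hγ
    exact tsum_eq_toReal_sub _ hγ.ne
  have hiP := integrable_toReal_of_lintegral_ne_top hmP.aemeasurable hP
  have hiN := integrable_toReal_of_lintegral_ne_top hmN.aemeasurable hN
  have hdiff := (hiP.sub hiN).congr hv.symm
  refine ⟨hdiff, ?_, ?_⟩
  · rw [integral_congr_ae hv, integral_sub hiP hiN,
      integral_toReal hmP.aemeasurable (ae_lt_top hmP hP),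
      integral_toReal hmN.aemeasurable (ae_lt_top hmN hN),
      integral_eq_lintegral_pos_part_sub_lintegral_neg_part hi,
      corr_kz hk n (f := fun x => ENNReal.ofReal (f x)) hf.ennreal_ofReal fun σ x => by rw [hs],
      corr_kz hk n (f := fun x => ENNReal.ofReal (-f x)) hf.neg.ennreal_ofReal
        fun σ x => by rw [hs]]
    simp_rw [← neg_mul, ENNReal.ofReal_mul' (hk0 _)]
  · have h1 : ∫ γ, (∑' p : injTuples n γ.1, ‖f p.1‖ₑ).toReal ∂μ = ∫ x, ‖f x * kz k n x‖ := by
      rw [integral_toReal hmA.aemeasurable hae, hT, integral_norm_eq_lintegral_enorm hi.1]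
    rw [← h1]
    refine integral_mono_ae hdiff.norm
      (integrable_toReal_of_lintegral_ne_top hmA.aemeasurable hT') ?_
    filter_upwards [hae] with γ hγ
    have := (summable_iff_tsum_enorm fun p : injTuples n γ.1 => f p.1).2 hγ.ne
    refine (norm_tsum_le_tsum_norm this.norm).trans (le_of_eq ?_)
    rw [ENNReal.tsum_toReal_eq fun a => enorm_ne_top]
    simp

/-- The `n`-th coefficient `∫ ∏ g(x_i) k⁽ⁿ⁾(x) dx`. -/
def Tn {d : ℕ} (k : ∀ n : ℕ, (Fin n → EucSp d) → ℝ) (g : EucSp d → ℝ) (n : ℕ) : ℝ :=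
  ∫ x : Fin n → EucSp d, (∏ i, g (x i)) * kz k n x

theorem integrable_prod_kz {d : ℕ} {μ : Measure (Config d)}
    {k : ∀ n : ℕ, (Fin n → EucSp d) → ℝ} {ξ : ℝ} (hk : HasCorrFns μ k) (hr : RuelleBound k ξ)
    {n : ℕ} {g : Fin n → EucSp d → ℝ} (hi : ∀ i, Integrable (g i)) :
    Integrable (fun x : Fin n → EucSp d => (∏ i, g i (x i)) * kz k n x) ∧
      ∫ x : Fin n → EucSp d, ‖(∏ i, g i (x i)) * kz k n x‖ ≤ ξ ^ n * ∏ i, ∫ x, ‖g i x‖ := by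
  have h1 : Integrable fun x : Fin n → EucSp d => ∏ i, g i (x i) := Integrable.fintype_prod hi
  have hb : ∀ x, ‖kz k n x‖ ≤ ξ ^ n := fun x => by
    rw [Real.norm_of_nonneg (kz_nonneg hk n x)]; exact kz_le hr n x
  have h2 := h1.mul_bdd (measurable_kz hk n).aestronglyMeasurable
    (Eventually.of_forall hb)
  refine ⟨h2, ?_⟩
  calc ∫ x : Fin n → EucSp d, ‖(∏ i, g i (x i)) * kz k n x‖
      ≤ ∫ x : Fin n → EucSp d, ξ ^ n * ∏ i, ‖g i (x i)‖ := by
        refine integral_mono h2.norm ?_ fun x => ?_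
        · exact (Integrable.fintype_prod fun i => (hi i).norm).const_mul _
        · dsimp only
          rw [norm_mul, norm_prod, mul_comm]
          exact mul_le_mul_of_nonneg_right (hb x) (Finset.prod_nonneg fun i _ => norm_nonneg _)
    _ = _ := by
        rw [integral_const_mul, integral_fintype_prod_volume_eq_prod (fun i x => ‖g i x‖)]

theorem abs_Tn_le {d : ℕ} {μ : Measure (Config d)}
    {k : ∀ n : ℕ, (Fin n → EucSp d) → ℝ} {ξ : ℝ} (hk : HasCorrFns μ k) (hr : RuelleBound k ξ)
    {g : EucSp d → ℝ} (hi : Integrable g) (n : ℕ) :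
    |Tn k g n| ≤ (ξ * ∫ x, ‖g x‖) ^ n := by
  rw [mul_pow]
  refine (norm_integral_le_integral_norm _).trans
    ((integrable_prod_kz hk hr fun _ => hi).2.trans ?_)
  simp

theorem expect_exp {d : ℕ} {μ : Measure (Config d)} [IsProbabilityMeasure μ]
    {k : ∀ n : ℕ, (Fin n → EucSp d) → ℝ} {ξ : ℝ} (hk : HasCorrFns μ k) (hr : RuelleBound k ξ)
    {ψ : EucSp d → ℝ} (hψ : Measurable ψ) (hi : Integrable fun x => Real.exp (ψ x) - 1)
    (hs : ∀ᵐ γ ∂μ, Summable fun u : γ.1 => ψ u) :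
    Integrable (fun γ : Config d => Real.exp (∑' u : γ.1, ψ u)) μ ∧
      ∫ γ, Real.exp (∑' u : γ.1, ψ u) ∂μ =
        ∑' n : ℕ, ((n.factorial : ℝ))⁻¹ * Tn k (fun x => Real.exp (ψ x) - 1) n := by
  set g : EucSp d → ℝ := fun x => Real.exp (ψ x) - 1 with hg
  have hgm : Measurable g := (Real.measurable_exp.comp hψ).sub_const 1
  have hgs : ∀ᵐ γ ∂μ, Summable fun u : γ.1 => g u := by
    have h1 : ∫⁻ γ, ∑' u : γ.1, ‖g u‖ₑ ∂μ ≠ ⊤ :=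
      ne_top_of_le_ne_top (ENNReal.mul_ne_top ENNReal.ofReal_ne_top hi.2.ne)
        (campbell_le hk hr (h := fun u => ‖g u‖ₑ) hgm.enorm)
    filter_upwards [ae_lt_top (measurable_id.tsum_config (g := fun _ u => ‖g u‖ₑ)
      (hgm.enorm.comp measurable_snd)) h1] with γ hγ
    exact (summable_iff_tsum_enorm _).2 hγ.ne
  have hF := fun n => corr_real hk n (f := fun x => ∏ i, g (x i))
    (Finset.measurable_prod _ fun i _ => hgm.comp (measurable_pi_apply i))
    (fun σ x => Equiv.prod_comp σ fun i => g (x i)) (integrable_prod_kz hk hr fun _ => hi).1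
  have hE : (fun γ : Config d => Real.exp (∑' u : γ.1, ψ u)) =ᵐ[μ] fun γ =>
      ∑' n : ℕ, ((n.factorial : ℝ))⁻¹ * ∑' p : injTuples n γ.1, ∏ i, g (p.1 i) := by
    filter_upwards [hs, hgs] with γ h1 h2
    exact exp_tsum_eq γ.1 ψ h1 h2
  have hsum : Summable fun n : ℕ => ∫ γ : Config d,
      ‖((n.factorial : ℝ))⁻¹ * ∑' p : injTuples n γ.1, ∏ i, g (p.1 i)‖ ∂μ := by
    refine Summable.of_nonneg_of_le (fun n => integral_nonneg fun γ => norm_nonneg _)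
      (fun n => ?_) (Real.summable_pow_div_factorial (ξ * ∫ x, ‖g x‖))
    simp_rw [norm_mul]
    rw [integral_const_mul, div_eq_inv_mul, Real.norm_of_nonneg (by positivity), mul_pow]
    gcongr
    refine (hF n).2.2.trans ((integrable_prod_kz hk hr fun _ => hi).2.trans ?_)
    simp
  have hH := hasSum_integral_of_summable_integral_norm (fun n => (hF n).1.const_mul _) hsum
  have hval : ∫ γ, Real.exp (∑' u : γ.1, ψ u) ∂μ =
      ∑' n : ℕ, ((n.factorial : ℝ))⁻¹ * Tn k g n := by
    rw [integral_congr_ae hE, ← hH.tsum_eq]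
    refine tsum_congr fun n => ?_
    rw [integral_const_mul, (hF n).2.1]; rfl
  refine ⟨?_, hval⟩
  have hm : Measurable fun γ : Config d => Real.exp (∑' u : γ.1, ψ u) :=
    Real.measurable_exp.comp (measurable_id.tsum_config_real (g := fun _ u => ψ u)
      (hψ.comp measurable_snd))
  refine ⟨hm.aestronglyMeasurable, ?_⟩
  have hle : ∀ᵐ γ ∂μ, ‖Real.exp (∑' u : γ.1, ψ u)‖ₑ ≤ ∑' n : ℕ,
      ‖((n.factorial : ℝ))⁻¹ * ∑' p : injTuples n γ.1, ∏ i, g (p.1 i)‖ₑ := by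
    filter_upwards [hE] with γ h
    have h' : Real.exp (∑' u : γ.1, ψ u) = _ := h
    rw [h']
    exact enorm_tsum_le_tsum_enorm
  refine (lintegral_mono_ae hle).trans_lt ?_
  rw [lintegral_tsum fun n => ((hF n).1.const_mul _).1.enorm]
  have : ∀ n : ℕ, ∫⁻ γ : Config d,
      ‖((n.factorial : ℝ))⁻¹ * ∑' p : injTuples n γ.1, ∏ i, g (p.1 i)‖ₑ ∂μ =
      ENNReal.ofReal (∫ γ : Config d,
        ‖((n.factorial : ℝ))⁻¹ * ∑' p : injTuples n γ.1, ∏ i, g (p.1 i)‖ ∂μ) := fun n => by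
    rw [ofReal_integral_norm_eq_lintegral_enorm ((hF n).1.const_mul _)]
  simp_rw [this]
  exact (hsum.tsum_ofReal_ne_top).lt_top

theorem lintegral_exp_le {d : ℕ} {μ : Measure (Config d)} [IsProbabilityMeasure μ]
    {k : ∀ n : ℕ, (Fin n → EucSp d) → ℝ} {ξ : ℝ} (hk : HasCorrFns μ k) (hr : RuelleBound k ξ)
    {ψ : EucSp d → ℝ} (hψ : Measurable ψ) (hi : Integrable fun x => Real.exp (ψ x) - 1)
    (hs : ∀ᵐ γ ∂μ, Summable fun u : γ.1 => ψ u) :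
    ∫⁻ γ, ENNReal.ofReal (Real.exp (∑' u : γ.1, ψ u)) ∂μ ≤
      ENNReal.ofReal (Real.exp (ξ * ∫ x, ‖Real.exp (ψ x) - 1‖)) := by
  obtain ⟨h1, h2⟩ := expect_exp hk hr hψ hi hs
  rw [← ofReal_integral_eq_lintegral_ofReal h1 (Eventually.of_forall fun _ => (Real.exp_pos _).le),
    h2]
  refine ENNReal.ofReal_le_ofReal ?_
  have hS := Real.summable_pow_div_factorial (ξ * ∫ x, ‖Real.exp (ψ x) - 1‖)
  have hle : ∀ n : ℕ, ‖((n.factorial : ℝ))⁻¹ * Tn k (fun x => Real.exp (ψ x) - 1) n‖ ≤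
      (ξ * ∫ x, ‖Real.exp (ψ x) - 1‖) ^ n / n.factorial := fun n => by
    rw [norm_mul, Real.norm_of_nonneg (by positivity), div_eq_inv_mul]
    gcongr
    exact abs_Tn_le hk hr hi n
  have hexp : ∀ A : ℝ, Real.exp A = ∑' n : ℕ, A ^ n / n.factorial := fun A => by
    rw [Real.exp_eq_exp_ℝ, NormedSpace.exp_eq_tsum_div]
  rw [hexp (ξ * ∫ x, ‖Real.exp (ψ x) - 1‖)]
  exact (Summable.of_norm_bounded hS hle).tsum_le_tsum (fun n => (le_abs_self _).trans (hle n)) hS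

/-- The Ursell function of the points with index in `b`. -/
def uset {d : ℕ} (u : ∀ n : ℕ, (Fin n → EucSp d) → ℝ) {n : ℕ} (b : Finset (Fin n))
    (x : Fin n → EucSp d) : ℝ :=
  u b.card (fun i => x (b.orderIsoOfFin rfl i).1)

/-- `P` is a partition of `S` into nonempty pairwise disjoint blocks. -/
def IsPartOf {n : ℕ} (S : Finset (Fin n)) (P : Finset (Finset (Fin n))) : Prop :=
  (∀ b ∈ P, b.Nonempty) ∧ (P : Set (Finset (Fin n))).PairwiseDisjoint id ∧ P.sup id = S

theorem IsPartOf.subset {n : ℕ} {S : Finset (Fin n)} {P : Finset (Finset (Fin n))}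
    (h : IsPartOf S P) {b : Finset (Fin n)} (hb : b ∈ P) : b ⊆ S := by
  rw [← h.2.2]; exact Finset.le_sup (f := id) hb

theorem uset_map {d : ℕ} (u : ∀ n : ℕ, (Fin n → EucSp d) → ℝ) {m n : ℕ} (e : Fin m ↪o Fin n)
    (b : Finset (Fin m)) (x : Fin n → EucSp d) :
    uset u (b.map e.toEmbedding) x = uset u b (x ∘ e) := by
  have key : ∀ (c : ℕ) (h : (b.map e.toEmbedding).card = c) (h' : b.card = c),
      (fun i => x ((b.map e.toEmbedding).orderIsoOfFin h i).1) =
        fun i => (x ∘ e) (b.orderIsoOfFin h' i).1 := fun c h h' => by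
    have : (fun i => e (b.orderEmbOfFin h' i)) = (b.map e.toEmbedding).orderEmbOfFin h :=
      Finset.orderEmbOfFin_unique h (fun i => by
        simp)
        (e.strictMono.comp (b.orderEmbOfFin h').strictMono)
    funext i
    exact congrArg x (congrFun this i).symm
  have key2 : ∀ (c : ℕ) (h : (b.map e.toEmbedding).card = c) (h' : b.card = c),
      uset u (b.map e.toEmbedding) x = u c (fun i => (x ∘ e) (b.orderIsoOfFin h' i).1) := by
    rintro c rfl h'
    exact congrArg _ (key _ rfl h')
  exact key2 _ (by simp) rfl

theorem sum_isPartOf_map {m n : ℕ} (e : Fin m ↪o Fin n) (w : Finset (Finset (Fin n)) → ℝ) :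
    (∑ P, if IsPartOf (Finset.univ.map e.toEmbedding) P then w P else 0) =
      ∑ P, if IsPartOf Finset.univ P
        then w (P.map (Finset.mapEmbedding e.toEmbedding).toEmbedding) else 0 := by
  rw [← Finset.sum_filter, ← Finset.sum_filter]
  symm
  refine Finset.sum_bij (fun P _ => P.map (Finset.mapEmbedding e.toEmbedding).toEmbedding)
    ?_ ?_ ?_ ?_
  · intro P hP
    simp only [Finset.mem_filter, Finset.mem_univ, true_and] at hP ⊢
    refine ⟨?_, ?_, ?_⟩
    · simpa using hP.1
    · intro b hb c hc hbc
      simp only [Finset.coe_map, Set.mem_image] at hb hc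
      obtain ⟨b, hb, rfl⟩ := hb
      obtain ⟨c, hc, rfl⟩ := hc
      have := hP.2.1 hb hc (fun h => hbc (by rw [h]))
      simpa [Function.onFun, Finset.mapEmbedding_apply, Finset.disjoint_map] using this
    · ext i
      have h3 := hP.2.2
      have : ∀ j, ∃ b ∈ P, j ∈ b := fun j => by
        have : j ∈ P.sup id := h3 ▸ Finset.mem_univ j
        simpa [Finset.mem_sup] using this
      simp only [Finset.mem_sup, Finset.mem_map, Finset.mem_univ, true_and, id]
      constructor
      · rintro ⟨_, ⟨b, hb, rfl⟩, hi⟩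
        simp only [RelEmbedding.coe_toEmbedding, Finset.mapEmbedding_apply, Finset.mem_map] at hi
        obtain ⟨j, hj, rfl⟩ := hi
        exact ⟨j, rfl⟩
      · rintro ⟨j, rfl⟩
        obtain ⟨b, hb, hj⟩ := this j
        exact ⟨_, ⟨b, hb, rfl⟩, by simpa [Finset.mapEmbedding_apply] using hj⟩
  · intro P _ Q _ h
    exact Finset.map_injective _ h
  · intro P hP
    simp only [Finset.mem_filter, Finset.mem_univ, true_and] at hP
    have hsub : P ⊆ (Finset.univ : Finset (Finset (Fin m))).map
        (Finset.mapEmbedding e.toEmbedding).toEmbedding := fun b hb => by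
      obtain ⟨c, -, rfl⟩ := Finset.subset_map_iff.1 (hP.subset hb)
      simp only [Finset.mem_map, Finset.mem_univ, true_and]
      exact ⟨c, rfl⟩
    obtain ⟨Q, -, rfl⟩ := Finset.subset_map_iff.1 hsub
    refine ⟨Q, ?_, rfl⟩
    simp only [Finset.mem_filter, Finset.mem_univ, true_and]
    refine ⟨?_, ?_, ?_⟩
    · simpa using hP.1
    · intro b hb c hc hbc
      have := hP.2.1 (Finset.mem_coe.2 (Finset.mem_map_of_mem _ hb))
        (Finset.mem_coe.2 (Finset.mem_map_of_mem _ hc))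
        (fun h => hbc ((Finset.mapEmbedding e.toEmbedding).injective h))
      simpa [Function.onFun, Finset.mapEmbedding_apply, Finset.disjoint_map] using this
    · refine Finset.eq_univ_iff_forall.2 fun j => ?_
      have : e j ∈ (Q.map (Finset.mapEmbedding e.toEmbedding).toEmbedding).sup id := by
        rw [hP.2.2]; simp
      simp only [Finset.mem_sup, Finset.mem_map, id] at this ⊢
      obtain ⟨_, ⟨b, hb, rfl⟩, hi⟩ := this
      exact ⟨b, hb, by simpa [Finset.mapEmbedding_apply] using hi⟩
  · intro P _; rfl

/-- The correlation function of the points with index in `S`, as a sum over partitions. -/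
def Kset {d : ℕ} (u : ∀ n : ℕ, (Fin n → EucSp d) → ℝ) {n : ℕ} (S : Finset (Fin n))
    (x : Fin n → EucSp d) : ℝ :=
  ∑ P, if IsPartOf S P then ∏ b ∈ P, uset u b x else 0

theorem isPartOf_empty {n : ℕ} (P : Finset (Finset (Fin n))) : IsPartOf ∅ P ↔ P = ∅ := by
  constructor
  · intro h
    refine Finset.eq_empty_of_forall_notMem fun b hb => ?_
    exact (h.1 b hb).ne_empty (Finset.subset_empty.1 (h.subset hb))
  · rintro rfl
    exact ⟨by simp, by simp, by simp⟩

theorem kz_eq_Kset {d : ℕ} {k u : ∀ n : ℕ, (Fin n → EucSp d) → ℝ} (hu : IsUrsell k u) {n : ℕ}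
    (S : Finset (Fin n)) (x : Fin n → EucSp d) :
    kz k S.card (x ∘ S.orderEmbOfFin rfl) = Kset u S x := by
  rcases S.eq_empty_or_nonempty with rfl | hS
  · simp [kz, Kset, isPartOf_empty]
  · have h0 : S.card ≠ 0 := hS.card_pos.ne'
    have hm : Finset.univ.map (S.orderEmbOfFin rfl).toEmbedding = S := by
      ext i
      have := Finset.range_orderEmbOfFin S rfl
      rw [← Finset.mem_coe (s := S), ← this]; simp
    rw [kz, if_neg h0, hu _ hS.card_pos, Kset]
    conv_rhs => rw [← hm]
    rw [sum_isPartOf_map]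
    refine Finset.sum_congr rfl fun P _ => ?_
    by_cases hP : IsPartOfUniv P
    · rw [if_pos hP, if_pos (show IsPartOf _ P from hP), Finset.prod_map]
      refine Finset.prod_congr rfl fun b _ => ?_
      exact (uset_map u _ b x).symm
    · rw [if_neg hP, if_neg (show ¬ IsPartOf _ P from hP)]

/-- A block meeting both `I` and its complement. -/
def Crosses {n : ℕ} (I b : Finset (Fin n)) : Prop := (∃ i ∈ b, i ∈ I) ∧ ∃ j ∈ b, j ∉ I

theorem Kset_split {d : ℕ} (u : ∀ n : ℕ, (Fin n → EucSp d) → ℝ) {n : ℕ} (I : Finset (Fin n))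
    (x : Fin n → EucSp d) :
    Kset u Finset.univ x = Kset u I x * Kset u Iᶜ x +
      ∑ P, if IsPartOf Finset.univ P ∧ ∃ b ∈ P, Crosses I b then ∏ b ∈ P, uset u b x else 0 := by
  have h1 : Kset u I x * Kset u Iᶜ x =
      ∑ P, if IsPartOf Finset.univ P ∧ ¬ ∃ b ∈ P, Crosses I b then ∏ b ∈ P, uset u b x else 0 := by
    simp_rw [Kset, ← Finset.sum_filter]
    rw [Finset.sum_mul_sum, ← Finset.sum_product']
    have dis : ∀ P Q : Finset (Finset (Fin n)), IsPartOf I P → IsPartOf Iᶜ Q → Disjoint P Q := by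
      intro P Q hP hQ
      rw [Finset.disjoint_left]
      intro b hb hb'
      obtain ⟨i, hi⟩ := hP.1 b hb
      exact (Finset.mem_compl.1 (hQ.subset hb' hi)) (hP.subset hb hi)
    refine Finset.sum_bij' (fun p _ => p.1 ∪ p.2)
      (fun P _ => (P.filter (fun b => b ⊆ I), P.filter (fun b => b ⊆ Iᶜ))) ?_ ?_ ?_ ?_ ?_
    · rintro ⟨P, Q⟩ h
      simp only [Finset.mem_product, Finset.mem_filter, Finset.mem_univ, true_and] at h ⊢
      obtain ⟨hP, hQ⟩ := h
      refine ⟨⟨?_, ?_, ?_⟩, ?_⟩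
      · intro b hb
        rcases Finset.mem_union.1 hb with hb | hb
        · exact hP.1 b hb
        · exact hQ.1 b hb
      · have hd : ∀ b ∈ P, ∀ c ∈ Q, Disjoint b c := fun b hb c hc =>
          Finset.disjoint_of_subset_left (hP.subset hb)
            (Finset.disjoint_of_subset_right (hQ.subset hc) disjoint_compl_right)
        intro b hb c hc hbc
        rcases Finset.mem_union.1 hb with hb | hb <;> rcases Finset.mem_union.1 hc with hc | hc
        · exact hP.2.1 hb hc hbc
        · exact hd b hb c hc
        · exact (hd c hc b hb).symm
        · exact hQ.2.1 hb hc hbc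
      · rw [Finset.sup_union, hP.2.2, hQ.2.2]; exact Finset.union_compl I
      · rintro ⟨b, hb, ⟨i, hi, hiI⟩, j, hj, hjI⟩
        rcases Finset.mem_union.1 hb with hb | hb
        · exact hjI (hP.subset hb hj)
        · exact Finset.mem_compl.1 (hQ.subset hb hi) hiI
    · intro P h
      simp only [Finset.mem_product, Finset.mem_filter, Finset.mem_univ, true_and] at h ⊢
      obtain ⟨hP, hc⟩ := h
      have hmem : ∀ i, ∃ b ∈ P, i ∈ b := fun i => by
        have : i ∈ P.sup id := hP.2.2 ▸ Finset.mem_univ i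
        simpa [Finset.mem_sup] using this
      refine ⟨⟨fun b hb => hP.1 b (Finset.mem_filter.1 hb).1, fun b hb c hc' =>
        hP.2.1 (Finset.mem_filter.1 hb).1 (Finset.mem_filter.1 hc').1, ?_⟩,
        ⟨fun b hb => hP.1 b (Finset.mem_filter.1 hb).1, fun b hb c hc' =>
        hP.2.1 (Finset.mem_filter.1 hb).1 (Finset.mem_filter.1 hc').1, ?_⟩⟩
      · ext i
        simp only [Finset.mem_sup, Finset.mem_filter, id]
        refine ⟨fun ⟨b, hb, hi⟩ => hb.2 hi, fun hi => ?_⟩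
        obtain ⟨b, hb, hib⟩ := hmem i
        refine ⟨b, ⟨hb, fun j hj => ?_⟩, hib⟩
        by_contra hjI
        exact hc ⟨b, hb, ⟨i, hib, hi⟩, j, hj, hjI⟩
      · ext i
        simp only [Finset.mem_sup, Finset.mem_filter, id]
        refine ⟨fun ⟨b, hb, hi⟩ => hb.2 hi, fun hi => ?_⟩
        obtain ⟨b, hb, hib⟩ := hmem i
        refine ⟨b, ⟨hb, fun j hj => ?_⟩, hib⟩
        rw [Finset.mem_compl]
        intro hjI
        exact hc ⟨b, hb, ⟨j, hj, hjI⟩, i, hib, Finset.mem_compl.1 hi⟩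
    · rintro ⟨P, Q⟩ h
      simp only [Finset.mem_product, Finset.mem_filter, Finset.mem_univ, true_and] at h
      obtain ⟨hP, hQ⟩ := h
      refine Prod.ext ?_ ?_
      · ext b
        simp only [Finset.mem_filter, Finset.mem_union]
        refine ⟨fun ⟨h, hb⟩ => h.resolve_right fun hbQ => ?_, fun h => ⟨Or.inl h, hP.subset h⟩⟩
        obtain ⟨i, hi⟩ := hQ.1 b hbQ
        exact Finset.mem_compl.1 (hQ.subset hbQ hi) (hb hi)
      · ext b
        simp only [Finset.mem_filter, Finset.mem_union]
        refine ⟨fun ⟨h, hb⟩ => h.resolve_left fun hbP => ?_, fun h => ⟨Or.inr h, hQ.subset h⟩⟩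
        obtain ⟨i, hi⟩ := hP.1 b hbP
        exact Finset.mem_compl.1 (hb hi) (hP.subset hbP hi)
    · intro P h
      simp only [Finset.mem_filter, Finset.mem_univ, true_and] at h
      ext b
      simp only [Finset.mem_filter, Finset.mem_union]
      refine ⟨fun h => h.elim And.left And.left, fun hb => ?_⟩
      by_cases hbI : b ⊆ I
      · exact Or.inl ⟨hb, hbI⟩
      · refine Or.inr ⟨hb, fun i hi => Finset.mem_compl.2 fun hiI => ?_⟩
        obtain ⟨j, hj, hjI⟩ := Finset.not_subset.1 hbI
        exact h.2 ⟨b, hb, ⟨i, hi, hiI⟩, j, hj, hjI⟩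
    · rintro ⟨P, Q⟩ h
      simp only [Finset.mem_product, Finset.mem_filter, Finset.mem_univ, true_and] at h
      exact (Finset.prod_union (dis P Q h.1 h.2)).symm
  rw [h1, ← Finset.sum_add_distrib, Kset]
  refine Finset.sum_congr rfl fun P _ => ?_
  by_cases hP : IsPartOf Finset.univ P <;> by_cases hc : ∃ b ∈ P, Crosses I b <;> simp [hP, hc]

theorem uset_univ {d : ℕ} (u : ∀ n : ℕ, (Fin n → EucSp d) → ℝ) {n : ℕ} (x : Fin n → EucSp d) :
    uset u Finset.univ x = u n x := by
  have key : ∀ h : (Finset.univ : Finset (Fin n)).card = n,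
      (fun i => x (Finset.univ.orderIsoOfFin h i).1) = x := fun h => by
    have : id = Finset.univ.orderEmbOfFin h :=
      Finset.orderEmbOfFin_unique h (fun i => Finset.mem_univ _) strictMono_id
    funext i
    exact congrArg x (congrFun this i).symm
  have key2 : ∀ (c : ℕ) (h : (Finset.univ : Finset (Fin n)).card = c), c = n →
      uset u Finset.univ x = u c (fun i => x (Finset.univ.orderIsoOfFin h i).1) := by
    rintro c rfl -; rfl
  rw [key2 n (by simp) rfl, key]

theorem ursell_rec {d : ℕ} {k u : ∀ n : ℕ, (Fin n → EucSp d) → ℝ} (hu : IsUrsell k u) {n : ℕ}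
    (hn : 0 < n) (x : Fin n → EucSp d) :
    u n x = k n x - ∑ P : Finset (Finset (Fin n)),
      if IsPartOf Finset.univ P ∧ P ≠ {Finset.univ} then ∏ b ∈ P, uset u b x else 0 := by
  have : Nonempty (Fin n) := ⟨⟨0, hn⟩⟩
  have hU : IsPartOf (Finset.univ : Finset (Fin n)) {Finset.univ} :=
    ⟨by simp, by simp, by simp⟩
  have h1 : k n x = ∑ P : Finset (Finset (Fin n)),
      if IsPartOf Finset.univ P then ∏ b ∈ P, uset u b x else 0 := hu n hn x
  rw [h1, eq_sub_iff_add_eq, ← Finset.add_sum_erase _ _ (Finset.mem_univ {Finset.univ}),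
    ← Finset.add_sum_erase _ (fun P => if IsPartOf Finset.univ P then _ else _)
      (Finset.mem_univ {Finset.univ})]
  simp only [hU, ne_eq, not_true_eq_false, and_false, if_false, if_true, zero_add,
    Finset.prod_singleton, uset_univ]
  congr 1
  refine Finset.sum_congr rfl fun P hP => ?_
  simp [(Finset.mem_erase.1 hP).1]

theorem IsPartOf.card_lt {n : ℕ} {P : Finset (Finset (Fin n))} (h : IsPartOf Finset.univ P)
    (hP : P ≠ {Finset.univ}) {b : Finset (Fin n)} (hb : b ∈ P) : b.card < n := by
  refine lt_of_le_of_ne (by simpa using Finset.card_le_univ b) fun hc => hP ?_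
  have hbu : b = Finset.univ := Finset.eq_univ_of_card _ (by simpa using hc)
  subst hbu
  refine Finset.eq_singleton_iff_unique_mem.2 ⟨hb, fun c hc' => ?_⟩
  by_contra hne
  have := h.2.1 hc' hb hne
  obtain ⟨i, hi⟩ := h.1 c hc'
  exact Finset.disjoint_left.1 this hi (Finset.mem_univ i)

theorem ursell_props {d : ℕ} {μ : Measure (Config d)} {k u : ∀ n : ℕ, (Fin n → EucSp d) → ℝ}
    {ξ : ℝ} (hk : HasCorrFns μ k) (hr : RuelleBound k ξ) (ht : TransInvFns k) (hu : IsUrsell k u)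
    (n : ℕ) (hn : 0 < n) :
    Measurable (u n) ∧ (∃ C : ℝ, 0 ≤ C ∧ ∀ x, |u n x| ≤ C) ∧
      ∀ (a : EucSp d) (x : Fin n → EucSp d), u n (fun i => x i + a) = u n x := by
  induction n using Nat.strong_induction_on with
  | _ n ih =>
    have hrec := fun x => ursell_rec hu hn x
    have hset : ∀ P : Finset (Finset (Fin n)), IsPartOf Finset.univ P → P ≠ {Finset.univ} →
        ∀ b ∈ P, Measurable (u b.card) ∧ (∃ C : ℝ, 0 ≤ C ∧ ∀ x, |u b.card x| ≤ C) ∧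
          ∀ (a : EucSp d) (x : Fin b.card → EucSp d), u b.card (fun i => x i + a) = u b.card x :=
      fun P h1 h2 b hb => ih _ (h1.card_lt h2 hb) (h1.1 b hb).card_pos
    refine ⟨?_, ?_, ?_⟩
    · rw [show u n = fun x => _ from funext hrec]
      refine (hk.1 n).1.sub (Finset.measurable_sum _ fun P _ => ?_)
      by_cases hP : IsPartOf Finset.univ P ∧ P ≠ {Finset.univ}
      · simp only [hP, ne_eq, not_false_eq_true, and_self, if_true]
        refine Finset.measurable_prod _ fun b hb => ?_
        exact (hset P hP.1 hP.2 b hb).1.comp (measurable_pi_lambda _ fun i => measurable_pi_apply _)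
      · simp only [hP, if_false]; exact measurable_const
    · have hc : ∀ P : Finset (Finset (Fin n)), ∃ C : ℝ, 0 ≤ C ∧ ∀ x : Fin n → EucSp d,
          |if IsPartOf Finset.univ P ∧ P ≠ {Finset.univ} then ∏ b ∈ P, uset u b x else 0| ≤ C := by
        intro P
        by_cases hP : IsPartOf Finset.univ P ∧ P ≠ {Finset.univ}
        · choose! C hC0 hC using fun b hb => (hset P hP.1 hP.2 b hb).2.1
          refine ⟨∏ b ∈ P, C b, Finset.prod_nonneg hC0, fun x => ?_⟩
          simp only [hP, ne_eq, not_false_eq_true, and_self, if_true]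
          rw [Finset.abs_prod]
          exact Finset.prod_le_prod (fun _ _ => abs_nonneg _) fun b hb => hC b hb _
        · exact ⟨0, le_rfl, fun x => by simp [hP]⟩
      choose C hC0 hC using hc
      have hξ : (0 : ℝ) ≤ ξ ^ n := ((hk.1 n).2.1 0).trans (hr n hn 0)
      refine ⟨ξ ^ n + ∑ P, C P, add_nonneg hξ (Finset.sum_nonneg fun P _ => hC0 P), fun x => ?_⟩
      rw [hrec]
      refine (abs_sub _ _).trans (add_le_add ?_ ?_)
      · rw [abs_of_nonneg ((hk.1 n).2.1 x)]; exact hr n hn x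
      · exact (Finset.abs_sum_le_sum_abs _ _).trans (Finset.sum_le_sum fun P _ => hC P x)
    · intro a x
      rw [hrec, hrec, ht]
      congr 1
      refine Finset.sum_congr rfl fun P _ => ?_
      by_cases hP : IsPartOf Finset.univ P ∧ P ≠ {Finset.univ}
      · simp only [hP, ne_eq, not_false_eq_true, and_self, if_true]
        exact Finset.prod_congr rfl fun b hb =>
          (hset P hP.1 hP.2 b hb).2.2 a fun i => x (b.orderIsoOfFin rfl i).1
      · simp only [hP, if_false]

/-- `∫ H(x_j) |u(x)| dx = (∫ H) (∫ |u(0, w)| dw)` for translation invariant `u`. -/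
theorem lintegral_transInv {d m : ℕ} {v : (Fin (m + 1) → EucSp d) → ℝ} (hv : Measurable v)
    (ht : ∀ (a : EucSp d) (x : Fin (m + 1) → EucSp d), v (fun i => x i + a) = v x)
    {H : EucSp d → ℝ≥0∞} (hH : Measurable H) (j : Fin (m + 1)) :
    ∫⁻ x, H (x j) * ‖v x‖ₑ = (∫⁻ y, H y) * ∫⁻ w : Fin m → EucSp d, ‖v (Fin.cons 0 w)‖ₑ := by
  have h1 : ∀ (F : (Fin (m + 1) → EucSp d) → ℝ≥0∞), Measurable F →
      ∫⁻ x, F x = ∫⁻ y, ∫⁻ w : Fin m → EucSp d, F (Fin.cons y w) := fun F hF => by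
    rw [← ((volume_preserving_piFinSuccAbove (fun _ : Fin (m + 1) => EucSp d)
      0).symm).lintegral_comp_emb
      (MeasurableEquiv.measurableEmbedding _), Measure.volume_eq_prod, lintegral_prod]
    · refine lintegral_congr fun y => lintegral_congr fun w => congrArg F ?_
      funext i
      refine Fin.cases ?_ (fun i => ?_) i <;> simp [MeasurableEquiv.piFinSuccAbove]
    · exact (hF.comp (MeasurableEquiv.measurable _)).aemeasurable
  have hm : Measurable fun x : Fin (m + 1) → EucSp d => H (x j) * ‖v x‖ₑ :=
    (hH.comp (measurable_pi_apply j)).mul hv.enorm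
  have hcons : Measurable fun p : EucSp d × (Fin m → EucSp d) =>
      (Fin.cons p.1 p.2 : Fin (m + 1) → EucSp d) := by
    refine measurable_pi_lambda _ fun i => ?_
    refine Fin.cases ?_ (fun i => ?_) i
    · exact measurable_fst
    · exact (measurable_pi_apply i).comp measurable_snd
  rw [h1 _ hm]
  have h2 : ∀ y : EucSp d, ∫⁻ w : Fin m → EucSp d,
      H ((Fin.cons y w : Fin (m + 1) → EucSp d) j) * ‖v (Fin.cons y w)‖ₑ =
      ∫⁻ w : Fin m → EucSp d,
        H ((Fin.cons 0 w : Fin (m + 1) → EucSp d) j + y) * ‖v (Fin.cons 0 w)‖ₑ := fun y => by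
    rw [← lintegral_add_right_eq_self _ (fun _ : Fin m => y)]
    have he : ∀ w : Fin m → EucSp d, (Fin.cons y (w + fun _ => y) : Fin (m + 1) → EucSp d) =
        fun i => (Fin.cons 0 w : Fin (m + 1) → EucSp d) i + y := fun w => by
      funext i
      refine Fin.cases ?_ (fun i => ?_) i <;> simp
    refine lintegral_congr fun w => ?_
    rw [he, ht]
  simp_rw [h2]
  rw [lintegral_lintegral_swap]
  · rw [← lintegral_const_mul]
    · refine lintegral_congr fun w => ?_
      rw [lintegral_mul_const]
      · congr 1
        simp_rw [add_comm ((Fin.cons 0 w : Fin (m + 1) → EucSp d) j)]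
        exact lintegral_add_right_eq_self (μ := volume) H _
      · exact hH.comp (measurable_const.add measurable_id)
    · exact (hv.comp (hcons.comp (measurable_const.prodMk measurable_id))).enorm
  · have hc0 : Measurable fun p : EucSp d × (Fin m → EucSp d) =>
      (Fin.cons 0 p.2 : Fin (m + 1) → EucSp d) :=
    hcons.comp (measurable_const.prodMk measurable_snd)
    exact ((hH.comp (((measurable_pi_apply j).comp hc0).add measurable_fst)).mul
      (hv.comp hc0).enorm).aemeasurable

theorem lintegral_reindex {d m : ℕ} {ι : Type*} [Fintype ι] (e : Fin m ≃ ι)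
    (F : (Fin m → EucSp d) → ℝ≥0∞) :
    ∫⁻ x : ι → EucSp d, F (fun i => x (e i)) = ∫⁻ w, F w :=
  ((volume_measurePreserving_piCongrLeft (fun _ : ι => EucSp d) e).symm).lintegral_comp_emb
    (MeasurableEquiv.measurableEmbedding _) F

theorem lintegral_prod_pi_fintype {d : ℕ} {ι : Type*} [Fintype ι] {g : ι → EucSp d → ℝ≥0∞}
    (hg : ∀ i, Measurable (g i)) :
    ∫⁻ x : ι → EucSp d, ∏ i, g i (x i) = ∏ i, ∫⁻ x, g i x := by
  have e := (Fintype.equivFin ι).symm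
  have h := lintegral_reindex (d := d) e fun w => ∏ i, g (e i) (w i)
  rw [lintegral_prod_pi fun i => hg (e i), Equiv.prod_comp e fun i => ∫⁻ x, g i x] at h
  rw [← h]
  refine lintegral_congr fun x => ?_
  exact (Equiv.prod_comp e fun i => g i (x i)).symm

theorem lintegral_block {d n : ℕ} (b : Finset (Fin n)) {F : (Fin b.card → EucSp d) → ℝ≥0∞}
    (hF : Measurable F) {q : Fin n → EucSp d → ℝ≥0∞} (hq : ∀ l, Measurable (q l)) :
    ∫⁻ x : Fin n → EucSp d, F (fun i => x (b.orderIsoOfFin rfl i).1) * ∏ l ∈ bᶜ, q l (x l) =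
      (∫⁻ w, F w) * ∏ l ∈ bᶜ, ∫⁻ x, q l x := by
  have e := volume_preserving_piEquivPiSubtypeProd (fun _ : Fin n => EucSp d) (fun l => l ∈ b)
  have hs : ∀ f : Fin n → ℝ≥0∞, ∏ l ∈ bᶜ, f l = ∏ l : {l // l ∉ b}, f l := fun f =>
    Finset.prod_subtype _ (fun l => Finset.mem_compl) f
  set F1 : ({l // l ∈ b} → EucSp d) → ℝ≥0∞ := fun w => F fun i => w (b.orderIsoOfFin rfl i)
  have hF1 : Measurable F1 := hF.comp (measurable_pi_lambda _ fun i => measurable_pi_apply _)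
  have hQ : Measurable fun w : {l // l ∉ b} → EucSp d => ∏ l, q l.1 (w l) :=
    Finset.measurable_prod _ fun l _ => (hq l.1).comp (measurable_pi_apply l)
  have h1 := e.lintegral_comp_emb (MeasurableEquiv.measurableEmbedding _)
    (fun p => F1 p.1 * ∏ l, q l.1 (p.2 l))
  rw [Measure.volume_eq_prod, lintegral_prod_mul hF1.aemeasurable hQ.aemeasurable,
    lintegral_prod_pi_fintype (g := fun l : {l // l ∉ b} => q l.1) fun l => hq l.1] at h1
  have h2 := @lintegral_reindex d _ {l // l ∈ b} (Subtype.fintype fun l => l ∈ b)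
    (b.orderIsoOfFin rfl).toEquiv F
  rw [hs, ← h2]
  refine Eq.trans (lintegral_congr fun x => ?_) h1
  rw [hs]; rfl

theorem cross_bound {d : ℕ} {μ : Measure (Config d)} {k u : ∀ n : ℕ, (Fin n → EucSp d) → ℝ}
    {ξ : ℝ} (hk : HasCorrFns μ k) (hr : RuelleBound k ξ) (ht : TransInvFns k) (hu : IsUrsell k u)
    (hui : ∀ m : ℕ, Integrable fun y : Fin (m + 1) → EucSp d => u (m + 2) (Fin.cons 0 y))
    {n : ℕ} {P : Finset (Finset (Fin n))} (hP : IsPartOf Finset.univ P) {b : Finset (Fin n)}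
    (hb : b ∈ P) {i j : Fin n} (hi : i ∈ b) (hj : j ∈ b) (hij : i ≠ j) {h : EucSp d → ℝ≥0∞}
    (hh : Measurable h) {M : ℝ≥0∞} (hM : M ≠ ⊤) (hhM : ∀ x, h x ≤ M) (hhi : ∫⁻ x, h x ≠ ⊤) :
    ∃ K : ℝ≥0∞, K ≠ ⊤ ∧ ∀ (y₁ : EucSp d) (c : EucSp d → Fin n → EucSp d),
      (∀ y, c y i = y₁) → (∀ y, c y j = y) →
      ∫⁻ y, ∫⁻ x : Fin n → EucSp d, (∏ l, h (x l - c y l)) * ∏ b ∈ P, ‖uset u b x‖ₑ ≤ K := by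
  have hub := fun b' (hb' : b' ∈ P) =>
    (ursell_props hk hr ht hu b'.card (hP.1 b' hb').card_pos)
  choose! C hC0 hC using fun b' hb' => (hub b' hb').2.1
  obtain ⟨hum, -, hut⟩ := hub b hb
  set i' := (b.orderIsoOfFin rfl).symm ⟨i, hi⟩ with hi'
  set j' := (b.orderIsoOfFin rfl).symm ⟨j, hj⟩ with hj'
  set Λ := ∫⁻ x, h x with hΛ
  set K₀ : ℝ≥0∞ := (∏ l ∈ (b.erase i).erase j, M) * ∏ b' ∈ P.erase b, ENNReal.ofReal (C b') with hK0
  have hcard : 2 ≤ b.card := Finset.one_lt_card.2 ⟨i, hi, j, hj, hij⟩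
  obtain ⟨m, hm⟩ : ∃ m, b.card = m + 2 := ⟨b.card - 2, by omega⟩
  have hfin : ∀ c : EucSp d, ∫⁻ w : Fin b.card → EucSp d, h (w i' - c) * ‖u b.card w‖ₑ =
      Λ * ∫⁻ w : Fin (m + 1) → EucSp d, ‖u (m + 2) (Fin.cons 0 w)‖ₑ := fun c => by
    have : ∀ (N : ℕ) (e : N = m + 2) (i' : Fin N), Measurable (u N) →
        (∀ (a : EucSp d) (x : Fin N → EucSp d), u N (fun i => x i + a) = u N x) →
        ∫⁻ w : Fin N → EucSp d, h (w i' - c) * ‖u N w‖ₑ =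
        Λ * ∫⁻ w : Fin (m + 1) → EucSp d, ‖u (m + 2) (Fin.cons 0 w)‖ₑ := by
      rintro N rfl i' h1 h2
      rw [lintegral_transInv h1 h2 (H := fun x => h (x - c)) (hh.comp (measurable_id.sub_const c)),
        lintegral_sub_right_eq_self (μ := volume) h c]
    exact this _ hm i' hum hut
  refine ⟨K₀ * (∏ l ∈ bᶜ, Λ) * (Λ * (Λ * ∫⁻ w : Fin (m + 1) → EucSp d,
    ‖u (m + 2) (Fin.cons 0 w)‖ₑ)), ?_, fun y₁ c hc1 hc2 => ?_⟩
  · refine ENNReal.mul_ne_top (ENNReal.mul_ne_top (ENNReal.mul_ne_top ?_ ?_) ?_)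
      (ENNReal.mul_ne_top hhi (ENNReal.mul_ne_top hhi (hui m).2.ne))
    · exact ENNReal.prod_ne_top fun _ _ => hM
    · exact ENNReal.prod_ne_top fun _ _ => ENNReal.ofReal_ne_top
    · exact ENNReal.prod_ne_top fun _ _ => hhi
  have hpt : ∀ (y : EucSp d) (x : Fin n → EucSp d),
      (∏ l, h (x l - c y l)) * ∏ b ∈ P, ‖uset u b x‖ₑ ≤
      K₀ * ((h (x i - y₁) * h (x j - y) * ‖uset u b x‖ₑ) * ∏ l ∈ bᶜ, h (x l - c y l)) := by
    intro y x
    have e1 : (∏ l, h (x l - c y l)) =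
        h (x i - y₁) * h (x j - y) * (∏ l ∈ (b.erase i).erase j, h (x l - c y l)) *
          ∏ l ∈ bᶜ, h (x l - c y l) := by
      rw [← Finset.prod_mul_prod_compl b, ← Finset.mul_prod_erase b _ hi,
        ← Finset.mul_prod_erase (b.erase i) _ (Finset.mem_erase.2 ⟨hij.symm, hj⟩), hc1, hc2]
      ring
    rw [e1, ← Finset.mul_prod_erase P _ hb]
    calc _ ≤ h (x i - y₁) * h (x j - y) * (∏ l ∈ (b.erase i).erase j, M) *
          (∏ l ∈ bᶜ, h (x l - c y l)) *
          (‖uset u b x‖ₑ * ∏ b' ∈ P.erase b, ENNReal.ofReal (C b')) := by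
          gcongr with l hl b' hb'
          · exact hhM _
          · rw [Real.enorm_eq_ofReal_abs]
            exact ENNReal.ofReal_le_ofReal (hC b' (Finset.mem_of_mem_erase hb') _)
      _ = _ := by rw [hK0]; ring
  have hstep : ∀ y : EucSp d,
      ∫⁻ x : Fin n → EucSp d, (∏ l, h (x l - c y l)) * ∏ b ∈ P, ‖uset u b x‖ₑ ≤
      K₀ * (∏ l ∈ bᶜ, Λ) * ∫⁻ w : Fin b.card → EucSp d,
        h (w j' - y) * (h (w i' - y₁) * ‖u b.card w‖ₑ) := by
    intro y
    refine (lintegral_mono (hpt y)).trans (le_of_eq ?_)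
    set F : (Fin b.card → EucSp d) → ℝ≥0∞ := fun w =>
      h (w j' - y) * (h (w i' - y₁) * ‖u b.card w‖ₑ) with hF
    have hFm : Measurable F :=
      by fun_prop
    have hq : ∀ l, Measurable fun x => h (x - c y l) := fun l =>
      hh.comp (measurable_id.sub_const _)
    have h3 := lintegral_block b hFm hq
    have h4 : ∀ l, ∫⁻ x, h (x - c y l) = Λ := fun l =>
      lintegral_sub_right_eq_self (μ := volume) h _
    simp_rw [h4] at h3
    rw [mul_assoc, mul_comm (∏ l ∈ bᶜ, Λ), ← h3, ← lintegral_const_mul]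
    · refine lintegral_congr fun x => ?_
      have hxi : x ((b.orderIsoOfFin rfl i').1) = x i := by rw [hi']; simp
      have hxj : x ((b.orderIsoOfFin rfl j').1) = x j := by rw [hj']; simp
      simp only [hF]
      rw [hxi, hxj, uset]
      ring
    · have hFx : Measurable fun x : Fin n → EucSp d => F fun i => x (b.orderIsoOfFin rfl i).1 :=
        hFm.comp (g := F) (f := fun (x : Fin n → EucSp d) i => x (b.orderIsoOfFin rfl i).1)
          (measurable_pi_lambda _ fun i => measurable_pi_apply (b.orderIsoOfFin rfl i).1)
      refine hFx.mul ?_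
      exact Finset.measurable_prod _ fun l _ => (hq l).comp (measurable_pi_apply l)
  refine (lintegral_mono hstep).trans ?_
  rw [lintegral_const_mul]
  · gcongr
    rw [lintegral_lintegral_swap]
    · have : ∀ w : Fin b.card → EucSp d, ∫⁻ y, h (w j' - y) * (h (w i' - y₁) * ‖u b.card w‖ₑ) =
          Λ * (h (w i' - y₁) * ‖u b.card w‖ₑ) := fun w => by
        rw [lintegral_mul_const, lintegral_sub_left_eq_self (μ := volume) h]
        exact hh.comp (measurable_const.sub measurable_id)
      rw [lintegral_congr this, lintegral_const_mul, hfin]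
      fun_prop
    · refine Measurable.aemeasurable ?_
      fun_prop
  · refine Measurable.lintegral_prod_right' (f := fun p : EucSp d × (Fin b.card → EucSp d) =>
      h (p.2 j' - p.1) * (h (p.2 i' - y₁) * ‖u b.card p.2‖ₑ)) ?_
    fun_prop

theorem uset_kz_eq_Kset {d : ℕ} {k u : ∀ n : ℕ, (Fin n → EucSp d) → ℝ} (hu : IsUrsell k u) {n : ℕ}
    (S : Finset (Fin n)) (x : Fin n → EucSp d) : uset (kz k) S x = Kset u S x :=
  kz_eq_Kset hu S x

theorem measurable_uset {d : ℕ} {u : ∀ n : ℕ, (Fin n → EucSp d) → ℝ} {n : ℕ} (b : Finset (Fin n))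
    (h : Measurable (u b.card)) : Measurable (uset u b : (Fin n → EucSp d) → ℝ) :=
  h.comp (g := u b.card) (f := fun (x : Fin n → EucSp d) i => x (b.orderIsoOfFin rfl i).1)
    (measurable_pi_lambda _ fun i => measurable_pi_apply (b.orderIsoOfFin rfl i).1)

/-- The cluster error of the correlation function with respect to the splitting `I ∪ Iᶜ`. -/
def kerr {d : ℕ} (k : ∀ n : ℕ, (Fin n → EucSp d) → ℝ) {n : ℕ} (I : Finset (Fin n))
    (x : Fin n → EucSp d) : ℝ :=
  kz k n x - uset (kz k) I x * uset (kz k) Iᶜ x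

theorem measurable_kerr {d : ℕ} {μ : Measure (Config d)} {k : ∀ n : ℕ, (Fin n → EucSp d) → ℝ}
    (hk : HasCorrFns μ k) {n : ℕ} (I : Finset (Fin n)) : Measurable (kerr k I) :=
  (measurable_kz hk n).sub ((measurable_uset I (measurable_kz hk _)).mul
    (measurable_uset Iᶜ (measurable_kz hk _)))

theorem kerr_enorm_le {d : ℕ} {k u : ∀ n : ℕ, (Fin n → EucSp d) → ℝ} (hu : IsUrsell k u) {n : ℕ}
    (I : Finset (Fin n)) (x : Fin n → EucSp d) :
    ‖kerr k I x‖ₑ ≤ ∑ P, if IsPartOf Finset.univ P ∧ ∃ b ∈ P, Crosses I b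
      then ∏ b ∈ P, ‖uset u b x‖ₑ else 0 := by
  have h : kerr k I x = ∑ P, if IsPartOf Finset.univ P ∧ ∃ b ∈ P, Crosses I b
      then ∏ b ∈ P, uset u b x else 0 := by
    rw [kerr, ← uset_univ (kz k), uset_kz_eq_Kset hu, uset_kz_eq_Kset hu, uset_kz_eq_Kset hu,
      Kset_split u I]
    ring
  rw [h]
  refine (enorm_sum_le _ _).trans (Finset.sum_le_sum fun P _ => ?_)
  split_ifs
  · simp only [enorm_eq_nnnorm, nnnorm_prod]; push_cast; exact le_rfl
  · simp

theorem integral_block {d n : ℕ} (b : Finset (Fin n)) (u v : ∀ n : ℕ, (Fin n → EucSp d) → ℝ) :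
    ∫ x : Fin n → EucSp d, uset u b x * uset v bᶜ x =
      (∫ x, u b.card x) * ∫ x, v bᶜ.card x := by
  have e := volume_preserving_piEquivPiSubtypeProd (fun _ : Fin n => EucSp d) (fun l => l ∈ b)
  have key : ∀ {m : ℕ} {ι : Type} [Fintype ι] (e : Fin m ≃ ι) (F : (Fin m → EucSp d) → ℝ),
      ∫ x : ι → EucSp d, F (fun i => x (e i)) = ∫ w, F w := fun e F =>
    ((volume_measurePreserving_piCongrLeft (fun _ => EucSp d) e).symm).integral_comp
      (MeasurableEquiv.measurableEmbedding _) F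
  let e1 : Fin b.card ≃ {l // l ∈ b} := (b.orderIsoOfFin rfl).toEquiv
  let e2 : Fin bᶜ.card ≃ {l // l ∉ b} := (bᶜ.orderIsoOfFin rfl).toEquiv.trans
    (Equiv.subtypeEquivRight fun l => Finset.mem_compl)
  have h1 := e.integral_comp (MeasurableEquiv.measurableEmbedding _)
    (fun p => u b.card (fun i => p.1 (e1 i)) * v bᶜ.card (fun i => p.2 (e2 i)))
  rw [Measure.volume_eq_prod, integral_prod_mul
    (fun p : ({l // l ∈ b} → EucSp d) => u b.card (fun i => p (e1 i)))
    (fun p : ({l // l ∉ b} → EucSp d) => v bᶜ.card (fun i => p (e2 i)))] at h1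
  have h2 := @key _ {l // l ∈ b} (Subtype.fintype fun l => l ∈ b) e1 (u b.card)
  rw [h2, key e2] at h1
  exact h1

theorem Tn_translate {d : ℕ} {k : ∀ n : ℕ, (Fin n → EucSp d) → ℝ} (ht : TransInvFns k)
    (g : EucSp d → ℝ) (y : EucSp d) (n : ℕ) : Tn k (fun x => g (x - y)) n = Tn k g n := by
  have hk : ∀ x : Fin n → EucSp d, kz k n (x + fun _ => y) = kz k n x := fun x => by
    unfold kz; split_ifs
    · rfl
    · exact ht n y x
  unfold Tn
  rw [← integral_add_right_eq_self _ (fun _ : Fin n => y)]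
  refine integral_congr_ae (Eventually.of_forall fun x => ?_)
  simp [hk]

/-- Translate a point of index in `I` by `y₁`, others by `y₂`. -/
def sh {d n : ℕ} (I : Finset (Fin n)) (y₁ y₂ : EucSp d) (l : Fin n) : EucSp d :=
  if l ∈ I then y₁ else y₂

theorem integral_sh_block {d n : ℕ} {k : ∀ n : ℕ, (Fin n → EucSp d) → ℝ} (ht : TransInvFns k)
    (g : EucSp d → ℝ) (I : Finset (Fin n)) (y₁ y₂ : EucSp d) :
    ∫ x : Fin n → EucSp d, (∏ l, g (x l - sh I y₁ y₂ l)) * (uset (kz k) I x * uset (kz k) Iᶜ x) =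
      Tn k g I.card * Tn k g Iᶜ.card := by
  have h := integral_block I
    (fun n x => (∏ i, g (x i - y₁)) * kz k n x) (fun n x => (∏ i, g (x i - y₂)) * kz k n x)
  have e1 := Tn_translate ht g y₁ I.card
  have e2 := Tn_translate ht g y₂ Iᶜ.card
  unfold Tn at e1 e2 ⊢
  rw [e1, e2] at h
  rw [← h]
  refine integral_congr_ae (Eventually.of_forall fun x => ?_)
  have hp : ∀ (S : Finset (Fin n)) (q : EucSp d → ℝ),
      ∏ i, q (x (S.orderIsoOfFin rfl i).1) = ∏ l ∈ S, q (x l) := fun S q => by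
    rw [← Finset.prod_coe_sort S]
    exact Fintype.prod_equiv (S.orderIsoOfFin rfl).toEquiv _ _ fun i => rfl
  simp only [uset]
  rw [hp I (fun x => g (x - y₁)), hp Iᶜ (fun x => g (x - y₂)), ← Finset.prod_mul_prod_compl I]
  have a1 : ∏ i ∈ I, g (x i - sh I y₁ y₂ i) = ∏ i ∈ I, g (x i - y₁) :=
    Finset.prod_congr rfl fun l hl => by rw [sh, if_pos hl]
  have a2 : ∏ i ∈ Iᶜ, g (x i - sh I y₁ y₂ i) = ∏ i ∈ Iᶜ, g (x i - y₂) :=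
    Finset.prod_congr rfl fun l hl => by rw [sh, if_neg (Finset.mem_compl.1 hl)]
  rw [a1, a2]
  ring

/-- The excess function of the product of two translates of `∏ (1 + g)`. -/
def pairG {d : ℕ} (g : EucSp d → ℝ) (y₁ y₂ x : EucSp d) : ℝ :=
  (1 + g (x - y₁)) * (1 + g (x - y₂)) - 1

theorem Tn_expand {d : ℕ} {μ : Measure (Config d)} {k : ∀ n : ℕ, (Fin n → EucSp d) → ℝ}
    {ξ : ℝ} (hk : HasCorrFns μ k) (hr : RuelleBound k ξ) {A B : EucSp d → ℝ}
    (hA : Integrable A) (hB : Integrable B) (n : ℕ) :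
    Tn k (fun x => A x + B x) n = ∑ S : Finset (Fin n),
      ∫ x : Fin n → EucSp d, (∏ l, (if l ∈ S then A else B) (x l)) * kz k n x := by
  unfold Tn
  rw [← integral_finsetSum]
  · refine integral_congr_ae (Eventually.of_forall fun x => ?_)
    simp only
    rw [Finset.prod_add, Finset.powerset_univ, Finset.sum_mul]
    refine Finset.sum_congr rfl fun S _ => ?_
    rw [← Finset.prod_mul_prod_compl S]
    congr 2
    · exact Finset.prod_congr rfl fun l hl => by rw [if_pos hl]
    · exact Finset.prod_congr (by ext; simp) fun l hl => by
        rw [if_neg (by simpa using hl)]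
  · intro S _
    exact (integrable_prod_kz hk hr (g := fun l => if l ∈ S then A else B) fun l => by
      split_ifs <;> assumption).1

theorem Tn_add_sub_le {d : ℕ} {μ : Measure (Config d)} {k : ∀ n : ℕ, (Fin n → EucSp d) → ℝ}
    {ξ : ℝ} (hk : HasCorrFns μ k) (hr : RuelleBound k ξ) (hξ : 0 ≤ ξ) {A B : EucSp d → ℝ}
    (hA : Integrable A) (hB : Integrable B) {Λ : ℝ} (h1 : 1 ≤ Λ) (hA' : ∫ x, ‖A x‖ ≤ Λ)
    (hB' : ∫ x, ‖B x‖ ≤ Λ) (n : ℕ) :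
    |Tn k (fun x => A x + B x) n - Tn k A n| ≤ 2 ^ n * (ξ * Λ) ^ n * ∫ x, ‖B x‖ := by
  have hTA : Tn k A n = ∫ x : Fin n → EucSp d,
      (∏ l, (if l ∈ (Finset.univ : Finset (Fin n)) then A else B) (x l)) * kz k n x := by
    simp [Tn]
  rw [Tn_expand hk hr hA hB, hTA, ← Finset.add_sum_erase _ _ (Finset.mem_univ Finset.univ),
    add_sub_cancel_left]
  refine (Finset.abs_sum_le_sum_abs _ _).trans ?_
  have hb0 : 0 ≤ ∫ x, ‖B x‖ := integral_nonneg fun _ => norm_nonneg _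
  have hb : ∀ S ∈ (Finset.univ : Finset (Finset (Fin n))).erase Finset.univ,
      |∫ x : Fin n → EucSp d, (∏ l, (if l ∈ S then A else B) (x l)) * kz k n x| ≤
      (ξ * Λ) ^ n * ∫ x, ‖B x‖ := by
    intro S hS
    obtain ⟨l₀, hl₀⟩ : ∃ l, l ∉ S := by
      by_contra! h
      exact (Finset.mem_erase.1 hS).1 (Finset.eq_univ_iff_forall.2 h)
    refine (norm_integral_le_integral_norm _).trans ((integrable_prod_kz hk hr
      (g := fun l => if l ∈ S then A else B) fun l => by split_ifs <;> assumption).2.trans ?_)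
    rw [mul_pow, mul_assoc]
    gcongr
    rw [← Finset.mul_prod_erase _ _ (Finset.mem_univ l₀), if_neg hl₀, mul_comm]
    gcongr
    calc ∏ i ∈ Finset.univ.erase l₀, ∫ x, ‖(if i ∈ S then A else B) x‖
        ≤ ∏ i ∈ Finset.univ.erase l₀, Λ := by
          refine Finset.prod_le_prod (fun _ _ => integral_nonneg fun _ => norm_nonneg _)
            fun i _ => ?_
          split_ifs <;> assumption
      _ ≤ Λ ^ n := by
          rw [Finset.prod_const]
          exact pow_le_pow_right₀ h1 ((Finset.card_le_univ _).trans (by simp))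
  refine (Finset.sum_le_sum hb).trans ?_
  rw [Finset.sum_const, nsmul_eq_mul, mul_assoc]
  gcongr
  calc (((Finset.univ : Finset (Finset (Fin n))).erase Finset.univ).card : ℝ)
      ≤ (Finset.univ : Finset (Finset (Fin n))).card := by
        exact_mod_cast Finset.card_le_card (Finset.erase_subset _ _)
    _ = 2 ^ n := by simp

theorem Tn_cluster {d : ℕ} {μ : Measure (Config d)} {k : ∀ n : ℕ, (Fin n → EucSp d) → ℝ}
    {ξ : ℝ} (hk : HasCorrFns μ k) (hr : RuelleBound k ξ) (hξ : 0 ≤ ξ) (ht : TransInvFns k)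
    {g : EucSp d → ℝ} (hg : Integrable g) {M : ℝ} (hM0 : 0 ≤ M) (hM : ∀ x, ‖g x‖ ≤ M)
    (n : ℕ) (y₁ y₂ : EucSp d) :
    ‖Tn k (pairG g y₁ y₂) n - ∑ I : Finset (Fin n), Tn k g I.card * Tn k g Iᶜ.card‖ₑ ≤
      ENNReal.ofReal (2 ^ n * (ξ * (1 + (2 + M) * ∫ x, ‖g x‖)) ^ n) *
        (∫⁻ x, ‖g (x - y₁)‖ₑ * ‖g (x - y₂)‖ₑ) +
      ∑ I : Finset (Fin n), ∫⁻ x : Fin n → EucSp d,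
        (∏ l, ‖g (x l - sh I y₁ y₂ l)‖ₑ) * ‖kerr k I x‖ₑ := by
  have i1 := hg.comp_sub_right y₁
  have i2 := hg.comp_sub_right y₂
  set A : EucSp d → ℝ := fun x => g (x - y₁) + g (x - y₂) with hA
  set B : EucSp d → ℝ := fun x => g (x - y₁) * g (x - y₂) with hB
  have iA : Integrable A := i1.add i2
  have iB : Integrable B := i1.mul_bdd i2.1 (Eventually.of_forall fun x => hM _)
  have n1 : ∀ y : EucSp d, ∫ x, ‖g (x - y)‖ = ∫ x, ‖g x‖ := fun y =>
    integral_sub_right_eq_self (μ := volume) (fun x => ‖g x‖) y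
  have hg0 : 0 ≤ ∫ x, ‖g x‖ := integral_nonneg fun _ => norm_nonneg _
  have hA' : ∫ x, ‖A x‖ ≤ 2 * ∫ x, ‖g x‖ := by
    calc ∫ x, ‖A x‖ ≤ ∫ x, (‖g (x - y₁)‖ + ‖g (x - y₂)‖) :=
          integral_mono iA.norm (i1.norm.add i2.norm) fun x => norm_add_le _ _
      _ = 2 * ∫ x, ‖g x‖ := by rw [integral_add i1.norm i2.norm, n1, n1]; ring
  have hB' : ∫ x, ‖B x‖ ≤ M * ∫ x, ‖g x‖ := by
    calc ∫ x, ‖B x‖ ≤ ∫ x, M * ‖g (x - y₁)‖ :=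
          integral_mono iB.norm (i1.norm.const_mul M) fun x => by
            simp only [hB, norm_mul]; rw [mul_comm]; gcongr; exact hM _
      _ = M * ∫ x, ‖g x‖ := by rw [integral_const_mul, n1]
  have hG : pairG g y₁ y₂ = fun x => A x + B x := by
    funext x; simp only [pairG, hA, hB]; ring
  have hTA : Tn k A n - ∑ I : Finset (Fin n), Tn k g I.card * Tn k g Iᶜ.card =
      ∑ I : Finset (Fin n), ∫ x : Fin n → EucSp d,
        (∏ l, g (x l - sh I y₁ y₂ l)) * kerr k I x := by
    rw [hA, Tn_expand hk hr i1 i2, ← Finset.sum_sub_distrib]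
    refine Finset.sum_congr rfl fun I _ => ?_
    have hsh : ∀ x : Fin n → EucSp d, (∏ l, g (x l - sh I y₁ y₂ l)) =
        ∏ l, (if l ∈ I then fun x => g (x - y₁) else fun x => g (x - y₂)) (x l) := fun x => by
      refine Finset.prod_congr rfl fun l _ => ?_
      unfold sh; split_ifs <;> rfl
    have hi : ∀ l : Fin n, Integrable fun x => g (x - sh I y₁ y₂ l) := fun l =>
      hg.comp_sub_right _
    have hbd : ∀ (S : Finset (Fin n)) (x : Fin n → EucSp d), ‖uset (kz k) S x‖ ≤ ξ ^ S.card :=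
      fun S x => by
        rw [uset, Real.norm_of_nonneg (kz_nonneg hk _ _)]; exact kz_le hr _ _
    have hi2 : Integrable fun x : Fin n → EucSp d => (∏ l, g (x l - sh I y₁ y₂ l)) *
        (uset (kz k) I x * uset (kz k) Iᶜ x) := by
      refine (Integrable.fintype_prod hi).mul_bdd
        (c := ξ ^ I.card * ξ ^ Iᶜ.card)
        ((measurable_uset I (measurable_kz hk _)).mul
          (measurable_uset Iᶜ (measurable_kz hk _))).aestronglyMeasurable
        (Eventually.of_forall fun x => ?_)
      rw [norm_mul]
      gcongr <;> exact hbd _ _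
    rw [← integral_sh_block ht g I y₁ y₂]
    simp_rw [← hsh]
    rw [← integral_sub (integrable_prod_kz hk hr hi).1 hi2]
    refine integral_congr_ae (Eventually.of_forall fun x => ?_)
    simp only [kerr]; ring
  have hsplit : Tn k (pairG g y₁ y₂) n - ∑ I : Finset (Fin n), Tn k g I.card * Tn k g Iᶜ.card =
      (Tn k (pairG g y₁ y₂) n - Tn k A n) +
      (Tn k A n - ∑ I : Finset (Fin n), Tn k g I.card * Tn k g Iᶜ.card) := by ring
  rw [hsplit]
  refine (enorm_add_le _ _).trans (add_le_add ?_ ?_)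
  · have hm := Tn_add_sub_le hk hr hξ iA iB (Λ := 1 + (2 + M) * ∫ x, ‖g x‖)
      (by nlinarith [mul_nonneg (by linarith : 0 ≤ 2 + M) hg0])
      (by nlinarith [mul_nonneg hM0 hg0]) (by nlinarith [mul_nonneg hM0 hg0]) n
    rw [hG, Real.enorm_eq_ofReal_abs]
    refine (ENNReal.ofReal_le_ofReal hm).trans ?_
    rw [ENNReal.ofReal_mul (by positivity), ofReal_integral_norm_eq_lintegral_enorm iB]
    simp only [hB, enorm_mul]
    exact le_rfl
  · rw [hTA]
    refine (enorm_sum_le _ _).trans (Finset.sum_le_sum fun I _ => ?_)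
    refine (enorm_integral_le_lintegral_enorm _).trans (lintegral_mono fun x => ?_)
    simp only [enorm_mul]
    gcongr
    simp only [enorm_eq_nnnorm, nnnorm_prod]; push_cast; exact le_rfl

theorem measurable_cross {d : ℕ} {μ : Measure (Config d)} {k : ∀ n : ℕ, (Fin n → EucSp d) → ℝ}
    (hk : HasCorrFns μ k) {h : EucSp d → ℝ≥0∞} (hh : Measurable h) {n : ℕ} (I : Finset (Fin n)) :
    Measurable fun p : EucSp d × EucSp d => ∫⁻ x : Fin n → EucSp d,
      (∏ l, h (x l - sh I p.1 p.2 l)) * ‖kerr k I x‖ₑ := by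
  refine Measurable.lintegral_prod_right' (f := fun q : (EucSp d × EucSp d) × (Fin n → EucSp d) =>
    (∏ l, h (q.2 l - sh I q.1.1 q.1.2 l)) * ‖kerr k I q.2‖ₑ) ?_
  refine (Finset.measurable_prod _ fun l _ => ?_).mul
    ((measurable_kerr hk I).comp measurable_snd).enorm
  by_cases hl : l ∈ I
  · simp only [sh, hl, if_true]; fun_prop
  · simp only [sh, hl, if_false]; fun_prop

theorem cross_int {d : ℕ} {μ : Measure (Config d)} {k u : ∀ n : ℕ, (Fin n → EucSp d) → ℝ}
    {ξ : ℝ} (hk : HasCorrFns μ k) (hr : RuelleBound k ξ) (ht : TransInvFns k) (hu : IsUrsell k u)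
    (hui : ∀ m : ℕ, Integrable fun y : Fin (m + 1) → EucSp d => u (m + 2) (Fin.cons 0 y))
    {n : ℕ} (I : Finset (Fin n)) {h : EucSp d → ℝ≥0∞}
    (hh : Measurable h) {M : ℝ≥0∞} (hM : M ≠ ⊤) (hhM : ∀ x, h x ≤ M) (hhi : ∫⁻ x, h x ≠ ⊤) :
    ∃ K : ℝ≥0∞, K ≠ ⊤ ∧ ∀ y₁ : EucSp d, ∫⁻ y₂, ∫⁻ x : Fin n → EucSp d,
      (∏ l, h (x l - sh I y₁ y₂ l)) * ‖kerr k I x‖ₑ ≤ K := by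
  set T : Finset (Finset (Fin n)) → EucSp d → EucSp d → (Fin n → EucSp d) → ℝ≥0∞ :=
    fun P y₁ y₂ x => if IsPartOf Finset.univ P ∧ ∃ b ∈ P, Crosses I b
      then (∏ l, h (x l - sh I y₁ y₂ l)) * ∏ b ∈ P, ‖uset u b x‖ₑ else 0 with hT
  have hTm : ∀ P y₁, Measurable fun q : EucSp d × (Fin n → EucSp d) => T P y₁ q.1 q.2 := by
    intro P y₁
    by_cases hP : IsPartOf Finset.univ P ∧ ∃ b ∈ P, Crosses I b
    · simp only [hT, if_pos hP]
      refine (Finset.measurable_prod _ fun l _ => ?_).mul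
        (Finset.measurable_prod _ fun b hb => ?_)
      · by_cases hl : l ∈ I
        · simp only [sh, hl, if_true]; fun_prop
        · simp only [sh, hl, if_false]; fun_prop
      · exact ((measurable_uset b (ursell_props hk hr ht hu b.card
          (hP.1.1 b hb).card_pos).1).comp measurable_snd).enorm
    · simp only [hT, if_neg hP]; exact measurable_const
  have hK : ∀ P, ∃ K : ℝ≥0∞, K ≠ ⊤ ∧ ∀ y₁ : EucSp d, ∫⁻ y₂, ∫⁻ x, T P y₁ y₂ x ≤ K := by
    intro P
    by_cases hP : IsPartOf Finset.univ P ∧ ∃ b ∈ P, Crosses I b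
    · obtain ⟨hP1, b, hb, ⟨i, hib, hi⟩, j, hjb, hj⟩ := hP
      obtain ⟨K, hK, hK'⟩ := cross_bound hk hr ht hu hui hP1 hb hib hjb
        (fun e => hj (e ▸ hi)) hh hM hhM hhi
      refine ⟨K, hK, fun y₁ => ?_⟩
      have := hK' y₁ (fun y => sh I y₁ y) (fun y => by simp [sh, hi]) (fun y => by simp [sh, hj])
      simp only [hT, if_pos (show IsPartOf Finset.univ P ∧ ∃ b ∈ P, Crosses I b from
        ⟨hP1, b, hb, ⟨i, hib, hi⟩, j, hjb, hj⟩)]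
      exact this
    · exact ⟨0, ENNReal.zero_ne_top, fun y₁ => by simp [hT, if_neg hP]⟩
  choose K hK hK' using hK
  refine ⟨∑ P, K P, ENNReal.sum_ne_top.2 fun P _ => hK P, fun y₁ => ?_⟩
  calc ∫⁻ y₂, ∫⁻ x : Fin n → EucSp d, (∏ l, h (x l - sh I y₁ y₂ l)) * ‖kerr k I x‖ₑ
      ≤ ∫⁻ y₂, ∫⁻ x : Fin n → EucSp d, ∑ P, T P y₁ y₂ x := by
        refine lintegral_mono fun y₂ => lintegral_mono fun x => ?_
        refine (mul_le_mul_right (kerr_enorm_le hu I x) _).trans (le_of_eq ?_)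
        rw [Finset.mul_sum]
        refine Finset.sum_congr rfl fun P _ => ?_
        simp only [hT, mul_ite, mul_zero]
    _ = ∑ P, ∫⁻ y₂, ∫⁻ x : Fin n → EucSp d, T P y₁ y₂ x := by
        rw [← lintegral_finsetSum]
        · refine lintegral_congr fun y₂ => ?_
          rw [lintegral_finsetSum]
          exact fun P _ => (hTm P y₁).comp (measurable_const.prodMk measurable_id)
        · exact fun P _ => (hTm P y₁).lintegral_prod_right'
    _ ≤ ∑ P, K P := Finset.sum_le_sum fun P _ => hK' P y₁

/-- `E ∏_{u ∈ γ} (1 + g u)`, expanded through the correlation functions. -/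
def Lfun {d : ℕ} (k : ∀ n : ℕ, (Fin n → EucSp d) → ℝ) (g : EucSp d → ℝ) : ℝ :=
  ∑' n : ℕ, ((n.factorial : ℝ))⁻¹ * Tn k g n

theorem summable_Lfun {d : ℕ} {μ : Measure (Config d)} {k : ∀ n : ℕ, (Fin n → EucSp d) → ℝ}
    {ξ : ℝ} (hk : HasCorrFns μ k) (hr : RuelleBound k ξ) {g : EucSp d → ℝ} (hg : Integrable g) :
    Summable fun n : ℕ => ‖((n.factorial : ℝ))⁻¹ * Tn k g n‖ := by
  refine Summable.of_nonneg_of_le (fun _ => norm_nonneg _) (fun n => ?_)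
    (Real.summable_pow_div_factorial (ξ * ∫ x, ‖g x‖))
  rw [norm_mul, Real.norm_of_nonneg (by positivity), div_eq_inv_mul]
  gcongr
  exact abs_Tn_le hk hr hg n

theorem Lfun_sq {d : ℕ} {μ : Measure (Config d)} {k : ∀ n : ℕ, (Fin n → EucSp d) → ℝ}
    {ξ : ℝ} (hk : HasCorrFns μ k) (hr : RuelleBound k ξ) {g : EucSp d → ℝ} (hg : Integrable g) :
    Lfun k g ^ 2 = ∑' n : ℕ, ((n.factorial : ℝ))⁻¹ *
      ∑ I : Finset (Fin n), Tn k g I.card * Tn k g Iᶜ.card := by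
  have hs := summable_Lfun hk hr hg
  rw [pow_two, Lfun, tsum_mul_tsum_eq_tsum_sum_range_of_summable_norm hs hs]
  refine tsum_congr fun n => ?_
  have h1 : ∑ I : Finset (Fin n), Tn k g I.card * Tn k g Iᶜ.card =
      ∑ m ∈ Finset.range (n + 1), (n.choose m : ℝ) * (Tn k g m * Tn k g (n - m)) := by
    have := Finset.sum_powerset_apply_card (fun m => Tn k g m * Tn k g (n - m))
      (x := (Finset.univ : Finset (Fin n)))
    simp only [Finset.powerset_univ, Finset.card_univ, Fintype.card_fin, nsmul_eq_mul] at this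
    rw [← this]
    refine Finset.sum_congr rfl fun I _ => ?_
    rw [Finset.card_compl, Fintype.card_fin]
  rw [h1, Finset.mul_sum]
  refine Finset.sum_congr rfl fun m hm => ?_
  have hmn : m ≤ n := Nat.lt_succ_iff.1 (Finset.mem_range.1 hm)
  rw [Nat.cast_choose ℝ hmn]
  have := n.factorial_ne_zero
  field_simp

theorem integral_pairG_le {d : ℕ} {g : EucSp d → ℝ} (hg : Integrable g) {M : ℝ}
    (hM : ∀ x, ‖g x‖ ≤ M) (y₁ y₂ : EucSp d) :
    Integrable (pairG g y₁ y₂) ∧ ∫ x, ‖pairG g y₁ y₂ x‖ ≤ (2 + M) * ∫ x, ‖g x‖ := by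
  have i1 := hg.comp_sub_right y₁
  have i2 := hg.comp_sub_right y₂
  have n1 : ∀ y : EucSp d, ∫ x, ‖g (x - y)‖ = ∫ x, ‖g x‖ := fun y =>
    integral_sub_right_eq_self (μ := volume) (fun x => ‖g x‖) y
  have hG : pairG g y₁ y₂ = fun x => g (x - y₁) + g (x - y₂) + g (x - y₁) * g (x - y₂) := by
    funext x; simp only [pairG]; ring
  have iB : Integrable fun x => g (x - y₁) * g (x - y₂) :=
    i1.mul_bdd i2.1 (Eventually.of_forall fun x => hM _)
  have iG : Integrable (pairG g y₁ y₂) := by rw [hG]; exact (i1.add i2).add iB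
  refine ⟨iG, ?_⟩
  calc ∫ x, ‖pairG g y₁ y₂ x‖ ≤ ∫ x, ((1 + M) * ‖g (x - y₁)‖ + ‖g (x - y₂)‖) := by
        refine integral_mono iG.norm ((i1.norm.const_mul _).add i2.norm) fun x => ?_
        rw [hG]
        refine (norm_add_le _ _).trans ?_
        have h1 := norm_add_le (g (x - y₁)) (g (x - y₂))
        have h2 : ‖g (x - y₁) * g (x - y₂)‖ ≤ ‖g (x - y₁)‖ * M := by
          rw [norm_mul]; gcongr; exact hM _
        nlinarith
    _ = _ := by
        rw [integral_add (i1.norm.const_mul _) i2.norm, integral_const_mul, n1, n1]; ring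

theorem tsum_eq_sum_range_add (f : ℕ → ℝ≥0∞) (N : ℕ) :
    ∑' n, f n = ∑ n ∈ Finset.range N, f n + ∑' n, f (n + N) :=
  (ENNReal.summable.sum_add_tsum_nat_add' (f := f) (k := N)).symm

theorem lintegral_const_mul_add_sum_le {α ι : Type*} [MeasurableSpace α] {ν : Measure α}
    [Fintype ι] (c : ℝ≥0∞) {A : α → ℝ≥0∞} {B : ι → α → ℝ≥0∞} (hA : Measurable A)
    (hB : ∀ i, Measurable (B i)) {a : ℝ≥0∞} {b : ι → ℝ≥0∞} (ha : ∫⁻ x, A x ∂ν ≤ a)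
    (hb : ∀ i, ∫⁻ x, B i x ∂ν ≤ b i) :
    ∫⁻ x, (c * A x + ∑ i, B i x) ∂ν ≤ c * a + ∑ i, b i := by
  rw [lintegral_add_left (hA.const_mul _), lintegral_const_mul _ hA,
    lintegral_finsetSum _ fun i _ => hB i]
  exact add_le_add (by gcongr) (Finset.sum_le_sum fun i _ => hb i)

theorem lintegral_lintegral_mul_sub {d : ℕ} {h : EucSp d → ℝ≥0∞} (hh : Measurable h)
    (y₁ : EucSp d) : ∫⁻ y, ∫⁻ x, h (x - y₁) * h (x - y) = (∫⁻ x, h x) * ∫⁻ x, h x := by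
  rw [lintegral_lintegral_swap (by fun_prop)]
  have : ∀ x, ∫⁻ y, h (x - y₁) * h (x - y) = h (x - y₁) * ∫⁻ x, h x := fun x => by
    rw [lintegral_const_mul _ (by fun_prop), lintegral_sub_left_eq_self (μ := volume) h x]
  rw [lintegral_congr this, lintegral_mul_const _ (by fun_prop),
    lintegral_sub_right_eq_self (μ := volume) h y₁]

theorem cluster_dom {d : ℕ} {μ : Measure (Config d)} {k u : ∀ n : ℕ, (Fin n → EucSp d) → ℝ}
    {ξ : ℝ} (hk : HasCorrFns μ k) (hr : RuelleBound k ξ) (hξ : 0 ≤ ξ) (ht : TransInvFns k)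
    (hu : IsUrsell k u)
    (hui : ∀ m : ℕ, Integrable fun y : Fin (m + 1) → EucSp d => u (m + 2) (Fin.cons 0 y))
    {g : EucSp d → ℝ} (hgm : Measurable g) (hg : Integrable g) {M : ℝ} (hM0 : 0 ≤ M)
    (hM : ∀ x, ‖g x‖ ≤ M) (n : ℕ) :
    ∃ (D : EucSp d → EucSp d → ℝ≥0∞) (K : ℝ≥0∞), K ≠ ⊤ ∧ Measurable (Function.uncurry D) ∧
      (∀ y₁, ∫⁻ y₂, D y₁ y₂ ≤ K) ∧
      ∀ y₁ y₂, ‖Tn k (pairG g y₁ y₂) n - ∑ I : Finset (Fin n), Tn k g I.card * Tn k g Iᶜ.card‖ₑ ≤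
        D y₁ y₂ := by
  have hh : Measurable fun x => ‖g x‖ₑ := hgm.enorm
  have hhM : ∀ x, ‖g x‖ₑ ≤ ENNReal.ofReal M := fun x => by
    rw [← ofReal_norm]; exact ENNReal.ofReal_le_ofReal (hM x)
  choose K hK hK' using fun (I : Finset (Fin n)) =>
    cross_int hk hr ht hu hui I hh ENNReal.ofReal_ne_top hhM hg.2.ne
  have hm1 : Measurable fun p : EucSp d × EucSp d => ∫⁻ x, ‖g (x - p.1)‖ₑ * ‖g (x - p.2)‖ₑ := by
    refine Measurable.lintegral_prod_right' (f := fun q : (EucSp d × EucSp d) × EucSp d =>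
      ‖g (q.2 - q.1.1)‖ₑ * ‖g (q.2 - q.1.2)‖ₑ) ?_
    fun_prop
  refine ⟨_, ENNReal.ofReal (2 ^ n * (ξ * (1 + (2 + M) * ∫ x, ‖g x‖)) ^ n) *
      ((∫⁻ x, ‖g x‖ₑ) * ∫⁻ x, ‖g x‖ₑ) + ∑ I : Finset (Fin n), K I, ?_, ?_, fun y₁ => ?_,
    Tn_cluster hk hr hξ ht hg hM0 hM n⟩
  · refine ENNReal.add_ne_top.2 ⟨?_, ENNReal.sum_ne_top.2 fun I _ => hK I⟩
    exact ENNReal.mul_ne_top ENNReal.ofReal_ne_top (ENNReal.mul_ne_top hg.2.ne hg.2.ne)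
  · exact (hm1.const_mul _).add (Finset.measurable_sum _ fun I _ => measurable_cross hk hh I)
  · have mk : Measurable fun y : EucSp d => (y₁, y) := measurable_const.prodMk measurable_id
    exact lintegral_const_mul_add_sum_le _ (hm1.comp mk)
      (fun I => (measurable_cross hk hh I).comp mk) (lintegral_lintegral_mul_sub hh y₁).le
      fun I => hK' I y₁

theorem cov_bound {d : ℕ} {μ : Measure (Config d)} {k u : ∀ n : ℕ, (Fin n → EucSp d) → ℝ}
    {ξ : ℝ} (hk : HasCorrFns μ k) (hr : RuelleBound k ξ) (hξ : 0 ≤ ξ) (ht : TransInvFns k)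
    (hu : IsUrsell k u)
    (hui : ∀ m : ℕ, Integrable fun y : Fin (m + 1) → EucSp d => u (m + 2) (Fin.cons 0 y))
    {g : EucSp d → ℝ} (hgm : Measurable g) (hg : Integrable g) {M : ℝ} (hM0 : 0 ≤ M)
    (hM : ∀ x, ‖g x‖ ≤ M) {δ : ℝ≥0∞} (hδ : 0 < δ) :
    ∃ (D : EucSp d → EucSp d → ℝ≥0∞) (K : ℝ≥0∞), K ≠ ⊤ ∧ Measurable (Function.uncurry D) ∧
      (∀ y₁, ∫⁻ y₂, D y₁ y₂ ≤ K) ∧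
      ∀ y₁ y₂, ‖Lfun k (pairG g y₁ y₂) - Lfun k g ^ 2‖ₑ ≤ D y₁ y₂ + δ := by
  have hg0 : 0 ≤ ∫ x, ‖g x‖ := integral_nonneg fun _ => norm_nonneg _
  choose Dn K hK hDm hDi hDn using fun n =>
    cluster_dom hk hr hξ ht hu hui hgm hg hM0 hM n
  set R : ℝ := ξ * ((2 + M) * ∫ x, ‖g x‖) with hR
  have hΔ : ∀ n y₁ y₂, ‖((n.factorial : ℝ))⁻¹ * (Tn k (pairG g y₁ y₂) n -
      ∑ I : Finset (Fin n), Tn k g I.card * Tn k g Iᶜ.card)‖ ≤ 2 * (R ^ n / n.factorial) := by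
    intro n y₁ y₂
    obtain ⟨i1, i2⟩ := integral_pairG_le hg hM y₁ y₂
    have h1 : |Tn k (pairG g y₁ y₂) n| ≤ R ^ n := by
      refine (abs_Tn_le hk hr i1 n).trans ?_
      rw [hR]; gcongr
    have h2 : |∑ I : Finset (Fin n), Tn k g I.card * Tn k g Iᶜ.card| ≤ R ^ n := by
      refine (Finset.abs_sum_le_sum_abs _ _).trans ?_
      calc ∑ I : Finset (Fin n), |Tn k g I.card * Tn k g Iᶜ.card|
          ≤ ∑ I : Finset (Fin n), (ξ * ∫ x, ‖g x‖) ^ n := by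
            refine Finset.sum_le_sum fun I _ => ?_
            rw [abs_mul]
            refine (mul_le_mul (abs_Tn_le hk hr hg _) (abs_Tn_le hk hr hg _) (abs_nonneg _)
              (by positivity)).trans (le_of_eq ?_)
            rw [← pow_add, Finset.card_add_card_compl, Fintype.card_fin]
        _ = (2 * (ξ * ∫ x, ‖g x‖)) ^ n := by
            simp [mul_pow]
        _ ≤ R ^ n := by
            refine pow_le_pow_left₀ (by positivity) ?_ n
            rw [hR]
            nlinarith [mul_nonneg hξ (mul_nonneg hM0 hg0)]
    rw [norm_mul, Real.norm_of_nonneg (by positivity), Real.norm_eq_abs]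
    have h3 := (abs_sub (Tn k (pairG g y₁ y₂) n)
      (∑ I : Finset (Fin n), Tn k g I.card * Tn k g Iᶜ.card)).trans (add_le_add h1 h2)
    calc _ ≤ ((n.factorial : ℝ))⁻¹ * (R ^ n + R ^ n) := by gcongr
      _ = _ := by ring
  have hsumR : Summable fun n : ℕ => 2 * (R ^ n / n.factorial) :=
    (Real.summable_pow_div_factorial R).mul_left 2
  have htail := ENNReal.tendsto_sum_nat_add
    (fun n : ℕ => ENNReal.ofReal (2 * (R ^ n / n.factorial))) hsumR.tsum_ofReal_ne_top
  obtain ⟨N, hN⟩ := (htail.eventually (eventually_le_nhds hδ)).exists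
  refine ⟨fun y₁ y₂ => ∑ n ∈ Finset.range N, Dn n y₁ y₂,
    ∑ n ∈ Finset.range N, K n,
    ?_, Finset.measurable_sum _ fun n _ => hDm n, fun y₁ => ?_, fun y₁ y₂ => ?_⟩
  · exact ENNReal.sum_ne_top.2 fun n _ => hK n
  · have hDm' : ∀ n, Measurable fun y₂ => Dn n y₁ y₂ := fun n =>
      (hDm n).comp (measurable_const.prodMk measurable_id)
    change ∫⁻ y₂, ∑ n ∈ Finset.range N, Dn n y₁ y₂ ≤ _
    rw [lintegral_finsetSum _ fun n _ => hDm' n]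
    exact Finset.sum_le_sum fun n _ => hDi n y₁
  · have hL : Lfun k (pairG g y₁ y₂) - Lfun k g ^ 2 = ∑' n : ℕ, ((n.factorial : ℝ))⁻¹ *
        (Tn k (pairG g y₁ y₂) n - ∑ I : Finset (Fin n), Tn k g I.card * Tn k g Iᶜ.card) := by
      have s1 := (summable_Lfun hk hr (integral_pairG_le hg hM y₁ y₂).1).of_norm
      have s2 : Summable fun n : ℕ => ((n.factorial : ℝ))⁻¹ *
          (Tn k (pairG g y₁ y₂) n - ∑ I : Finset (Fin n), Tn k g I.card * Tn k g Iᶜ.card) :=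
        Summable.of_norm_bounded hsumR fun n => hΔ n y₁ y₂
      have s3 : Summable fun n : ℕ => ((n.factorial : ℝ))⁻¹ *
          ∑ I : Finset (Fin n), Tn k g I.card * Tn k g Iᶜ.card := by
        refine (s1.sub s2).congr fun n => ?_
        ring
      rw [Lfun_sq hk hr hg, Lfun, ← s1.tsum_sub s3]
      exact tsum_congr fun n => by ring
    rw [hL]
    refine enorm_tsum_le_tsum_enorm.trans ?_
    refine (tsum_eq_sum_range_add _ N).trans_le ?_
    refine add_le_add (Finset.sum_le_sum fun n _ => ?_) (le_trans ?_ hN)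
    · rw [enorm_mul]
      refine (mul_le_of_le_one_left zero_le ?_).trans
        (hDn n y₁ y₂)
      rw [Real.enorm_of_nonneg (by positivity), ENNReal.ofReal_le_one]
      exact inv_le_one_of_one_le₀ (by exact_mod_cast n.factorial_pos)
    · refine ENNReal.tsum_le_tsum fun n => ?_
      rw [← ofReal_norm]
      exact ENNReal.ofReal_le_ofReal (hΔ _ y₁ y₂)

/-- Functions that are bounded above, vanish at infinity and are integrable far away. -/
structure Tame {d : ℕ} (ψ : EucSp d → ℝ) : Prop where
  meas : Measurable ψ
  bdd : ∃ M, ∀ x, ψ x ≤ M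
  van : Tendsto ψ (cocompact (EucSp d)) (𝓝 0)
  far : ∃ R, IntegrableOn ψ {x | R ≤ ‖x‖}

theorem exists_far_le {d : ℕ} {ψ : EucSp d → ℝ} (h : Tendsto ψ (cocompact (EucSp d)) (𝓝 0))
    {δ : ℝ} (hδ : 0 < δ) : ∃ R, ∀ x, R ≤ ‖x‖ → |ψ x| ≤ δ := by
  have h1 := h.eventually (Metric.ball_mem_nhds 0 hδ)
  rw [← Metric.cobounded_eq_cocompact, ← comap_norm_atTop, eventually_comap] at h1
  obtain ⟨R, hR⟩ := eventually_atTop.1 h1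
  refine ⟨R, fun x hx => ?_⟩
  have := hR ‖x‖ hx x rfl
  rw [dist_zero_right, Real.norm_eq_abs] at this
  exact this.le

theorem Tame.exp_sub_one {d : ℕ} {ψ : EucSp d → ℝ} (h : Tame ψ) :
    (∃ M, 0 ≤ M ∧ ∀ x, ‖Real.exp (ψ x) - 1‖ ≤ M) ∧ Integrable fun x => Real.exp (ψ x) - 1 := by
  obtain ⟨M, hM⟩ := h.bdd
  obtain ⟨R₁, hR₁⟩ := exists_far_le h.van one_pos
  obtain ⟨R₂, hR₂⟩ := h.far
  have hb : ∀ x, ‖Real.exp (ψ x) - 1‖ ≤ Real.exp M + 1 := fun x => by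
    refine (norm_sub_le _ _).trans ?_
    rw [Real.norm_of_nonneg (Real.exp_pos _).le, norm_one]
    gcongr
    exact hM x
  have hm : Measurable fun x => Real.exp (ψ x) - 1 := (Real.measurable_exp.comp h.meas).sub_const 1
  refine ⟨⟨Real.exp M + 1, by positivity, hb⟩, ?_⟩
  set R := max R₁ R₂
  have hs : MeasurableSet {x : EucSp d | R ≤ ‖x‖} :=
    measurableSet_le measurable_const measurable_norm
  rw [← integrableOn_univ, ← union_compl_self {x : EucSp d | R ≤ ‖x‖}]
  refine IntegrableOn.union ?_ ?_
  · have h1 : IntegrableOn ψ {x : EucSp d | R ≤ ‖x‖} :=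
      hR₂.mono_set fun x (hx : R ≤ ‖x‖) => (le_max_right _ _).trans hx
    refine (h1.norm.const_mul 2).mono' hm.aestronglyMeasurable ?_
    refine (ae_restrict_iff' hs).2 (Eventually.of_forall fun x hx => ?_)
    exact Real.abs_exp_sub_one_le (hR₁ x ((le_max_left _ _).trans hx))
  · refine Measure.integrableOn_of_bounded (M := Real.exp M + 1) ?_ hm.aestronglyMeasurable
      (Eventually.of_forall hb)
    have hsub : {x : EucSp d | R ≤ ‖x‖}ᶜ ⊆ Metric.ball 0 R := fun x hx => by
      rw [mem_ball_zero_iff]; exact not_le.1 hx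
    exact ((measure_mono hsub).trans_lt measure_ball_lt_top).ne

theorem Tame.summable {d : ℕ} {μ : Measure (Config d)} [IsProbabilityMeasure μ]
    {k : ∀ n : ℕ, (Fin n → EucSp d) → ℝ} {ξ : ℝ} (hk : HasCorrFns μ k) (hr : RuelleBound k ξ)
    {ψ : EucSp d → ℝ} (h : Tame ψ) (y : EucSp d) :
    ∀ᵐ γ ∂μ, Summable fun u : γ.1 => ψ (u - y) := by
  obtain ⟨R, hR⟩ := h.far
  have hs : MeasurableSet {x : EucSp d | R ≤ ‖x‖} :=
    measurableSet_le measurable_const measurable_norm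
  set H : EucSp d → ℝ≥0∞ := {x : EucSp d | R ≤ ‖x‖}.indicator fun x => ‖ψ x‖ₑ with hH
  have hHm : Measurable H := h.meas.enorm.indicator hs
  have h1 := campbell_le hk hr (h := fun u => H (u - y)) (hHm.comp (measurable_sub_const y))
  rw [lintegral_sub_right_eq_self (μ := volume) H y, hH, lintegral_indicator hs] at h1
  have h2 : ∫⁻ γ, ∑' u : γ.1, H (u - y) ∂μ ≠ ⊤ :=
    (h1.trans_lt (ENNReal.mul_lt_top ENNReal.ofReal_lt_top hR.2)).ne
  have h3 := ae_lt_top (measurable_id.tsum_config (g := fun _ u => H (u - y)) (by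
    unfold Function.uncurry; fun_prop)) h2
  filter_upwards [h3] with γ hγ
  have h4 : Summable fun u : γ.1 => {x : EucSp d | R ≤ ‖x‖}.indicator ψ (u - y) := by
    rw [summable_iff_tsum_enorm]
    refine ne_of_lt (lt_of_le_of_lt (le_of_eq (tsum_congr fun u => ?_)) hγ)
    rw [hH]
    by_cases hu : R ≤ ‖u.1 - y‖
    · rw [indicator_of_mem (by exact hu), indicator_of_mem (by exact hu)]
    · rw [indicator_of_notMem (by exact hu), indicator_of_notMem (by exact hu), enorm_zero]
  have h5 : Summable fun u : γ.1 => {x : EucSp d | R ≤ ‖x‖}ᶜ.indicator ψ (u - y) := by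
    refine summable_of_hasFiniteSupport ?_
    have hf := (γ.2 _ (isCompact_closedBall y R)).preimage (f := ((↑) : γ.1 → EucSp d))
      Subtype.val_injective.injOn
    refine hf.subset fun u hu => ⟨u.2, ?_⟩
    have hm := mem_of_indicator_ne_zero hu
    rw [Metric.mem_closedBall, dist_eq_norm]
    exact (not_le.1 (show ¬ R ≤ ‖u.1 - y‖ from hm)).le
  refine (h4.add h5).congr fun u => ?_
  exact congrFun (indicator_self_add_compl _ ψ) _

theorem Tame.lintegral_le {d : ℕ} {μ : Measure (Config d)} [IsProbabilityMeasure μ]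
    {k : ∀ n : ℕ, (Fin n → EucSp d) → ℝ} {ξ : ℝ} (hk : HasCorrFns μ k) (hr : RuelleBound k ξ)
    {ψ : EucSp d → ℝ} (h : Tame ψ) (y : EucSp d) :
    ∫⁻ γ, ENNReal.ofReal (Real.exp (∑' u : γ.1, ψ (u - y))) ∂μ ≤
      ENNReal.ofReal (Real.exp (ξ * ∫ x, ‖Real.exp (ψ x) - 1‖)) := by
  have h1 := lintegral_exp_le hk hr (ψ := fun u => ψ (u - y)) (h.meas.comp (measurable_sub_const y))
    (h.exp_sub_one.2.comp_sub_right y) (h.summable hk hr y)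
  rwa [integral_sub_right_eq_self (μ := volume) (fun x => ‖Real.exp (ψ x) - 1‖) y] at h1

theorem Tame.integral_eq {d : ℕ} {μ : Measure (Config d)} [IsProbabilityMeasure μ]
    {k : ∀ n : ℕ, (Fin n → EucSp d) → ℝ} {ξ : ℝ} (hk : HasCorrFns μ k) (hr : RuelleBound k ξ)
    (ht : TransInvFns k) {ψ : EucSp d → ℝ} (h : Tame ψ) (y : EucSp d) :
    Integrable (fun γ : Config d => Real.exp (∑' u : γ.1, ψ (u - y))) μ ∧
    ∫ γ, Real.exp (∑' u : γ.1, ψ (u - y)) ∂μ = Lfun k fun x => Real.exp (ψ x) - 1 := by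
  obtain ⟨h1, h2⟩ := expect_exp hk hr (ψ := fun u => ψ (u - y))
    (h.meas.comp (measurable_sub_const y))
    (h.exp_sub_one.2.comp_sub_right y) (h.summable hk hr y)
  refine ⟨h1, h2.trans ?_⟩
  refine tsum_congr fun n => ?_
  rw [Tn_translate ht (fun x => Real.exp (ψ x) - 1) y n]

theorem Tame.integral_pair_eq {d : ℕ} {μ : Measure (Config d)} [IsProbabilityMeasure μ]
    {k : ∀ n : ℕ, (Fin n → EucSp d) → ℝ} {ξ : ℝ} (hk : HasCorrFns μ k) (hr : RuelleBound k ξ)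
    {ψ : EucSp d → ℝ} (h : Tame ψ) (y₁ y₂ : EucSp d) :
    ∫⁻ γ, ENNReal.ofReal (Real.exp (∑' u : γ.1, ψ (u - y₁))) *
      ENNReal.ofReal (Real.exp (∑' u : γ.1, ψ (u - y₂))) ∂μ =
      ENNReal.ofReal (Lfun k (pairG (fun x => Real.exp (ψ x) - 1) y₁ y₂)) := by
  obtain ⟨⟨M, hM0, hM⟩, hi⟩ := h.exp_sub_one
  have s1 := h.summable hk hr y₁
  have s2 := h.summable hk hr y₂
  have e : (fun u => Real.exp (ψ (u - y₁) + ψ (u - y₂)) - 1) =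
      pairG (fun x => Real.exp (ψ x) - 1) y₁ y₂ := by
    funext u; simp only [pairG]; rw [Real.exp_add]; ring
  have hm := h.meas
  obtain ⟨h1, h2⟩ := expect_exp hk hr (ψ := fun u => ψ (u - y₁) + ψ (u - y₂)) (by fun_prop)
    (by rw [e]; exact (integral_pairG_le hi hM y₁ y₂).1)
    (by filter_upwards [s1, s2] with γ a b using a.add b)
  rw [Lfun, ← e, ← h2, ofReal_integral_eq_lintegral_ofReal h1
    (Eventually.of_forall fun _ => (Real.exp_pos _).le)]
  refine lintegral_congr_ae ?_
  filter_upwards [s1, s2] with γ a b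
  rw [a.tsum_add b, Real.exp_add, ENNReal.ofReal_mul (Real.exp_pos _).le]

theorem Tame.of_isC0 {d : ℕ} {f : EucSp d → ℝ} (hf : IsC0 f) : Tame f := by
  refine ⟨hf.1.measurable, ?_, ?_, ⟨0, (hf.1.integrable_of_hasCompactSupport hf.2).integrableOn⟩⟩
  · obtain ⟨C, hC⟩ := hf.1.bounded_above_of_compact_support hf.2
    exact ⟨C, fun x => (le_abs_self _).trans (hC x)⟩
  · rw [← coclosedCompact_eq_cocompact]
    exact Tendsto.congr' (hasCompactSupport_iff_eventuallyEq.1 hf.2).symm tendsto_const_nhds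

/-- The exponential with values in `[0,∞]`. -/
def ex (t : ℝ) : ℝ≥0∞ := ENNReal.ofReal (Real.exp t)

theorem ex_add (a b : ℝ) : ex (a + b) = ex a * ex b := by
  rw [ex, Real.exp_add, ENNReal.ofReal_mul (Real.exp_pos _).le, ex, ex]

theorem ex_ne_top (a : ℝ) : ex a ≠ ⊤ := ENNReal.ofReal_ne_top

theorem ex_pow (a : ℝ) (n : ℕ) : ex a ^ n = ex (n * a) := by
  rw [ex, ex, Real.exp_nat_mul, ENNReal.ofReal_pow (Real.exp_pos _).le]

theorem measurable_ex : Measurable ex := ENNReal.measurable_ofReal.comp Real.measurable_exp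

@[fun_prop]
theorem Measurable.ex {X : Type*} [MeasurableSpace X] {f : X → ℝ} (hf : Measurable f) :
    Measurable fun a => ex (f a) := measurable_ex.comp hf

/-- The real-valued relative energy for a real-valued potential. -/
def En {d : ℕ} (v : EucSp d → ℝ) (x : EucSp d) (γ : Config d) : ℝ := ∑' u : γ.1, v (x - u)

theorem Measurable.En {d : ℕ} {v : EucSp d → ℝ} (hv : Measurable v) {X : Type*} [MeasurableSpace X]
    {x : X → EucSp d} {Γ : X → Config d} (hx : Measurable x) (hΓ : Measurable Γ) :
    Measurable fun a => En v (x a) (Γ a) :=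
  hΓ.tsum_config_real (g := fun a u => v (x a - u)) (by unfold Function.uncurry; fun_prop)

theorem Measurable.cpair {d : ℕ} {f : EucSp d → ℝ} (hf : Measurable f) {X : Type*}
    [MeasurableSpace X] {Γ : X → Config d} (hΓ : Measurable Γ) :
    Measurable fun a => cpair f (Γ a) :=
  hΓ.tsum_config_real (g := fun _ u => f u) (by unfold Function.uncurry; fun_prop)

/-- The consequences of the standing assumptions in terms of a real-valued potential `v`. -/
structure Model {d : ℕ} (s z : ℝ) (v : EucSp d → ℝ) (μ : Measure (Config d)) (m : ℝ≥0∞) :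
    Prop where
  prob : IsProbabilityMeasure μ
  noatoms : NullSingletonClass (volume : Measure (EucSp d))
  hs1 : s ≤ 1 / 2
  vm : Measurable v
  ev : ∀ x, v (-x) = v x
  tame : ∀ c, 0 ≤ c → Tame fun x => -c * v x
  summ : ∀ x, ∀ᵐ γ ∂μ, Summable fun u : γ.1 => v (x - u)
  notMem : ∀ x, ∀ᵐ γ ∂μ, x ∉ γ.1
  gnz : ∀ G : Config d → EucSp d → ℝ≥0∞, Measurable (Function.uncurry G) →
    ∫⁻ γ, ∑' x : γ.1, G (γ.del x) x ∂μ =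
      ENNReal.ofReal z * ∫⁻ x, ∫⁻ γ, ex (-En v x γ) * G γ x ∂μ
  mom : ∀ c, 0 ≤ c → ∃ C : ℝ≥0∞, C ≠ ⊤ ∧ ∀ y, ∫⁻ γ, ex (-c * En v y γ) ∂μ ≤ C
  momf : ∀ h : EucSp d → ℝ, IsC0 h → ∫⁻ γ, ex (cpair h γ) ∂μ ≠ ⊤
  m0 : m ≠ 0
  mtop : m ≠ ⊤
  mean : ∀ y, ∫⁻ γ, ex ((s - 1) * En v y γ) ∂μ = m
  cov : ∀ δ : ℝ≥0∞, 0 < δ → ∃ (D : EucSp d → EucSp d → ℝ≥0∞) (K : ℝ≥0∞), K ≠ ⊤ ∧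
    Measurable (Function.uncurry D) ∧ (∀ y₁, ∫⁻ y₂, D y₁ y₂ ≤ K) ∧
    ∀ y₁ y₂, ∫⁻ γ, ex ((s - 1) * En v y₁ γ) * ex ((s - 1) * En v y₂ γ) ∂μ ≤
      m ^ 2 + (D y₁ y₂ + δ)

/-- The real-valued version of the potential. -/
def rpot {d : ℕ} (φ : EucSp d → EReal) (x : EucSp d) : ℝ := if x = 0 then 0 else (φ x).toReal

theorem measurable_rpot {d : ℕ} {φ : EucSp d → EReal} (h : IsPairPotential φ) :
    Measurable (rpot φ) :=
  Measurable.ite (measurableSet_singleton _) measurable_const h.meas.ereal_toReal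

theorem rpot_neg {d : ℕ} {φ : EucSp d → EReal} (h : IsPairPotential φ) (x : EucSp d) :
    rpot φ (-x) = rpot φ x := by
  unfold rpot
  by_cases hx : x = 0
  · simp [hx]
  · rw [if_neg hx, if_neg (neg_ne_zero.2 hx), h.even x hx]

theorem coe_rpot {d : ℕ} {φ : EucSp d → EReal} (h : IsPairPotential φ) {x : EucSp d} (hx : x ≠ 0) :
    ((rpot φ x : ℝ) : EReal) = φ x := by
  rw [rpot, if_neg hx, EReal.coe_toReal (h.finite_off x hx) (h.ne_bot x)]

theorem neg_le_rpot {d : ℕ} {φ : EucSp d → EReal} {B : ℝ} (h : IsPairPotential φ) (hB : 0 ≤ B)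
    (hs : Stable φ B) (x : EucSp d) : -(2 * B) ≤ rpot φ x := by
  by_cases hx : x = 0
  · simp [rpot, hx, hB]
  · have h1 := hs {0, x}
    have h2 : (({0, x} : Finset (EucSp d)).offDiag) = {(0, x), (x, 0)} := by
      ext ⟨a, b⟩
      simp only [Finset.mem_offDiag, Finset.mem_insert, Finset.mem_singleton, Prod.mk.injEq]
      constructor
      · rintro ⟨rfl | rfl, rfl | rfl, h⟩ <;> simp_all
      · rintro (⟨rfl, rfl⟩ | ⟨rfl, rfl⟩) <;> simp [hx, Ne.symm hx]
    rw [h2, Finset.sum_pair (by simp [Ne.symm hx]), Finset.card_pair (Ne.symm hx)] at h1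
    simp only [zero_sub, sub_zero, h.even x hx, ← coe_rpot h hx] at h1
    rw [← EReal.coe_add, EReal.coe_le_coe_iff] at h1
    push_cast at h1
    linarith

theorem eexp_coe (t : ℝ) : eexp (t : EReal) = ex t := by simp [eexp, ex]

theorem rexp_coe (t : ℝ) : rexp (t : EReal) = Real.exp t := by
  rw [rexp, eexp_coe, ex, ENNReal.toReal_ofReal (Real.exp_pos _).le]

theorem tendsto_rpot {d : ℕ} {φ : EucSp d → EReal} (hvan : PhiVanishes φ) :
    Tendsto (rpot φ) (cocompact (EucSp d)) (𝓝 0) := by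
  have h1 : Tendsto (fun x => (φ x).toReal) (cocompact (EucSp d)) (𝓝 0) :=
    (EReal.tendsto_toReal (a := 0) (by simp) (by simp)).comp hvan
  refine h1.congr' ?_
  have : ({0} : Set (EucSp d))ᶜ ∈ cocompact (EucSp d) := isCompact_singleton.compl_mem_cocompact
  filter_upwards [this] with x hx
  rw [rpot, if_neg (show ¬ x = 0 from hx)]

theorem abs_le_two_mul_abs_exp_neg_sub_one {t : ℝ} (ht : |t| ≤ 1) :
    |t| ≤ 2 * |Real.exp (-t) - 1| := by
  rcases le_total 0 t with h | h
  · have h1 := Real.add_one_le_exp t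
    rw [abs_of_nonneg h] at ht ⊢
    have h2 : Real.exp (-t) * Real.exp t = 1 := by rw [← Real.exp_add]; simp
    have h3 := Real.exp_pos (-t)
    have h4 : Real.exp (-t) ≤ 1 := Real.exp_le_one_iff.2 (by linarith)
    rw [abs_of_nonpos (by linarith)]
    have h5 : Real.exp (-t) * (1 + t) ≤ 1 := by
      calc _ ≤ Real.exp (-t) * Real.exp t := by gcongr; linarith
        _ = 1 := h2
    nlinarith
  · have h1 := Real.add_one_le_exp (-t)
    rw [abs_of_nonpos h, abs_of_nonneg (by linarith)]
    linarith

theorem integrableOn_rpot {d : ℕ} {φ : EucSp d → EReal} {z B : ℝ} (h : IsPairPotential φ)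
    (hz : 0 < z) (hl : LAHT φ z B) (hvan : PhiVanishes φ) :
    ∃ R, IntegrableOn (rpot φ) {x | R ≤ ‖x‖} := by
  obtain ⟨R, hR⟩ := exists_far_le (tendsto_rpot hvan) one_pos
  refine ⟨max R 1, (measurable_rpot h).aestronglyMeasurable, ?_⟩
  have hs : MeasurableSet {x : EucSp d | max R 1 ≤ ‖x‖} :=
    measurableSet_le measurable_const measurable_norm
  refine lt_of_le_of_lt (b := ENNReal.ofReal (2 / z) *
    ∫⁻ x : EucSp d, ENNReal.ofReal (|rexp (-(φ x)) - 1| * z)) ?_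
    (ENNReal.mul_lt_top ENNReal.ofReal_lt_top (hl.trans ENNReal.ofReal_lt_top))
  rw [← lintegral_const_mul' _ _ ENNReal.ofReal_ne_top]
  refine (setLIntegral_mono' hs fun x hx => ?_).trans (setLIntegral_le_lintegral _ _)
  have hx' : max R 1 ≤ ‖x‖ := hx
  have hx0 : x ≠ 0 := by
    rintro rfl
    simp at hx'
    linarith [hx'.2]
  rw [← coe_rpot h hx0, ← EReal.coe_neg, rexp_coe, ← ENNReal.ofReal_mul (by positivity),
    ← ofReal_norm, Real.norm_eq_abs]
  refine ENNReal.ofReal_le_ofReal ((abs_le_two_mul_abs_exp_neg_sub_one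
    (hR x ((le_max_left _ _).trans hx'))).trans (le_of_eq ?_))
  field_simp

theorem Setting.tame {d : ℕ} {s z B ξ : ℝ} {φ : EucSp d → EReal} {μ : Measure (Config d)}
    {k u : ∀ n : ℕ, (Fin n → EucSp d) → ℝ} (h : Setting d s z B ξ φ μ k u)
    (hvan : PhiVanishes φ) {c : ℝ} (hc : 0 ≤ c) : Tame fun x => -c * rpot φ x := by
  obtain ⟨R, hR⟩ := integrableOn_rpot h.pp h.hz h.laht hvan
  refine ⟨(measurable_rpot h.pp).const_mul _, ⟨c * (2 * B), fun x => ?_⟩, ?_, R, hR.const_mul _⟩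
  · have := neg_le_rpot h.pp h.hB h.stable x
    nlinarith
  · simpa using (tendsto_rpot hvan).const_mul (-c)

theorem energy_eq {d : ℕ} {φ : EucSp d → EReal} (h : IsPairPotential φ) {x : EucSp d}
    {γ : Config d} (hx : x ∉ γ.1) (hs : Summable fun u : γ.1 => rpot φ (x - u)) :
    energy φ x γ.1 = (En (rpot φ) x γ : ℝ) := by
  have h0 : ∀ y ∈ γ.1, x - y ≠ 0 := fun y hy => sub_ne_zero.2 fun e => hx (e ▸ hy)
  have h1 : ∀ y : γ.1, (φ (x - y)).toReal = rpot φ (x - y) := fun y => by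
    rw [rpot, if_neg (h0 y y.2)]
  rw [energy, if_pos ⟨fun y hy => h.finite_off _ (h0 y hy), by simpa only [h1] using hs⟩]
  simp only [h1, En]

theorem Config.del_ins {d : ℕ} {γ : Config d} {x : EucSp d} (hx : x ∉ γ.1) :
    (γ.ins x).del x = γ := by
  apply Subtype.ext
  simp only [Config.del, Config.ins]
  exact insert_sdiff_self_of_notMem hx

theorem Config.ins_del {d : ℕ} {γ : Config d} {x : EucSp d} (hx : x ∈ γ.1) :
    (γ.del x).ins x = γ := by
  apply Subtype.ext
  simp only [Config.del, Config.ins]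
  rw [insert_sdiff_singleton, insert_eq_of_mem hx]

theorem measurableSet_summable {d : ℕ} {v : EucSp d → ℝ} (hv : Measurable v) :
    MeasurableSet {p : Config d × EucSp d | Summable fun u : p.1.1 => v (p.2 - u)} := by
  simp only [summable_iff_tsum_enorm]
  refine (MeasurableSet.singleton ⊤).compl.preimage (f := fun p : Config d × EucSp d =>
    ∑' u : p.1.1, ‖v (p.2 - u)‖ₑ) (measurable_fst.tsum_config
      (g := fun (p : Config d × EucSp d) u => ‖v (p.2 - u)‖ₑ) ?_)
  unfold Function.uncurry; fun_prop

theorem Setting.gnz' {d : ℕ} {s z B ξ : ℝ} {φ : EucSp d → EReal} {μ : Measure (Config d)}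
    {k u : ∀ n : ℕ, (Fin n → EucSp d) → ℝ} (h : Setting d s z B ξ φ μ k u)
    [NullSingletonClass (volume : Measure (EucSp d))]
    (hsumm : ∀ x, ∀ᵐ γ ∂μ, Summable fun u : γ.1 => rpot φ (x - u))
    {G : Config d → EucSp d → ℝ≥0∞} (hG : Measurable (Function.uncurry G)) :
    ∫⁻ γ, ∑' x : γ.1, G (γ.del x) x ∂μ =
      ENNReal.ofReal z * ∫⁻ x, ∫⁻ γ, ex (-En (rpot φ) x γ) * G γ x ∂μ := by
  have := h.prob
  have hdel : Measurable fun p : Config d × EucSp d => (p.1.del p.2, p.2) :=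
    (measurable_fst.config_del measurable_snd).prodMk measurable_snd
  rw [h.gnz (fun γ x => G (γ.del x) x) (hG.comp hdel)]
  have hv := measurable_rpot h.pp
  have hE : Measurable fun p : Config d × EucSp d => En (rpot φ) p.2 p.1 :=
    Measurable.En hv measurable_snd measurable_fst
  have hm : Measurable fun p : Config d × EucSp d => ex (-En (rpot φ) p.2 p.1) * G p.1 p.2 :=
    hE.neg.ex.mul hG
  have h1 : ∀ᵐ γ ∂μ, ∀ᵐ x, Summable fun u : γ.1 => rpot φ (x - u) :=
    Measure.ae_ae_comm (p := fun x (γ : Config d) => Summable fun u : γ.1 => rpot φ (x - u))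
      (measurable_swap (measurableSet_summable hv)) |>.1 (Eventually.of_forall hsumm)
  rw [← lintegral_lintegral_swap (f := fun γ x => ex (-En (rpot φ) x γ) * G γ x) hm.aemeasurable,
    ← lintegral_const_mul' _ _ ENNReal.ofReal_ne_top]
  refine lintegral_congr_ae ?_
  filter_upwards [h1] with γ hγ
  rw [← lintegral_const_mul' _ _ ENNReal.ofReal_ne_top]
  refine lintegral_congr_ae ?_
  filter_upwards [hγ, γ.countable.ae_notMem volume] with x hx hxγ
  rw [Config.del_ins hxγ, energy_eq h.pp hxγ hx, ← EReal.coe_neg, eexp_coe, mul_assoc]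

theorem En_eq {d : ℕ} {v : EucSp d → ℝ} (hev : ∀ x, v (-x) = v x) (x : EucSp d) (γ : Config d) :
    En v x γ = ∑' u : γ.1, v (u - x) :=
  tsum_congr fun u => by rw [← hev, neg_sub]

theorem mul_En_eq {d : ℕ} {v : EucSp d → ℝ} (hev : ∀ x, v (-x) = v x) (c : ℝ) (x : EucSp d)
    (γ : Config d) : c * En v x γ = ∑' u : γ.1, c * v (u - x) := by
  rw [En_eq hev, tsum_mul_left]

theorem Setting.exists_model {d : ℕ} {s z B ξ : ℝ} {φ : EucSp d → EReal} {μ : Measure (Config d)}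
    {k u : ∀ n : ℕ, (Fin n → EucSp d) → ℝ} (h : Setting d s z B ξ φ μ k u)
    (hvan : PhiVanishes φ) :
    ∃ m : ℝ≥0∞, Model s z (rpot φ) μ m ∧
      ∫ γ, rexp (((s - 1 : ℝ) : EReal) * totPhi φ γ.1) ∂μ = m.toReal := by
  have := h.prob
  have : Nonempty (Fin d) := ⟨⟨0, h.hd⟩⟩
  have hna : NullSingletonClass (volume : Measure (EucSp d)) := inferInstance
  have hv := measurable_rpot h.pp
  have hev := rpot_neg h.pp
  have hT := fun c (hc : 0 ≤ c) => h.tame hvan hc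
  have hsumm : ∀ x, ∀ᵐ γ ∂μ, Summable fun u : γ.1 => rpot φ (x - u) := fun x => by
    filter_upwards [(hT 1 zero_le_one).summable h.corr h.ruelle x] with γ hγ
    refine hγ.neg.congr fun u => ?_
    rw [← hev, neg_sub]; ring
  have hnm : ∀ x, ∀ᵐ γ ∂μ, x ∉ γ.1 := fun x => by
    have h1 := campbell_le (μ := μ) h.corr h.ruelle (h := ({x} : Set (EucSp d)).indicator 1)
      (measurable_const.indicator (measurableSet_singleton x))
    rw [lintegral_indicator_one (measurableSet_singleton x), measure_singleton, mul_zero,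
      nonpos_iff_eq_zero] at h1
    have hmm : Measurable fun γ : Config d => ∑' u : γ.1, ({x} : Set (EucSp d)).indicator 1 u.1 :=
      Measurable.tsum_config measurable_id (g := fun _ => ({x} : Set (EucSp d)).indicator 1)
        ((measurable_const.indicator (measurableSet_singleton x)).comp measurable_snd)
    replace h1 := (lintegral_eq_zero_iff hmm).1 h1
    filter_upwards [h1] with γ hγ hx
    have h2 := ENNReal.tsum_eq_zero.1 hγ ⟨x, hx⟩
    simp at h2
  have hs := h.hs1
  have hT1 : Tame fun x => (s - 1) * rpot φ x := by
    have := hT (1 - s) (by linarith)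
    simpa only [neg_sub] using this
  obtain ⟨⟨M, hM0, hM⟩, hgi⟩ := hT1.exp_sub_one
  set g : EucSp d → ℝ := fun x => Real.exp ((s - 1) * rpot φ x) - 1 with hg
  have hgm : Measurable g := (Real.measurable_exp.comp hT1.meas).sub_const 1
  have hmean : ∀ y, Integrable (fun γ : Config d => Real.exp ((s - 1) * En (rpot φ) y γ)) μ ∧
      ∫ γ, Real.exp ((s - 1) * En (rpot φ) y γ) ∂μ = Lfun k g := fun y => by
    simp only [mul_En_eq hev]
    exact hT1.integral_eq h.corr h.ruelle h.ti y
  have hpos : 0 < Lfun k g := by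
    rw [← (hmean 0).2]
    exact integral_exp_pos (hmean 0).1
  refine ⟨ENNReal.ofReal (Lfun k g), ?_, ?_⟩
  · refine ⟨h.prob, hna, h.hs1, hv, hev, hT, hsumm, hnm, fun G hG => h.gnz' hsumm hG,
      fun c hc => ⟨ENNReal.ofReal (Real.exp (ξ * ∫ x, ‖Real.exp (-c * rpot φ x) - 1‖)),
        ENNReal.ofReal_ne_top, fun y => ?_⟩, fun f hf => ?_, ?_, ENNReal.ofReal_ne_top,
      fun y => ?_, fun δ hδ => ?_⟩
    · simp only [mul_En_eq hev]
      exact (hT c hc).lintegral_le h.corr h.ruelle y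
    · have h1 := (Tame.of_isC0 hf).lintegral_le (μ := μ) h.corr h.ruelle 0
      simp only [sub_zero] at h1
      exact (h1.trans_lt ENNReal.ofReal_lt_top).ne
    · exact (ENNReal.ofReal_pos.2 hpos).ne'
    · rw [← (hmean y).2, ofReal_integral_eq_lintegral_ofReal (hmean y).1
        (Eventually.of_forall fun _ => (Real.exp_pos _).le)]
      rfl
    · obtain ⟨D, K, hK, hDm, hDK, hD⟩ := cov_bound h.corr h.ruelle h.hξ.le h.ti h.ursell h.ursellInt
        hgm hgi hM0 hM hδ
      refine ⟨D, K, hK, hDm, hDK, fun y₁ y₂ => ?_⟩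
      simp only [mul_En_eq hev]
      refine (hT1.integral_pair_eq h.corr h.ruelle y₁ y₂).trans_le ?_
      rw [← ENNReal.ofReal_pow hpos.le]
      calc ENNReal.ofReal (Lfun k (pairG g y₁ y₂))
          = ENNReal.ofReal (Lfun k g ^ 2 + (Lfun k (pairG g y₁ y₂) - Lfun k g ^ 2)) := by
            congr 1; ring
        _ ≤ ENNReal.ofReal (Lfun k g ^ 2) +
            ENNReal.ofReal (Lfun k (pairG g y₁ y₂) - Lfun k g ^ 2) := ENNReal.ofReal_add_le
        _ ≤ _ := by
            gcongr
            exact (Real.ofReal_le_enorm _).trans (hD y₁ y₂)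
  · rw [ENNReal.toReal_ofReal hpos.le, ← (hmean 0).2]
    refine integral_congr_ae ?_
    filter_upwards [hnm 0, hsumm 0] with γ h0 hγ
    have e : totPhi φ γ.1 = energy φ 0 γ.1 := by
      have h1 : ∀ y ∈ γ.1, φ (0 - y) = φ y := fun y hy => by
        rw [zero_sub, h.pp.even]
        rintro rfl
        exact h0 hy
      have h2 : ∀ y : γ.1, φ (0 - y) = φ y := fun y => h1 y y.2
      have h3 : (∀ y ∈ γ.1, φ (0 - y) ≠ ⊤) ↔ ∀ y ∈ γ.1, φ y ≠ ⊤ :=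
        forall₂_congr fun y hy => by rw [h1 y hy]
      unfold totPhi energy
      simp only [h2, h3]
    rw [e, energy_eq h.pp h0 hγ, ← EReal.coe_mul, rexp_coe]

/-- The squared distance of two elements of `[0,∞]`, through their real parts. -/
def sqd (P Q : ℝ≥0∞) : ℝ≥0∞ := ENNReal.ofReal ((P.toReal - Q.toReal) ^ 2)

theorem sqd_add_eq {P Q : ℝ≥0∞} (hP : P ≠ ⊤) (hQ : Q ≠ ⊤) :
    sqd P Q + 2 * (P * Q) = P ^ 2 + Q ^ 2 := by
  lift P to ℝ≥0 using hP
  lift Q to ℝ≥0 using hQ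
  rw [sqd, ← ENNReal.toReal_eq_toReal_iff' (by finiteness) (by finiteness),
    ENNReal.toReal_add (by finiteness) (by finiteness),
    ENNReal.toReal_add (by finiteness) (by finiteness), ENNReal.toReal_ofReal (sq_nonneg _)]
  simp
  ring

theorem sqd_add_le (P Q : ℝ≥0∞) : sqd P Q + 2 * (P * Q) ≤ P ^ 2 + Q ^ 2 := by
  by_cases hP : P = ⊤
  · simp [hP]
  by_cases hQ : Q = ⊤
  · simp [hQ]
  exact (sqd_add_eq hP hQ).le

theorem sqd_le (P Q : ℝ≥0∞) : sqd P Q ≤ P ^ 2 + Q ^ 2 := le_self_add.trans (sqd_add_le P Q)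

@[fun_prop]
theorem Measurable.sqd {X : Type*} [MeasurableSpace X] {P Q : X → ℝ≥0∞} (hP : Measurable P)
    (hQ : Measurable Q) : Measurable fun a => sqd (P a) (Q a) := by
  unfold _root_.sqd; fun_prop

theorem enorm_sub_sq_eq_sqd (P Q : ℝ≥0∞) : ‖P.toReal - Q.toReal‖ₑ ^ 2 = sqd P Q := by
  rw [sqd, ← Real.enorm_of_nonneg (sq_nonneg _), enorm_pow]

/-- Cauchy-Schwarz with a weight. -/
theorem lintegral_mul_sq_le {X : Type*} [MeasurableSpace X] {ν : Measure X} {h b : X → ℝ≥0∞}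
    (hh : AEMeasurable h ν) (hb : AEMeasurable b ν) :
    (∫⁻ x, h x * b x ∂ν) ^ 2 ≤ (∫⁻ x, h x ∂ν) * ∫⁻ x, h x * b x ^ 2 ∂ν := by
  have h1 := ENNReal.lintegral_mul_le_Lp_mul_Lq ν Real.HolderConjugate.two_two
    (hh.pow_const (1 / 2 : ℝ)) ((hh.pow_const (1 / 2 : ℝ)).mul hb)
  have e1 : ∀ x, h x ^ (1 / 2 : ℝ) * h x ^ (1 / 2 : ℝ) = h x := fun x => by
    rw [← ENNReal.rpow_add_of_nonneg _ _ (by norm_num) (by norm_num)]; norm_num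
  have e2 : ∀ x, (h x ^ (1 / 2 : ℝ)) ^ (2 : ℝ) = h x := fun x => by
    rw [← ENNReal.rpow_mul]; norm_num
  have e3 : ∀ x, (h x ^ (1 / 2 : ℝ) * b x) ^ (2 : ℝ) = h x * b x ^ 2 := fun x => by
    rw [ENNReal.mul_rpow_of_nonneg _ _ (by norm_num), e2]; norm_num
  simp only [Pi.mul_apply, ← mul_assoc, e1, e2, e3] at h1
  calc (∫⁻ x, h x * b x ∂ν) ^ 2 ≤ ((∫⁻ x, h x ∂ν) ^ (1 / 2 : ℝ) *
        (∫⁻ x, h x * b x ^ 2 ∂ν) ^ (1 / 2 : ℝ)) ^ 2 := by gcongr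
    _ = _ := by
      rw [mul_pow, ← ENNReal.rpow_natCast, ← ENNReal.rpow_natCast, ← ENNReal.rpow_mul,
        ← ENNReal.rpow_mul]
      norm_num

theorem tsum_mul_sq_le {d : ℕ} (γ : Config d) {h b : EucSp d → ℝ≥0∞} (hh : Measurable h)
    (hb : Measurable b) :
    (∑' x : γ.1, h x * b x) ^ 2 ≤ (∑' x : γ.1, h x) * ∑' x : γ.1, h x * b x ^ 2 := by
  have := lintegral_mul_sq_le (ν := cmeas γ) hh.aemeasurable hb.aemeasurable
  rwa [lintegral_cmeas γ (fun x => h x * b x), lintegral_cmeas γ h,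
    lintegral_cmeas γ (fun x => h x * b x ^ 2)] at this

theorem mul_le_young {M : ℝ≥0∞} (hM : M ≠ 0) (hM' : M ≠ ⊤) (X T : ℝ≥0∞) :
    X * T ≤ M * T + M⁻¹ * (X ^ 4 + T ^ 2) := by
  rcases le_total X M with h | h
  · exact (mul_le_mul_left h T).trans le_self_add
  · refine le_trans ?_ le_add_self
    have h1 : X ^ 2 * T ≤ X ^ 4 + T ^ 2 := by
      rcases le_total (X ^ 2) T with h2 | h2
      · calc X ^ 2 * T ≤ T * T := by gcongr
          _ = T ^ 2 := (sq T).symm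
          _ ≤ _ := le_add_self
      · calc X ^ 2 * T ≤ X ^ 2 * X ^ 2 := by gcongr
          _ = X ^ 4 := by ring
          _ ≤ _ := le_self_add
    calc X * T = M⁻¹ * (M * X * T) := by
          rw [← mul_assoc, ← mul_assoc, ENNReal.inv_mul_cancel hM hM', one_mul]
      _ ≤ M⁻¹ * (X * X * T) := by gcongr
      _ = M⁻¹ * (X ^ 2 * T) := by ring
      _ ≤ _ := by gcongr

theorem mul_le_sq_add_sq (a b : ℝ≥0∞) : a * b ≤ a ^ 2 + b ^ 2 := by
  rcases le_total a b with h | h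
  · calc a * b ≤ b * b := by gcongr
      _ = b ^ 2 := (sq b).symm
      _ ≤ _ := le_add_self
  · calc a * b ≤ a * a := by gcongr
      _ = a ^ 2 := (sq a).symm
      _ ≤ _ := le_self_add

/-- Jump kernels that are small, even, and normalized. -/
structure Ker {d : ℕ} (c m : ℝ≥0∞) (α : EucSp d → ℝ≥0∞) : Prop where
  meas : Measurable α
  even : ∀ x, α (-x) = α x
  le : ∀ x, α x ≤ c
  int : ∫⁻ x, α x = m⁻¹

theorem Ker.int_sub {d : ℕ} {c m : ℝ≥0∞} {α : EucSp d → ℝ≥0∞} (h : Ker c m α) (x : EucSp d) :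
    ∫⁻ y, α (x - y) = m⁻¹ := by
  rw [lintegral_sub_left_eq_self (μ := volume) α x, h.int]

theorem Ker.int_sub' {d : ℕ} {c m : ℝ≥0∞} {α : EucSp d → ℝ≥0∞} (h : Ker c m α) (x : EucSp d) :
    ∫⁻ y, α (y - x) = m⁻¹ := by
  rw [lintegral_sub_right_eq_self (μ := volume) α x, h.int]

/-- The local average of the jump rates. -/
def Av {d : ℕ} (s : ℝ) (v : EucSp d → ℝ) (α : EucSp d → ℝ≥0∞) (x : EucSp d) (γ : Config d) :
    ℝ≥0∞ := ∫⁻ y, α (x - y) * ex ((s - 1) * En v y γ)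

theorem Measurable.Av {d : ℕ} {s : ℝ} {v : EucSp d → ℝ} {α : EucSp d → ℝ≥0∞} (hv : Measurable v)
    (hα : Measurable α) {X : Type*} [MeasurableSpace X]
    {x : X → EucSp d} {Γ : X → Config d} (hx : Measurable x) (hΓ : Measurable Γ) :
    Measurable fun a => _root_.Av s v α (x a) (Γ a) := by
  have hE : Measurable fun p : X × EucSp d => _root_.En v p.2 (Γ p.1) :=
    Measurable.En hv measurable_snd (hΓ.comp measurable_fst)
  exact Measurable.lintegral_prod_right' (f := fun p : X × EucSp d =>
    α (x p.1 - p.2) * _root_.ex ((s - 1) * _root_.En v p.2 (Γ p.1))) (by fun_prop)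

namespace Model

variable {d : ℕ} {s z : ℝ} {v : EucSp d → ℝ} {μ : Measure (Config d)} {m : ℝ≥0∞}

theorem measurable_rate (H : Model s z v μ m) :
    Measurable fun p : Config d × EucSp d => ex ((s - 1) * En v p.2 p.1) :=
  ((Measurable.En H.vm measurable_snd measurable_fst).const_mul _).ex

theorem measurable_rate_left (H : Model s z v μ m) (y : EucSp d) :
    Measurable fun γ : Config d => ex ((s - 1) * En v y γ) :=
  ((Measurable.En H.vm measurable_const measurable_id).const_mul _).ex

theorem measurable_rate_right (H : Model s z v μ m) (γ : Config d) :
    Measurable fun y : EucSp d => ex ((s - 1) * En v y γ) :=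
  ((Measurable.En H.vm measurable_id measurable_const).const_mul _).ex

theorem lintegral_Av (H : Model s z v μ m) {c : ℝ≥0∞} {α : EucSp d → ℝ≥0∞} (hα : Ker c m α)
    (x : EucSp d) : ∫⁻ γ, Av s v α x γ ∂μ = 1 := by
  have := H.prob
  have hm := hα.meas
  have hr := H.measurable_rate
  unfold Av
  rw [lintegral_lintegral_swap (f := fun γ y => α (x - y) * ex ((s - 1) * En v y γ))
    (((hm.comp (measurable_snd.const_sub x)).mul hr).aemeasurable)]
  have : ∀ y, ∫⁻ γ, α (x - y) * ex ((s - 1) * En v y γ) ∂μ = α (x - y) * m := fun y => by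
    rw [lintegral_const_mul _ (H.measurable_rate_left y), H.mean]
  simp only [this]
  rw [lintegral_mul_const _ (by fun_prop), hα.int_sub, ENNReal.inv_mul_cancel H.m0 H.mtop]

theorem lintegral_Av_sq_le (H : Model s z v μ m) {δ : ℝ≥0∞} (hδ : 0 < δ) :
    ∃ K : ℝ≥0∞, K ≠ ⊤ ∧ ∀ c α, Ker c m α → ∀ x : EucSp d,
      ∫⁻ γ, Av s v α x γ ^ 2 ∂μ ≤ 1 + (m⁻¹ * (c * K) + m⁻¹ * m⁻¹ * δ) := by
  have := H.prob
  obtain ⟨D, K, hK, hDm, hDK, hD⟩ := H.cov δ hδ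
  refine ⟨K, hK, fun c α hα x => ?_⟩
  have hm := hα.meas
  have hr := H.measurable_rate
  have e1 : ∀ γ, Av s v α x γ ^ 2 = ∫⁻ p : EucSp d × EucSp d, (α (x - p.1) * α (x - p.2)) *
      (ex ((s - 1) * En v p.1 γ) * ex ((s - 1) * En v p.2 γ)) := fun γ => by
    have hrr := H.measurable_rate_right γ
    have ha : AEMeasurable (fun y => α (x - y) * ex ((s - 1) * En v y γ)) volume := by fun_prop
    rw [sq, Av, ← lintegral_prod_mul ha ha]
    refine lintegral_congr fun p => ?_
    ring
  have hjm : Measurable fun q : Config d × (EucSp d × EucSp d) => (α (x - q.2.1) * α (x - q.2.2)) *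
      (ex ((s - 1) * En v q.2.1 q.1) * ex ((s - 1) * En v q.2.2 q.1)) := by
    have h1 : Measurable fun q : Config d × (EucSp d × EucSp d) => ex ((s - 1) * En v q.2.1 q.1) :=
      ((Measurable.En H.vm (measurable_fst.comp measurable_snd) measurable_fst).const_mul _).ex
    have h2 : Measurable fun q : Config d × (EucSp d × EucSp d) => ex ((s - 1) * En v q.2.2 q.1) :=
      ((Measurable.En H.vm (measurable_snd.comp measurable_snd) measurable_fst).const_mul _).ex
    fun_prop
  simp only [e1]
  rw [lintegral_lintegral_swap hjm.aemeasurable]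
  have hDm1 : ∀ y₁, Measurable fun y₂ => D y₁ y₂ := fun y₁ =>
    hDm.comp (measurable_const.prodMk measurable_id : Measurable fun y₂ : EucSp d => (y₁, y₂))
  have hDm2 : Measurable fun p : EucSp d × EucSp d => D p.1 p.2 := hDm
  calc ∫⁻ p : EucSp d × EucSp d, ∫⁻ γ, (α (x - p.1) * α (x - p.2)) *
        (ex ((s - 1) * En v p.1 γ) * ex ((s - 1) * En v p.2 γ)) ∂μ
      ≤ ∫⁻ p : EucSp d × EucSp d, (α (x - p.1) * α (x - p.2)) * (m ^ 2 + (D p.1 p.2 + δ)) := by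
        refine lintegral_mono fun p => ?_
        have h1 := H.measurable_rate_left p.1
        have h2 := H.measurable_rate_left p.2
        rw [lintegral_const_mul _ (by fun_prop)]
        gcongr
        exact hD _ _
    _ = ∫⁻ y₁, ∫⁻ y₂, (α (x - y₁) * α (x - y₂)) * (m ^ 2 + (D y₁ y₂ + δ)) :=
        lintegral_prod _ (by fun_prop)
    _ ≤ ∫⁻ y₁, α (x - y₁) * (m⁻¹ * m ^ 2 + (c * K + m⁻¹ * δ)) := by
        refine lintegral_mono fun y₁ => ?_
        have := hDm1 y₁
        simp only [mul_assoc]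
        rw [lintegral_const_mul _ (by fun_prop)]
        gcongr
        simp only [mul_add]
        rw [lintegral_add_left (by fun_prop), lintegral_add_left (by fun_prop),
          lintegral_mul_const _ (by fun_prop), lintegral_mul_const _ (by fun_prop), hα.int_sub]
        gcongr
        calc ∫⁻ y₂, α (x - y₂) * D y₁ y₂ ≤ ∫⁻ y₂, c * D y₁ y₂ := by
              gcongr; exact hα.le _
          _ ≤ c * K := by
              rw [lintegral_const_mul _ this]
              gcongr
              exact hDK y₁
    _ = _ := by
        rw [lintegral_mul_const _ (by fun_prop), hα.int_sub, mul_add, mul_add]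
        congr 1
        · rw [← mul_assoc, sq, mul_mul_mul_comm, ENNReal.inv_mul_cancel H.m0 H.mtop, one_mul]
        · ring

theorem lintegral_Av_four_le (H : Model s z v μ m) :
    ∃ L : ℝ≥0∞, L ≠ ⊤ ∧ ∀ c α, Ker c m α → ∀ x : EucSp d,
      ∫⁻ γ, Av s v α x γ ^ 4 ∂μ ≤ L := by
  have := H.prob
  obtain ⟨C, hC, hCb⟩ := H.mom (4 * (1 - s)) (by linarith [H.hs1])
  have hmi : m⁻¹ ≠ ⊤ := ENNReal.inv_ne_top.2 H.m0
  refine ⟨m⁻¹ ^ 3 * (m⁻¹ * C), by finiteness, fun c α hα x => ?_⟩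
  have hm := hα.meas
  have hr := H.measurable_rate
  have h1 : ∀ γ, Av s v α x γ ^ 4 ≤
      m⁻¹ ^ 3 * ∫⁻ y, α (x - y) * ex ((s - 1) * En v y γ) ^ 4 := fun γ => by
    have hrr := H.measurable_rate_right γ
    have a1 := lintegral_mul_sq_le (ν := volume) (h := fun y => α (x - y))
      (b := fun y => ex ((s - 1) * En v y γ)) (by fun_prop) hrr.aemeasurable
    have a2 := lintegral_mul_sq_le (ν := volume) (h := fun y => α (x - y))
      (b := fun y => ex ((s - 1) * En v y γ) ^ 2) (by fun_prop)
      (hrr.pow_const 2).aemeasurable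
    rw [hα.int_sub] at a1 a2
    calc Av s v α x γ ^ 4 = (Av s v α x γ ^ 2) ^ 2 := by ring
      _ ≤ (m⁻¹ * ∫⁻ y, α (x - y) * ex ((s - 1) * En v y γ) ^ 2) ^ 2 := by gcongr; exact a1
      _ = m⁻¹ ^ 2 * (∫⁻ y, α (x - y) * ex ((s - 1) * En v y γ) ^ 2) ^ 2 := by rw [mul_pow]
      _ ≤ m⁻¹ ^ 2 * (m⁻¹ * ∫⁻ y, α (x - y) * (ex ((s - 1) * En v y γ) ^ 2) ^ 2) := by gcongr
      _ = _ := by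
        rw [← mul_assoc, ← pow_succ]
        congr 1
        refine lintegral_congr fun y => ?_
        rw [← pow_mul]
  have hjm : Measurable fun q : Config d × EucSp d =>
      α (x - q.2) * ex ((s - 1) * En v q.2 q.1) ^ 4 := by fun_prop
  refine (lintegral_mono h1).trans ?_
  rw [lintegral_const_mul _ hjm.lintegral_prod_right', lintegral_lintegral_swap hjm.aemeasurable]
  gcongr
  calc ∫⁻ y, ∫⁻ γ, α (x - y) * ex ((s - 1) * En v y γ) ^ 4 ∂μ ≤ ∫⁻ y, α (x - y) * C := by
        refine lintegral_mono fun y => ?_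
        have h1 := H.measurable_rate_left y
        rw [lintegral_const_mul _ (by fun_prop)]
        gcongr
        refine le_trans (le_of_eq (lintegral_congr fun γ => ?_)) (hCb y)
        rw [ex_pow]
        congr 1
        push_cast
        ring
    _ = _ := by rw [lintegral_mul_const _ (by fun_prop), hα.int_sub]

theorem measurable_Av (H : Model s z v μ m) {c : ℝ≥0∞} {α : EucSp d → ℝ≥0∞} (hα : Ker c m α)
    (x : EucSp d) : Measurable fun γ => Av s v α x γ :=
  Measurable.Av H.vm hα.meas measurable_const measurable_id

theorem sqd_Av_small (H : Model s z v μ m) {δ : ℝ≥0∞} (hδ : 0 < δ) :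
    ∃ c₀ : ℝ≥0∞, 0 < c₀ ∧ ∀ α, Ker c₀ m α → ∀ x : EucSp d,
      ∫⁻ γ, sqd (Av s v α x γ) 1 ∂μ ≤ δ := by
  have := H.prob
  have hmi : m⁻¹ ≠ ⊤ := ENNReal.inv_ne_top.2 H.m0
  have hmi0 : m⁻¹ ≠ 0 := ENNReal.inv_ne_zero.2 H.mtop
  rcases eq_or_ne δ ⊤ with rfl | hδt
  · exact ⟨1, one_pos, fun _ _ _ => le_top⟩
  have hδ2 : 0 < δ / 2 := ENNReal.half_pos hδ.ne'
  obtain ⟨K, hK, hKb⟩ := H.lintegral_Av_sq_le (δ := δ / 2 / (m⁻¹ * m⁻¹))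
    (ENNReal.div_pos hδ2.ne' (by finiteness))
  refine ⟨δ / 2 / (m⁻¹ * K + 1), ENNReal.div_pos hδ2.ne' (by finiteness), fun α hα x => ?_⟩
  have h1 := hKb _ α hα x
  have hA := H.measurable_Av hα x
  have h2 : ∫⁻ γ, sqd (Av s v α x γ) 1 ∂μ + 2 ≤ δ + 2 := by
    calc ∫⁻ γ, sqd (Av s v α x γ) 1 ∂μ + 2
        = ∫⁻ γ, (sqd (Av s v α x γ) 1 + 2 * (Av s v α x γ * 1)) ∂μ := by
          simp only [mul_one]
          rw [lintegral_add_left (by fun_prop), lintegral_const_mul _ hA, H.lintegral_Av hα,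
            mul_one]
      _ ≤ ∫⁻ γ, (Av s v α x γ ^ 2 + 1 ^ 2) ∂μ := lintegral_mono fun γ => sqd_add_le _ _
      _ = ∫⁻ γ, Av s v α x γ ^ 2 ∂μ + 1 := by
          rw [lintegral_add_left (by fun_prop)]; simp
      _ ≤ 1 + (δ / 2 + δ / 2) + 1 := by
          gcongr
          refine h1.trans ?_
          gcongr 1 + (?_ + ?_)
          · calc m⁻¹ * (δ / 2 / (m⁻¹ * K + 1) * K) = δ / 2 / (m⁻¹ * K + 1) * (m⁻¹ * K) := by ring
              _ ≤ δ / 2 / (m⁻¹ * K + 1) * (m⁻¹ * K + 1) := by gcongr; exact le_self_add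
              _ ≤ δ / 2 := by rw [mul_comm]; exact ENNReal.mul_div_le
          · exact ENNReal.mul_div_le
      _ = _ := by rw [ENNReal.add_halves, add_comm 1 δ, add_assoc, one_add_one_eq_two]
  exact (ENNReal.add_le_add_iff_right (by norm_num)).1 h2

theorem mul_sqd_Av_small (H : Model s z v μ m) {L δ : ℝ≥0∞} (hL : L ≠ ⊤) (hδ : 0 < δ) :
    ∃ c₀ : ℝ≥0∞, 0 < c₀ ∧ ∀ α, Ker c₀ m α → ∀ (x : EucSp d) (X : Config d → ℝ≥0∞), Measurable X →
      ∫⁻ γ, X γ ^ 4 ∂μ ≤ L → ∫⁻ γ, X γ * sqd (Av s v α x γ) 1 ∂μ ≤ δ := by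
  have := H.prob
  rcases eq_or_ne δ ⊤ with rfl | hδt
  · exact ⟨1, one_pos, fun _ _ _ _ _ _ => le_top⟩
  have hδ2 : 0 < δ / 2 := ENNReal.half_pos hδ.ne'
  obtain ⟨L', hL', hL'b⟩ := H.lintegral_Av_four_le
  set R : ℝ≥0∞ := L + 2 * (L' + 1) with hR
  have hRt : R ≠ ⊤ := by finiteness
  set M : ℝ≥0∞ := (R + 1) / (δ / 2) with hM
  have hM0 : M ≠ 0 := (ENNReal.div_pos (by simp) (by finiteness)).ne'
  have hMt : M ≠ ⊤ := ENNReal.div_ne_top (by finiteness) hδ2.ne'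
  obtain ⟨c₀, hc₀, hcb⟩ := H.sqd_Av_small (δ := δ / 2 / M) (ENNReal.div_pos hδ2.ne' hMt)
  refine ⟨c₀, hc₀, fun α hα x X hX hXL => ?_⟩
  have hA := H.measurable_Av hα x
  have hT := hcb α hα x
  have hT2 : ∫⁻ γ, sqd (Av s v α x γ) 1 ^ 2 ∂μ ≤ 2 * (L' + 1) := by
    calc ∫⁻ γ, sqd (Av s v α x γ) 1 ^ 2 ∂μ ≤ ∫⁻ γ, 2 * (Av s v α x γ ^ 4 + 1) ∂μ := by
          refine lintegral_mono fun γ => ?_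
          calc sqd (Av s v α x γ) 1 ^ 2 ≤ (Av s v α x γ ^ 2 + 1 ^ 2) ^ 2 := by
                gcongr; exact sqd_le _ _
            _ ≤ 2 ^ (2 - 1) * ((Av s v α x γ ^ 2) ^ 2 + (1 ^ 2) ^ 2) := by
                have := ENNReal.rpow_add_le_mul_rpow_add_rpow (Av s v α x γ ^ 2) (1 ^ 2)
                  (p := 2) (by norm_num)
                norm_num at this ⊢
                exact this
            _ = _ := by norm_num [← pow_mul]
      _ = 2 * (∫⁻ γ, Av s v α x γ ^ 4 ∂μ + 1) := by
          rw [lintegral_const_mul _ (by fun_prop), lintegral_add_left (by fun_prop)]; simp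
      _ ≤ _ := by gcongr; exact hL'b _ α hα x
  calc ∫⁻ γ, X γ * sqd (Av s v α x γ) 1 ∂μ
      ≤ ∫⁻ γ, (M * sqd (Av s v α x γ) 1 + M⁻¹ * (X γ ^ 4 + sqd (Av s v α x γ) 1 ^ 2)) ∂μ :=
        lintegral_mono fun γ => mul_le_young hM0 hMt _ _
    _ = M * ∫⁻ γ, sqd (Av s v α x γ) 1 ∂μ +
        M⁻¹ * (∫⁻ γ, X γ ^ 4 ∂μ + ∫⁻ γ, sqd (Av s v α x γ) 1 ^ 2 ∂μ) := by
        rw [lintegral_add_left (by fun_prop), lintegral_const_mul _ (by fun_prop),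
          lintegral_const_mul _ (by fun_prop), lintegral_add_left (by fun_prop)]
    _ ≤ M * (δ / 2 / M) + M⁻¹ * R := by
        gcongr
        rw [hR]
        exact add_le_add hXL hT2
    _ ≤ δ / 2 + δ / 2 := by
        gcongr
        · exact ENNReal.mul_div_le
        · rw [hM, ENNReal.inv_div (Or.inr (by finiteness)) (Or.inl hδ2.ne')]
          calc δ / 2 / (R + 1) * R ≤ δ / 2 / (R + 1) * (R + 1) := by gcongr; exact le_self_add
            _ ≤ δ / 2 := by rw [mul_comm]; exact ENNReal.mul_div_le
    _ = δ := ENNReal.add_halves δ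

end Model

theorem IsC0.summable {d : ℕ} {f : EucSp d → ℝ} (hf : IsC0 f) (γ : Config d) :
    Summable fun x : γ.1 => f x := by
  refine summable_of_hasFiniteSupport ?_
  have h := (γ.2 _ hf.2).preimage (f := ((↑) : γ.1 → EucSp d)) Subtype.val_injective.injOn
  exact h.subset fun u hu => ⟨u.2, subset_tsupport f hu⟩

theorem IsC0.lin {d : ℕ} {f g : EucSp d → ℝ} (hf : IsC0 f) (hg : IsC0 g) (a b : ℝ) :
    IsC0 fun x => a * f x + b * g x :=
  ⟨(hf.1.const_mul a).add (hg.1.const_mul b), hf.2.mul_left.add hg.2.mul_left⟩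

theorem cpair_lin {d : ℕ} {f g : EucSp d → ℝ} (hf : IsC0 f) (hg : IsC0 g) (a b : ℝ)
    (γ : Config d) :
    cpair (fun x => a * f x + b * g x) γ = a * cpair f γ + b * cpair g γ := by
  unfold cpair
  rw [((hf.summable γ).mul_left a).tsum_add ((hg.summable γ).mul_left b), tsum_mul_left,
    tsum_mul_left]

theorem IsC0.abs_one_sub_exp {d : ℕ} {f : EucSp d → ℝ} (hf : IsC0 f) :
    IsC0 fun x => |1 - Real.exp (f x)| := by
  refine ⟨(continuous_const.sub (Real.continuous_exp.comp hf.1)).abs, ?_⟩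
  exact hf.2.comp_left (g := fun t => |1 - Real.exp t|) (by simp)

theorem IsC0.exists_le {d : ℕ} {f : EucSp d → ℝ} (hf : IsC0 f) : ∃ C, 0 ≤ C ∧ ∀ x, |f x| ≤ C := by
  obtain ⟨C, hC⟩ := hf.2.exists_bound_of_continuous hf.1
  exact ⟨C, (norm_nonneg _).trans (hC 0), hC⟩

theorem IsC0.integrable {d : ℕ} {f : EucSp d → ℝ} (hf : IsC0 f) : Integrable f :=
  hf.1.integrable_of_hasCompactSupport hf.2

theorem le_ex (t : ℝ) : ENNReal.ofReal t ≤ ex t :=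
  ENNReal.ofReal_le_ofReal (by linarith [Real.add_one_le_exp t])

theorem one_le_ex {t : ℝ} (ht : 0 ≤ t) : 1 ≤ ex t := by
  rw [ex, ENNReal.one_le_ofReal]; exact Real.one_le_exp ht

theorem tsum_ofReal_eq_cpair {d : ℕ} {h : EucSp d → ℝ} (hh : IsC0 h) (h0 : ∀ x, 0 ≤ h x)
    (γ : Config d) : ∑' x : γ.1, ENNReal.ofReal (h x) = ENNReal.ofReal (cpair h γ) :=
  (ENNReal.ofReal_tsum_of_nonneg (f := fun x : γ.1 => h x) (fun x => h0 x) (hh.summable γ)).symm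

theorem tsum_eq_add_tsum_del {d : ℕ} (γ : Config d) {x : EucSp d} (hx : x ∈ γ.1)
    (g : EucSp d → ℝ≥0∞) : ∑' u : γ.1, g u = g x + ∑' u : (γ.del x).1, g u := by
  have h := tsum_ins (γ.del x) x g
  rw [Config.ins_del hx] at h
  rw [h]
  congr 1
  refine tsum_congr fun u => if_neg ?_
  exact u.2.2

theorem Ker.mono {d : ℕ} {c c' m : ℝ≥0∞} {α : EucSp d → ℝ≥0∞} (h : Ker c m α) (hc : c ≤ c') :
    Ker c' m α := ⟨h.meas, h.even, fun x => (h.le x).trans hc, h.int⟩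

namespace Model

variable {d : ℕ} {s z : ℝ} {v : EucSp d → ℝ} {μ : Measure (Config d)} {m : ℝ≥0∞}

theorem exists_pow_moment_le (H : Model s z v μ m) {h : EucSp d → ℝ} (hh : IsC0 h) {c : ℝ}
    (hc : 0 ≤ c) (n : ℕ) : ∃ L : ℝ≥0∞, L ≠ ⊤ ∧ ∀ y,
      ∫⁻ γ, (ex (cpair h γ) * ex (-c * En v y γ)) ^ n ∂μ ≤ L := by
  obtain ⟨C, hC, hCb⟩ := H.mom (2 * n * c) (by positivity)
  have h2 := H.momf _ (hh.lin hh (2 * n) 0)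
  refine ⟨_, ENNReal.add_ne_top.2 ⟨h2, hC⟩, fun y => ?_⟩
  have hm : Measurable fun γ => ex (cpair (fun x => 2 * n * h x + 0 * h x) γ) :=
    (Measurable.cpair (hh.lin hh _ _).1.measurable measurable_id).ex
  calc ∫⁻ γ, (ex (cpair h γ) * ex (-c * En v y γ)) ^ n ∂μ
      ≤ ∫⁻ γ, (ex (cpair (fun x => 2 * n * h x + 0 * h x) γ) +
          ex (-(2 * n * c) * En v y γ)) ∂μ := by
        refine lintegral_mono fun γ => ?_
        dsimp only
        rw [cpair_lin hh hh, mul_pow]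
        refine (mul_le_sq_add_sq _ _).trans (le_of_eq ?_)
        rw [ex_pow, ex_pow, ex_pow, ex_pow]
        congr 2 <;> · push_cast; ring
    _ ≤ _ := by
        rw [lintegral_add_left hm]
        gcongr
        exact hCb y

theorem minus_small (H : Model s z v μ m) {f : EucSp d → ℝ} (hf : IsC0 f) {δ : ℝ≥0∞}
    (hδ : 0 < δ) : ∃ c₀ : ℝ≥0∞, 0 < c₀ ∧ ∀ α, Ker c₀ m α →
      ∫⁻ γ, (∑' x : γ.1, ENNReal.ofReal |1 - Real.exp (f x)| * (ex (cpair f (γ.del x)) *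
        ex (s * En v x (γ.del x)) * ‖(Av s v α x (γ.del x)).toReal - 1‖ₑ)) ^ 2 ∂μ ≤ δ := by
  rcases eq_or_ne δ ⊤ with rfl | hδt
  · exact ⟨1, one_pos, fun _ _ => le_top⟩
  have := H.prob
  have hh := hf.abs_one_sub_exp
  set h : EucSp d → ℝ := fun x => |1 - Real.exp (f x)| with hhdef
  have h0 : ∀ x, 0 ≤ h x := fun x => abs_nonneg _
  obtain ⟨C, hC, hCb⟩ := hh.exists_le
  have hI : ∫⁻ x, ENNReal.ofReal (h x) ≠ ⊤ := hh.integrable.lintegral_lt_top.ne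
  set I := ∫⁻ x, ENNReal.ofReal (h x) with hIdef
  obtain ⟨L, hL, hLb⟩ := H.exists_pow_moment_le (hh.lin hf 1 2) (c := 1 - 2 * s)
    (by linarith [H.hs1]) 4
  obtain ⟨c₀, hc₀, hcb⟩ := H.mul_sqd_Av_small (L := ENNReal.ofReal (C + 1) ^ 4 * L)
    (δ := δ / (ENNReal.ofReal z * I + 1)) (by finiteness)
    (ENNReal.div_pos hδ.ne' (by finiteness))
  refine ⟨c₀, hc₀, fun α hα => ?_⟩
  have hhm : Measurable fun x => ENNReal.ofReal (h x) := hh.1.measurable.ennreal_ofReal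
  have hfm : Measurable f := hf.1.measurable
  have hNm : Measurable fun γ : Config d => ∑' u : γ.1, ENNReal.ofReal (h u) :=
    measurable_id.tsum_config (g := fun _ u => ENNReal.ofReal (h u)) (hhm.comp measurable_snd)
  have hGm : ∀ {Y : Type} [MeasurableSpace Y] {Γ : Y → Config d} {x : Y → EucSp d},
      Measurable Γ → Measurable x → Measurable fun a => ex (cpair f (Γ a)) *
        ex (s * En v (x a) (Γ a)) * ‖(Av s v α (x a) (Γ a)).toReal - 1‖ₑ := by
    intro Y _ Γ x hΓ hx
    have h1 := Measurable.cpair hfm hΓ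
    have h2 := Measurable.En H.vm hx hΓ
    have h3 := Measurable.Av (s := s) H.vm hα.meas hx hΓ
    fun_prop
  set G : Config d → EucSp d → ℝ≥0∞ := fun γ x => ex (cpair f γ) * ex (s * En v x γ) *
    ‖(Av s v α x γ).toReal - 1‖ₑ with hG
  have hGu : Measurable (Function.uncurry G) := hGm measurable_fst measurable_snd
  have hNu : Measurable fun p : Config d × EucSp d => ∑' u : p.1.1, ENNReal.ofReal (h u) :=
    hNm.comp measurable_fst
  have key : ∀ γ : Config d, (∑' x : γ.1, ENNReal.ofReal (h x) * G (γ.del x) x) ^ 2 ≤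
      ∑' x : γ.1, ENNReal.ofReal (h x) * G (γ.del x) x ^ 2 *
        (ENNReal.ofReal (h x) + ∑' u : (γ.del x).1, ENNReal.ofReal (h u)) := fun γ => by
    refine (tsum_mul_sq_le γ hhm (b := fun x => G (γ.del x) x)
      (hGm (measurable_const.config_del measurable_id) measurable_id)).trans (le_of_eq ?_)
    rw [← ENNReal.tsum_mul_left]
    refine tsum_congr fun x => ?_
    rw [tsum_eq_add_tsum_del γ x.2 fun u => ENNReal.ofReal (h u), mul_comm]
  refine (lintegral_mono key).trans ?_
  rw [H.gnz (fun γ x => ENNReal.ofReal (h x) * G γ x ^ 2 *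
    (ENNReal.ofReal (h x) + ∑' u : γ.1, ENNReal.ofReal (h u))) (by
      unfold Function.uncurry at hGu ⊢; fun_prop)]
  have hx : ∀ x, ∫⁻ γ, ex (-En v x γ) * (ENNReal.ofReal (h x) * G γ x ^ 2 *
      (ENNReal.ofReal (h x) + ∑' u : γ.1, ENNReal.ofReal (h u))) ∂μ ≤
      ENNReal.ofReal (h x) * (δ / (ENNReal.ofReal z * I + 1)) := fun x => by
    have hE : Measurable fun γ : Config d => En v x γ :=
      Measurable.En H.vm measurable_const measurable_id
    have hF : Measurable fun γ : Config d => cpair f γ := Measurable.cpair hfm measurable_id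
    have hA := H.measurable_Av hα x
    set X : Config d → ℝ≥0∞ := fun γ =>
      (ENNReal.ofReal (h x) + ∑' u : γ.1, ENNReal.ofReal (h u)) * (ex (2 * cpair f γ) *
        ex (-(1 - 2 * s) * En v x γ)) with hX
    have hXm : Measurable X := by fun_prop
    have e1 : ∀ γ, ex (-En v x γ) * (ENNReal.ofReal (h x) * G γ x ^ 2 *
        (ENNReal.ofReal (h x) + ∑' u : γ.1, ENNReal.ofReal (h u))) =
        ENNReal.ofReal (h x) * (X γ * sqd (Av s v α x γ) 1) := fun γ => by
      have e2 : ex (-(1 - 2 * s) * En v x γ) = ex (-En v x γ) * ex (s * En v x γ) ^ 2 := by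
        rw [ex_pow, ← ex_add]; congr 1; push_cast; ring
      have e3 : ex (2 * cpair f γ) = ex (cpair f γ) ^ 2 := by rw [ex_pow]; norm_num
      simp only [hG, hX]
      rw [e2, e3, mul_pow, ← ENNReal.toReal_one, enorm_sub_sq_eq_sqd]
      ring
    simp only [e1]
    rw [lintegral_const_mul _ (by fun_prop)]
    gcongr
    refine hcb α hα x X hXm ?_
    calc ∫⁻ γ, X γ ^ 4 ∂μ ≤ ∫⁻ γ, ENNReal.ofReal (C + 1) ^ 4 *
          (ex (cpair (fun x => 1 * h x + 2 * f x) γ) * ex (-(1 - 2 * s) * En v x γ)) ^ 4 ∂μ := by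
          refine lintegral_mono fun γ => ?_
          dsimp only
          rw [← mul_pow, cpair_lin hh hf, one_mul, ex_add]
          simp only [hX]
          rw [← mul_assoc, ← mul_assoc, ← mul_assoc]
          gcongr
          rw [tsum_ofReal_eq_cpair hh h0]
          have hc0 : 0 ≤ cpair h γ := tsum_nonneg fun x => h0 x
          calc ENNReal.ofReal (h x) + ENNReal.ofReal (cpair h γ)
              ≤ ENNReal.ofReal C * ex (cpair h γ) + 1 * ex (cpair h γ) := by
                rw [one_mul]
                refine add_le_add ?_ (le_ex _)
                calc ENNReal.ofReal (h x) ≤ ENNReal.ofReal C * 1 := by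
                      rw [mul_one]
                      exact ENNReal.ofReal_le_ofReal ((le_abs_self _).trans (hCb x))
                  _ ≤ _ := by gcongr; exact one_le_ex hc0
            _ = _ := by
                rw [← add_mul, ENNReal.ofReal_add hC zero_le_one, ENNReal.ofReal_one]
      _ ≤ _ := by
          rw [lintegral_const_mul' _ _ (by finiteness)]
          gcongr
          exact hLb x
  calc ENNReal.ofReal z * ∫⁻ x, ∫⁻ γ, ex (-En v x γ) * (ENNReal.ofReal (h x) * G γ x ^ 2 *
      (ENNReal.ofReal (h x) + ∑' u : γ.1, ENNReal.ofReal (h u))) ∂μ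
      ≤ ENNReal.ofReal z * ∫⁻ x, ENNReal.ofReal (h x) * (δ / (ENNReal.ofReal z * I + 1)) := by
        gcongr with x
        exact hx x
    _ = ENNReal.ofReal z * I * (δ / (ENNReal.ofReal z * I + 1)) := by
        rw [lintegral_mul_const _ hhm, mul_assoc]
    _ ≤ (ENNReal.ofReal z * I + 1) * (δ / (ENNReal.ofReal z * I + 1)) := by
        gcongr; exact le_self_add
    _ ≤ δ := ENNReal.mul_div_le

end Model

/-- The birth rate of the Glauber dynamics at `y`, times the test function. -/
def Wt {d : ℕ} (s : ℝ) (v f : EucSp d → ℝ) (y : EucSp d) (γ : Config d) : ℝ≥0∞ :=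
  ex ((s - 1) * En v y γ) * ex (cpair f γ)

/-- The contribution of jumps from `x` to `y`. -/
def pk {d : ℕ} (s : ℝ) (v f : EucSp d → ℝ) (α : EucSp d → ℝ≥0∞) (y x : EucSp d) (γ : Config d) :
    ℝ≥0∞ := α (x - y) * ex (s * En v x γ) * Wt s v f y γ

/-- The total contribution of jumps to `y`. -/
def Pt {d : ℕ} (s : ℝ) (v f : EucSp d → ℝ) (α : EucSp d → ℝ≥0∞) (y : EucSp d) (γ : Config d) :
    ℝ≥0∞ := ∑' x : γ.1, pk s v f α y x (γ.del x)

section Measurability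

variable {d : ℕ} {s : ℝ} {v f : EucSp d → ℝ} {α : EucSp d → ℝ≥0∞} {X : Type*}
  [MeasurableSpace X] {x y : X → EucSp d} {Γ : X → Config d}

theorem Measurable.Wt (hv : Measurable v) (hf : Measurable f) (hy : Measurable y)
    (hΓ : Measurable Γ) : Measurable fun a => _root_.Wt s v f (y a) (Γ a) :=
  ((Measurable.En hv hy hΓ).const_mul _).ex.mul (Measurable.cpair hf hΓ).ex

theorem Measurable.pk (hv : Measurable v) (hf : Measurable f) (hα : Measurable α)
    (hy : Measurable y) (hx : Measurable x) (hΓ : Measurable Γ) :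
    Measurable fun a => _root_.pk s v f α (y a) (x a) (Γ a) :=
  ((hα.comp (hx.sub hy)).mul ((Measurable.En hv hx hΓ).const_mul _).ex).mul
    (Measurable.Wt hv hf hy hΓ)

theorem Measurable.Pt (hv : Measurable v) (hf : Measurable f) (hα : Measurable α)
    (hy : Measurable y) (hΓ : Measurable Γ) :
    Measurable fun a => _root_.Pt s v f α (y a) (Γ a) :=
  hΓ.tsum_config (g := fun a x => _root_.pk s v f α (y a) x ((Γ a).del x))
    (Measurable.pk hv hf hα (hy.comp measurable_fst) measurable_snd
      ((hΓ.comp measurable_fst).config_del measurable_snd))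

end Measurability

theorem tsum_ins_real {d : ℕ} {γ : Config d} {x : EucSp d} (hx : x ∉ γ.1) {g : EucSp d → ℝ}
    (hg : Summable fun u : γ.1 => g u) : ∑' u : (γ.ins x).1, g u = g x + ∑' u : γ.1, g u := by
  have h1 : (γ.ins x).1 = {x} ∪ γ.1 := rfl
  rw [h1, Summable.tsum_union_disjoint (Set.disjoint_singleton_left.2 hx) Summable.of_finite hg,
    tsum_singleton]

theorem En_ins {d : ℕ} {γ : Config d} {x y : EucSp d} {v : EucSp d → ℝ} (hx : x ∉ γ.1)
    (h : Summable fun u : γ.1 => v (y - u)) : En v y (γ.ins x) = v (y - x) + En v y γ :=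
  tsum_ins_real (g := fun u => v (y - u)) hx h

theorem cpair_ins {d : ℕ} {γ : Config d} {x : EucSp d} {f : EucSp d → ℝ} (hx : x ∉ γ.1)
    (hf : IsC0 f) : cpair f (γ.ins x) = f x + cpair f γ :=
  tsum_ins_real hx (hf.summable γ)

theorem Wt_ins {d : ℕ} {s : ℝ} {γ : Config d} {x y : EucSp d} {v f : EucSp d → ℝ} (hx : x ∉ γ.1)
    (h : Summable fun u : γ.1 => v (y - u)) (hf : IsC0 f) :
    Wt s v f y (γ.ins x) = ex ((s - 1) * v (y - x) + f x) * Wt s v f y γ := by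
  rw [Wt, Wt, En_ins hx h, cpair_ins hx hf, mul_add, ex_add, ex_add, ex_add]
  ring

theorem ex_le_one_add (t : ℝ) : ex t ≤ 1 + ‖Real.exp t - 1‖ₑ := by
  rw [ex, ← ofReal_norm, ← ENNReal.ofReal_one, ← ENNReal.ofReal_add zero_le_one (norm_nonneg _)]
  refine ENNReal.ofReal_le_ofReal ?_
  linarith [Real.le_norm_self (Real.exp t - 1)]

theorem one_le_ex_add (t : ℝ) : 1 ≤ ex t + ‖Real.exp t - 1‖ₑ := by
  rw [ex, ← ofReal_norm, ← ENNReal.ofReal_one,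
    ← ENNReal.ofReal_add (Real.exp_pos _).le (norm_nonneg _)]
  refine ENNReal.ofReal_le_ofReal ?_
  linarith [neg_le_of_abs_le (le_refl |Real.exp t - 1|), Real.norm_eq_abs (Real.exp t - 1)]

namespace Model

variable {d : ℕ} {s z : ℝ} {v : EucSp d → ℝ} {μ : Measure (Config d)} {m : ℝ≥0∞}

theorem exists_prod_moment_le (H : Model s z v μ m) {h : EucSp d → ℝ} (hh : IsC0 h) {a b c : ℝ}
    (ha : 0 ≤ a) (hb : 0 ≤ b) (hc : 0 ≤ c) : ∃ C : ℝ≥0∞, C ≠ ⊤ ∧ ∀ x x' y,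
      ∫⁻ γ, (ex (-a * En v x γ) * ex (-b * En v x' γ)) * (ex (cpair h γ) * ex (-c * En v y γ)) ∂μ
        ≤ C := by
  obtain ⟨C, hC, hCb⟩ := H.exists_pow_moment_le hh hc 2
  obtain ⟨D, hD, hDb⟩ := H.mom (4 * a) (by positivity)
  obtain ⟨D', hD', hDb'⟩ := H.mom (4 * b) (by positivity)
  refine ⟨D + D' + C, by finiteness, fun x x' y => ?_⟩
  have hE : ∀ (t : ℝ) x, Measurable fun γ : Config d => ex (t * En v x γ) := fun t x =>
    ((Measurable.En H.vm measurable_const measurable_id).const_mul _).ex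
  have h1 := hE (-(4 * a)) x
  have h2 := hE (-(4 * b)) x'
  calc _ ≤ ∫⁻ γ, (ex (-(4 * a) * En v x γ) + ex (-(4 * b) * En v x' γ) +
          (ex (cpair h γ) * ex (-c * En v y γ)) ^ 2) ∂μ := by
        refine lintegral_mono fun γ => ?_
        dsimp only
        refine (mul_le_sq_add_sq _ _).trans ?_
        gcongr
        rw [mul_pow]
        refine (mul_le_sq_add_sq _ _).trans (le_of_eq ?_)
        simp only [ex_pow]
        congr 2 <;> · push_cast; ring
    _ ≤ _ := by
        have h12 : Measurable fun γ : Config d => ex (-(4 * a) * En v x γ) +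
            ex (-(4 * b) * En v x' γ) := h1.add h2
        rw [lintegral_add_left h12, lintegral_add_left h1]
        gcongr
        · exact hDb x
        · exact hDb' x'
        · exact hCb y

theorem exists_rate_bound (H : Model s z v μ m) {f : EucSp d → ℝ} (hf : IsC0 f) :
    ∃ (ρ : EucSp d → EucSp d → ℝ≥0∞) (R K : ℝ≥0∞), R ≠ ⊤ ∧ K ≠ ⊤ ∧ (∀ y, Measurable (ρ y)) ∧
      (∀ y x, ρ y x ≤ R) ∧ (∀ y, ∫⁻ x, ρ y x ≤ K) ∧
      (∀ y x, ex ((s - 1) * v (y - x) + f x) ≤ 1 + ρ y x) ∧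
      ∀ y x, 1 ≤ ex ((s - 1) * v (y - x) + f x) + ρ y x := by
  have ht := (H.tame (1 - s) (by linarith [H.hs1])).exp_sub_one
  have ht' := (Tame.of_isC0 hf).exp_sub_one
  obtain ⟨⟨M, hM, hMb⟩, hi⟩ := ht
  obtain ⟨⟨M', hM', hMb'⟩, hi'⟩ := ht'
  have hvm := H.vm
  have hfm := hf.1.measurable
  set τ : EucSp d → ℝ≥0∞ := fun w => ‖Real.exp (-(1 - s) * v w) - 1‖ₑ with hτ
  set σ : EucSp d → ℝ≥0∞ := fun w => ‖Real.exp (f w) - 1‖ₑ with hσ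
  have hτm : Measurable τ := by fun_prop
  have hσm : Measurable σ := by fun_prop
  have hτb : ∀ w, τ w ≤ ENNReal.ofReal M := fun w => by
    rw [hτ]; dsimp only; rw [← ofReal_norm]; exact ENNReal.ofReal_le_ofReal (hMb w)
  have hσb : ∀ w, σ w ≤ ENNReal.ofReal M' := fun w => by
    rw [hσ]; dsimp only; rw [← ofReal_norm]; exact ENNReal.ofReal_le_ofReal (hMb' w)
  have hle : ∀ y x, ‖Real.exp ((s - 1) * v (y - x) + f x) - 1‖ₑ ≤
      τ (y - x) * (1 + σ x) + σ x := fun y x => by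
    have e : Real.exp ((s - 1) * v (y - x) + f x) - 1 =
        (Real.exp (-(1 - s) * v (y - x)) - 1) * (1 + (Real.exp (f x) - 1)) +
          (Real.exp (f x) - 1) := by
      rw [Real.exp_add, neg_sub]; ring
    rw [e]
    refine (enorm_add_le _ _).trans ?_
    rw [enorm_mul]
    gcongr
    refine (enorm_add_le _ _).trans ?_
    rw [enorm_one]
  refine ⟨fun y x => τ (y - x) * (1 + σ x) + σ x,
    ENNReal.ofReal M * (1 + ENNReal.ofReal M') + ENNReal.ofReal M',
    (∫⁻ x, τ x) * (1 + ENNReal.ofReal M') + ∫⁻ x, σ x, by finiteness, ?_, fun y => by fun_prop,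
    fun y x => ?_, fun y => ?_, fun y x => ?_, fun y x => ?_⟩
  · exact ENNReal.add_ne_top.2 ⟨ENNReal.mul_ne_top hi.2.ne (by finiteness), hi'.2.ne⟩
  · dsimp only
    gcongr
    exacts [hτb _, hσb _, hσb _]
  · rw [lintegral_add_left (by fun_prop)]
    gcongr
    calc ∫⁻ x, τ (y - x) * (1 + σ x) ≤ ∫⁻ x, τ (y - x) * (1 + ENNReal.ofReal M') := by
          gcongr; exact hσb _
      _ = _ := by
          rw [lintegral_mul_const _ (by fun_prop), lintegral_sub_left_eq_self (μ := volume) τ y]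
  · exact (ex_le_one_add _).trans (add_le_add le_rfl (hle y x))
  · exact (one_le_ex_add _).trans (add_le_add le_rfl (hle y x))

theorem exists_pair_bound (H : Model s z v μ m) :
    ∃ (κ : EucSp d → ℝ≥0∞) (R K : ℝ≥0∞), R ≠ ⊤ ∧ K ≠ ⊤ ∧ Measurable κ ∧ (∀ w, κ w ≤ R) ∧
      ∫⁻ w, κ w ≤ K ∧ ∀ w, ex ((2 * s - 1) * v w) ≤ 1 + κ w := by
  obtain ⟨⟨M, hM, hMb⟩, hi⟩ := (H.tame (1 - 2 * s) (by linarith [H.hs1])).exp_sub_one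
  have hvm := H.vm
  refine ⟨fun w => ‖Real.exp (-(1 - 2 * s) * v w) - 1‖ₑ, ENNReal.ofReal M, _,
    ENNReal.ofReal_ne_top, hi.2.ne, by fun_prop, fun w => ?_, le_rfl, fun w => ?_⟩
  · dsimp only
    rw [← ofReal_norm]
    exact ENNReal.ofReal_le_ofReal (hMb w)
  · rw [show (2 * s - 1) * v w = -(1 - 2 * s) * v w by ring]
    exact ex_le_one_add _

end Model

theorem Config.del_del_ins {d : ℕ} {γ : Config d} {x u : EucSp d} (hx : x ∈ γ.1) (hu : u ≠ x) :
    ((γ.del x).del u).ins x = γ.del u := by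
  refine Subtype.ext (Set.ext fun w => ?_)
  simp only [Config.del, Config.ins, Set.mem_insert_iff, Set.mem_sdiff, Set.mem_singleton_iff]
  constructor
  · rintro (rfl | h)
    · exact ⟨hx, hu.symm⟩
    · exact ⟨h.1.1, h.2⟩
  · rintro ⟨h1, h2⟩
    by_cases h : w = x
    · exact Or.inl h
    · exact Or.inr ⟨⟨h1, h⟩, h2⟩

theorem pk_ins {d : ℕ} {s : ℝ} {γ : Config d} {x x' y : EucSp d} {v f : EucSp d → ℝ}
    {α : EucSp d → ℝ≥0∞} (hx : x' ∉ γ.1) (h : Summable fun u : γ.1 => v (y - u))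
    (h' : Summable fun u : γ.1 => v (x - u)) (hf : IsC0 f) :
    pk s v f α y x (γ.ins x') =
      ex (s * v (x - x')) * ex ((s - 1) * v (y - x') + f x') * pk s v f α y x γ := by
  rw [pk, pk, Wt_ins hx h hf, En_ins hx h', mul_add, ex_add]
  ring

theorem Pt_sq_eq {d : ℕ} {s : ℝ} {γ : Config d} {y : EucSp d} {v f : EucSp d → ℝ}
    {α : EucSp d → ℝ≥0∞} : Pt s v f α y γ ^ 2 = ∑' x : γ.1, pk s v f α y x (γ.del x) *
      (pk s v f α y x (γ.del x) +
        ∑' u : (γ.del x).1, pk s v f α y u (((γ.del x).del u).ins x)) := by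
  rw [sq, Pt, ← ENNReal.tsum_mul_right]
  refine tsum_congr fun x => ?_
  rw [tsum_eq_add_tsum_del γ x.2 fun u => pk s v f α y u (γ.del u)]
  congr 2
  refine tsum_congr fun u => ?_
  rw [Config.del_del_ins x.2 u.2.2]

namespace Model

variable {d : ℕ} {s z : ℝ} {v : EucSp d → ℝ} {μ : Measure (Config d)} {m : ℝ≥0∞}

theorem lintegral_Pt_mul_Wt (H : Model s z v μ m) {f : EucSp d → ℝ} (hf : IsC0 f)
    {α : EucSp d → ℝ≥0∞} (hα : Measurable α) (y : EucSp d) :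
    ∫⁻ γ, Pt s v f α y γ * Wt s v f y γ ∂μ = ENNReal.ofReal z * ∫⁻ x, α (x - y) *
      ex ((s - 1) * v (y - x) + f x) * ∫⁻ γ, ex ((s - 1) * En v x γ) * Wt s v f y γ ^ 2 ∂μ := by
  have hvm := H.vm
  have hfm := hf.1.measurable
  have e1 : ∀ γ, Pt s v f α y γ * Wt s v f y γ =
      ∑' x : γ.1, pk s v f α y x (γ.del x) * Wt s v f y ((γ.del x).ins x) := fun γ => by
    rw [Pt, ← ENNReal.tsum_mul_right]
    refine tsum_congr fun x => ?_
    rw [Config.ins_del x.2]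
  simp only [e1]
  have hm1 : Measurable fun p : Config d × EucSp d => pk s v f α y p.2 p.1 :=
    Measurable.pk hvm hfm hα measurable_const measurable_snd measurable_fst
  have hm2 : Measurable fun p : Config d × EucSp d => Wt s v f y (p.1.ins p.2) :=
    Measurable.Wt hvm hfm measurable_const (measurable_fst.config_ins measurable_snd)
  rw [H.gnz (fun γ x => pk s v f α y x γ * Wt s v f y (γ.ins x)) (hm1.mul hm2)]
  congr 1
  refine lintegral_congr fun x => ?_
  have hm3 : Measurable fun γ : Config d => ex ((s - 1) * En v x γ) := H.measurable_rate_left x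
  have hm4 : Measurable fun γ : Config d => Wt s v f y γ :=
    Measurable.Wt hvm hfm measurable_const measurable_id
  rw [← lintegral_const_mul _ (by fun_prop)]
  refine lintegral_congr_ae ?_
  filter_upwards [H.notMem x, H.summ y] with γ h1 h2
  rw [Wt_ins h1 h2 hf, pk, show (s - 1) * En v x γ = -En v x γ + s * En v x γ by ring]
  simp only [ex_add]
  ring

theorem lintegral_Pt_sq (H : Model s z v μ m) {f : EucSp d → ℝ} (hf : IsC0 f)
    {α : EucSp d → ℝ≥0∞} (hα : Measurable α) (y : EucSp d) :
    ∫⁻ γ, Pt s v f α y γ ^ 2 ∂μ =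
      ENNReal.ofReal z * ∫⁻ x, (α (x - y) ^ 2 *
        (∫⁻ γ, ex (-(1 - 2 * s) * En v x γ) * Wt s v f y γ ^ 2 ∂μ) +
        ENNReal.ofReal z * ∫⁻ x', (α (x - y) * α (x' - y)) *
          (ex ((s - 1) * v (y - x) + f x) * ex ((s - 1) * v (y - x') + f x') *
            ex ((2 * s - 1) * v (x - x'))) *
          ∫⁻ γ, (ex ((s - 1) * En v x γ) * ex ((s - 1) * En v x' γ)) * Wt s v f y γ ^ 2 ∂μ) := by
  have hvm := H.vm
  have hfm := hf.1.measurable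
  simp only [Pt_sq_eq]
  have hm1 : Measurable fun p : Config d × EucSp d => pk s v f α y p.2 p.1 :=
    Measurable.pk hvm hfm hα measurable_const measurable_snd measurable_fst
  have hm2 : Measurable fun q : (Config d × EucSp d) × EucSp d =>
      pk s v f α y q.2 ((q.1.1.del q.2).ins q.1.2) :=
    Measurable.pk hvm hfm hα measurable_const measurable_snd
      (((measurable_fst.comp measurable_fst).config_del measurable_snd).config_ins
        (measurable_snd.comp measurable_fst))
  have hm3 : Measurable fun p : Config d × EucSp d =>
      ∑' u : p.1.1, pk s v f α y u ((p.1.del u).ins p.2) :=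
    measurable_fst.tsum_config (g := fun p u => pk s v f α y u ((p.1.del u).ins p.2)) hm2
  rw [H.gnz (fun γ x => pk s v f α y x γ *
    (pk s v f α y x γ + ∑' u : γ.1, pk s v f α y u ((γ.del u).ins x))) (hm1.mul (hm1.add hm3))]
  congr 1
  refine lintegral_congr fun x => ?_
  have hE : ∀ (t : ℝ) x, Measurable fun γ : Config d => ex (t * En v x γ) := fun t x =>
    ((Measurable.En H.vm measurable_const measurable_id).const_mul _).ex
  have hE1 : Measurable fun γ : Config d => ex (-En v x γ) :=
    (Measurable.En H.vm measurable_const measurable_id).neg.ex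
  have hp1 : Measurable fun γ : Config d => pk s v f α y x γ :=
    Measurable.pk hvm hfm hα measurable_const measurable_const measurable_id
  have hW : Measurable fun γ : Config d => Wt s v f y γ :=
    Measurable.Wt hvm hfm measurable_const measurable_id
  have e2 : ∀ γ : Config d, ex (-En v x γ) * (pk s v f α y x γ *
      (pk s v f α y x γ + ∑' u : γ.1, pk s v f α y u ((γ.del u).ins x))) =
      ex (-En v x γ) * pk s v f α y x γ ^ 2 + ∑' u : γ.1,
        ex (-En v x ((γ.del u).ins u)) * pk s v f α y x ((γ.del u).ins u) *
          pk s v f α y u ((γ.del u).ins x) := fun γ => by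
    rw [mul_add, mul_add]
    congr 1
    · ring
    · rw [← mul_assoc, ← ENNReal.tsum_mul_left]
      refine tsum_congr fun u => ?_
      rw [Config.ins_del u.2]
  simp only [e2]
  rw [lintegral_add_left (by fun_prop)]
  congr 1
  · have hx := hE (-(1 - 2 * s)) x
    rw [← lintegral_const_mul _ (by fun_prop)]
    refine lintegral_congr fun γ => ?_
    have e2 : ex (-(1 - 2 * s) * En v x γ) = ex (-En v x γ) * ex (s * En v x γ) ^ 2 := by
      rw [ex_pow, ← ex_add]; congr 1; push_cast; ring
    rw [e2, pk]
    ring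
  · have hg1 : Measurable fun p : Config d × EucSp d => ex (-En v x (p.1.ins p.2)) :=
      (Measurable.En H.vm measurable_const (measurable_fst.config_ins measurable_snd)).neg.ex
    have hg2 : Measurable fun p : Config d × EucSp d => pk s v f α y x (p.1.ins p.2) :=
      Measurable.pk hvm hfm hα measurable_const measurable_const
        (measurable_fst.config_ins measurable_snd)
    have hg3 : Measurable fun p : Config d × EucSp d => pk s v f α y p.2 (p.1.ins x) :=
      Measurable.pk hvm hfm hα measurable_const measurable_snd
        (measurable_fst.config_ins measurable_const)
    rw [H.gnz (fun γ u => ex (-En v x (γ.ins u)) * pk s v f α y x (γ.ins u) *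
      pk s v f α y u (γ.ins x)) ((hg1.mul hg2).mul hg3)]
    congr 1
    refine lintegral_congr fun x' => ?_
    have h1 := hE (s - 1) x
    have h2 := hE (s - 1) x'
    rw [← lintegral_const_mul _ (by fun_prop)]
    refine lintegral_congr_ae ?_
    filter_upwards [H.notMem x, H.notMem x', H.summ x, H.summ x', H.summ y] with γ n1 n2 s1 s2 s3
    rw [pk_ins n2 s3 s1 hf, pk_ins n1 s3 s2 hf, En_ins n2 s1, pk, pk,
      show (s - 1) * En v x γ = -En v x γ + s * En v x γ by ring,
      show (s - 1) * En v x' γ = -En v x' γ + s * En v x' γ by ring,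
      show (2 * s - 1) * v (x - x') = -v (x - x') + (s * v (x - x') + s * v (x - x')) by ring,
      ← H.ev (x' - x), neg_sub, neg_add]
    simp only [ex_add]
    ring

end Model

theorem sq_add_one_le_sqd (A : ℝ≥0∞) : A ^ 2 + 1 ≤ sqd A 1 + 2 * A := by
  by_cases hA : A = ⊤
  · simp [hA]
  · have := sqd_add_eq hA ENNReal.one_ne_top
    rw [mul_one, one_pow] at this
    exact this.ge

namespace Model

variable {d : ℕ} {s z : ℝ} {v : EucSp d → ℝ} {μ : Measure (Config d)} {m : ℝ≥0∞}

theorem Wt_sq {f : EucSp d → ℝ} (hf : IsC0 f) (y : EucSp d) (γ : Config d) :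
    Wt s v f y γ ^ 2 =
      ex (cpair (fun x => 2 * f x + 0 * f x) γ) * ex (-(2 * (1 - s)) * En v y γ) := by
  rw [Wt, cpair_lin hf hf, mul_pow, ex_pow, ex_pow, mul_comm]
  congr 2 <;> · push_cast; ring

theorem exists_rate_moment_le (H : Model s z v μ m) {f : EucSp d → ℝ} (hf : IsC0 f) {a b : ℝ}
    (ha : 0 ≤ a) (hb : 0 ≤ b) : ∃ C : ℝ≥0∞, C ≠ ⊤ ∧ ∀ x x' y,
      ∫⁻ γ, (ex (-a * En v x γ) * ex (-b * En v x' γ)) * Wt s v f y γ ^ 2 ∂μ ≤ C := by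
  obtain ⟨C, hC, h⟩ := H.exists_prod_moment_le (hf.lin hf 2 0) ha hb (c := 2 * (1 - s))
    (by linarith [H.hs1])
  exact ⟨C, hC, fun x x' y => by simpa only [Wt_sq hf] using h x x' y⟩

theorem Av_eq {s : ℝ} {v : EucSp d → ℝ} {c m : ℝ≥0∞} {α : EucSp d → ℝ≥0∞} (hα : Ker c m α)
    (y : EucSp d) (γ : Config d) :
    Av s v α y γ = ∫⁻ x, α (x - y) * ex ((s - 1) * En v x γ) := by
  unfold Av
  refine lintegral_congr fun x => ?_
  rw [← hα.even, neg_sub]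

theorem lintegral_Av_mul (H : Model s z v μ m) {c : ℝ≥0∞} {α : EucSp d → ℝ≥0∞} (hα : Ker c m α)
    {X : Config d → ℝ≥0∞} (hX : Measurable X) (y : EucSp d) :
    ∫⁻ γ, Av s v α y γ * X γ ∂μ =
      ∫⁻ x, α (x - y) * ∫⁻ γ, ex ((s - 1) * En v x γ) * X γ ∂μ := by
  have := H.prob
  have hm := hα.meas
  have hr := H.measurable_rate
  have e : ∀ γ, Av s v α y γ * X γ = ∫⁻ x, α (x - y) * (ex ((s - 1) * En v x γ) * X γ) :=
    fun γ => by
      have hrr := H.measurable_rate_right γ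
      rw [Av_eq hα, ← lintegral_mul_const _ (by fun_prop)]
      simp only [mul_assoc]
  simp only [e]
  rw [lintegral_lintegral_swap (f := fun γ x => α (x - y) * (ex ((s - 1) * En v x γ) * X γ))
    (Measurable.aemeasurable (by unfold Function.uncurry; fun_prop))]
  refine lintegral_congr fun x => ?_
  have h1 := H.measurable_rate_left x
  rw [lintegral_const_mul _ (by fun_prop)]

theorem lintegral_Av_sq_mul (H : Model s z v μ m) {c : ℝ≥0∞} {α : EucSp d → ℝ≥0∞}
    (hα : Ker c m α) {X : Config d → ℝ≥0∞} (hX : Measurable X) (y : EucSp d) :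
    ∫⁻ γ, Av s v α y γ ^ 2 * X γ ∂μ = ∫⁻ x, ∫⁻ x', (α (x - y) * α (x' - y)) *
      ∫⁻ γ, (ex ((s - 1) * En v x γ) * ex ((s - 1) * En v x' γ)) * X γ ∂μ := by
  have := H.prob
  have hm := hα.meas
  have hr := H.measurable_rate
  have hA := H.measurable_Av hα y
  have e : ∀ γ, Av s v α y γ ^ 2 * X γ = Av s v α y γ * (Av s v α y γ * X γ) := fun γ => by ring
  simp only [e]
  rw [H.lintegral_Av_mul hα (by fun_prop)]
  refine lintegral_congr fun x => ?_
  have h1 := H.measurable_rate_left x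
  have e2 : ∀ γ, ex ((s - 1) * En v x γ) * (Av s v α y γ * X γ) =
      Av s v α y γ * (ex ((s - 1) * En v x γ) * X γ) := fun γ => by ring
  simp only [e2]
  rw [H.lintegral_Av_mul hα (by fun_prop)]
  have hjm : Measurable fun p : EucSp d × Config d =>
      ex ((s - 1) * En v p.1 p.2) * (ex ((s - 1) * En v x p.2) * X p.2) := by
    have h2 : Measurable fun p : EucSp d × Config d => ex ((s - 1) * En v p.1 p.2) :=
      hr.comp measurable_swap
    have h3 : Measurable fun p : EucSp d × Config d => ex ((s - 1) * En v x p.2) :=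
      h1.comp measurable_snd
    fun_prop
  have hjm' := hjm.lintegral_prod_right' (ν := μ)
  rw [← lintegral_const_mul _ (by fun_prop)]
  refine lintegral_congr fun x' => ?_
  rw [mul_assoc]
  congr 2
  refine lintegral_congr fun γ => ?_
  ring

theorem exists_lintegral_Wt_sq_le (H : Model s z v μ m) {f : EucSp d → ℝ} (hf : IsC0 f) :
    ∃ C : ℝ≥0∞, C ≠ ⊤ ∧ ∀ y, ∫⁻ γ, Wt s v f y γ ^ 2 ∂μ ≤ C := by
  obtain ⟨C, hC, h⟩ := H.exists_rate_moment_le hf le_rfl le_rfl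
  exact ⟨C, hC, fun y => by simpa [ex] using h y y y⟩

theorem exists_cross_le (H : Model s z v μ m) {f : EucSp d → ℝ} (hf : IsC0 f) :
    ∃ K : ℝ≥0∞, K ≠ ⊤ ∧ ∀ c α, Ker c m α → ∀ y,
      ∫⁻ γ, Pt s v f α y γ * Wt s v f y γ ∂μ ≠ ⊤ ∧
      ENNReal.ofReal z * ∫⁻ γ, Av s v α y γ * Wt s v f y γ ^ 2 ∂μ ≤
        ∫⁻ γ, Pt s v f α y γ * Wt s v f y γ ∂μ + c * K := by
  have := H.prob
  have hvm := H.vm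
  have hfm := hf.1.measurable
  obtain ⟨ρ, R, K, hR, hK, hρm, hρR, hρK, hup, hlo⟩ := H.exists_rate_bound hf
  obtain ⟨C, hC, hCb⟩ := H.exists_rate_moment_le hf (a := 1 - s) (by linarith [H.hs1]) le_rfl
  have hCb' : ∀ x y, ∫⁻ γ, ex ((s - 1) * En v x γ) * Wt s v f y γ ^ 2 ∂μ ≤ C := fun x y => by
    simpa [ex] using hCb x x y
  have hmi : m⁻¹ ≠ ⊤ := ENNReal.inv_ne_top.2 H.m0
  refine ⟨ENNReal.ofReal z * (K * C), by finiteness, fun c α hα y => ?_⟩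
  have hm := hα.meas
  have hρ := hρm y
  have hW : Measurable fun γ : Config d => Wt s v f y γ :=
    Measurable.Wt hvm hfm measurable_const measurable_id
  have hEm : Measurable fun x => ∫⁻ γ, ex ((s - 1) * En v x γ) * Wt s v f y γ ^ 2 ∂μ := by
    have h2 : Measurable fun p : EucSp d × Config d => ex ((s - 1) * En v p.1 p.2) :=
      H.measurable_rate.comp measurable_swap
    exact Measurable.lintegral_prod_right' (f := fun p : EucSp d × Config d =>
      ex ((s - 1) * En v p.1 p.2) * Wt s v f y p.2 ^ 2) (by fun_prop)
  rw [H.lintegral_Pt_mul_Wt hf hm]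
  refine ⟨?_, ?_⟩
  · refine ENNReal.mul_ne_top ENNReal.ofReal_ne_top (ne_top_of_le_ne_top
      (b := m⁻¹ * ((1 + R) * C)) (by finiteness) ?_)
    calc _ ≤ ∫⁻ x, α (x - y) * ((1 + R) * C) := by
          refine lintegral_mono fun x => ?_
          rw [mul_assoc]
          gcongr
          · exact (hup y x).trans (by gcongr; exact hρR y x)
          · exact hCb' x y
      _ = _ := by rw [lintegral_mul_const _ (by fun_prop), hα.int_sub']
  · rw [H.lintegral_Av_mul hα (by fun_prop)]
    calc ENNReal.ofReal z * ∫⁻ x, α (x - y) *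
          ∫⁻ γ, ex ((s - 1) * En v x γ) * Wt s v f y γ ^ 2 ∂μ
        ≤ ENNReal.ofReal z * ∫⁻ x, (α (x - y) * ex ((s - 1) * v (y - x) + f x) *
            (∫⁻ γ, ex ((s - 1) * En v x γ) * Wt s v f y γ ^ 2 ∂μ) + c * (ρ y x * C)) := by
          gcongr with x
          calc α (x - y) * ∫⁻ γ, ex ((s - 1) * En v x γ) * Wt s v f y γ ^ 2 ∂μ
              ≤ α (x - y) * (ex ((s - 1) * v (y - x) + f x) + ρ y x) *
                ∫⁻ γ, ex ((s - 1) * En v x γ) * Wt s v f y γ ^ 2 ∂μ := by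
                gcongr
                exact le_mul_of_one_le_right' (hlo y x)
            _ = α (x - y) * ex ((s - 1) * v (y - x) + f x) *
                (∫⁻ γ, ex ((s - 1) * En v x γ) * Wt s v f y γ ^ 2 ∂μ) + α (x - y) * (ρ y x *
                ∫⁻ γ, ex ((s - 1) * En v x γ) * Wt s v f y γ ^ 2 ∂μ) := by ring
            _ ≤ _ := by
                gcongr
                · exact hα.le _
                · exact hCb' x y
      _ ≤ _ := by
          rw [lintegral_add_left (by fun_prop), mul_add, lintegral_const_mul _ (by fun_prop),
            lintegral_mul_const _ hρ]
          refine add_le_add le_rfl ?_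
          calc ENNReal.ofReal z * (c * ((∫⁻ x, ρ y x) * C)) ≤ ENNReal.ofReal z * (c * (K * C)) := by
                gcongr; exact hρK y
            _ = c * (ENNReal.ofReal z * (K * C)) := by ring

end Model

section

variable {d : ℕ} {c m : ℝ≥0∞} {α : EucSp d → ℝ≥0∞}

theorem Ker.lintegral_pair_le (hα : Ker c m α) {J : EucSp d → EucSp d → ℝ≥0∞} {C : ℝ≥0∞}
    (hJC : ∀ x x', J x x' ≤ C) (y : EucSp d) :
    ∫⁻ x, ∫⁻ x', (α (x - y) * α (x' - y)) * J x x' ≤ m⁻¹ * m⁻¹ * C := by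
  have hm := hα.meas
  calc ∫⁻ x, ∫⁻ x', (α (x - y) * α (x' - y)) * J x x'
      ≤ ∫⁻ x, ∫⁻ x', α (x - y) * (α (x' - y) * C) := by
        refine lintegral_mono fun x => lintegral_mono fun x' => ?_
        dsimp only
        rw [mul_assoc]
        gcongr
        exact hJC x x'
    _ = ∫⁻ x, α (x - y) * (m⁻¹ * C) := by
        refine lintegral_congr fun x => ?_
        rw [lintegral_const_mul _ (by fun_prop), lintegral_mul_const _ (by fun_prop),
          hα.int_sub']
    _ = m⁻¹ * m⁻¹ * C := by
        rw [lintegral_mul_const _ (by fun_prop), hα.int_sub', mul_assoc]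

theorem Ker.lintegral_pair_error_le (hα : Ker c m α) {ρ κ : EucSp d → ℝ≥0∞} {R K K' : ℝ≥0∞}
    (hρ : Measurable ρ) (hκ : Measurable κ) (hρK : ∫⁻ x, ρ x ≤ K) (hκK : ∫⁻ x, κ x ≤ K')
    (y : EucSp d) :
    ∫⁻ x, ∫⁻ x', (α (x - y) * α (x' - y)) * (ρ x + R * ρ x' + R ^ 2 * κ (x - x')) ≤
      c * (m⁻¹ * (K + R * K + R ^ 2 * K')) := by
  have hm := hα.meas
  calc ∫⁻ x, ∫⁻ x', (α (x - y) * α (x' - y)) * (ρ x + R * ρ x' + R ^ 2 * κ (x - x'))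
      ≤ ∫⁻ x, ∫⁻ x', ((c * ρ x) * α (x' - y) + α (x - y) * (c * R * ρ x') +
          α (x - y) * (c * R ^ 2 * κ (x - x'))) := by
        refine lintegral_mono fun x => lintegral_mono fun x' => ?_
        calc (α (x - y) * α (x' - y)) * (ρ x + R * ρ x' + R ^ 2 * κ (x - x'))
            = α (x - y) * ρ x * α (x' - y) + α (x - y) * (α (x' - y) * R * ρ x') +
              α (x - y) * (α (x' - y) * R ^ 2 * κ (x - x')) := by ring
          _ ≤ _ := by
            gcongr <;> exact hα.le _
    _ ≤ ∫⁻ x, ((c * ρ x) * m⁻¹ + α (x - y) * (c * R * K) + α (x - y) * (c * R ^ 2 * K')) := by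
        refine lintegral_mono fun x => ?_
        dsimp only
        rw [lintegral_add_right _ (by fun_prop), lintegral_add_right _ (by fun_prop),
          lintegral_const_mul _ (by fun_prop), lintegral_const_mul _ (by fun_prop),
          lintegral_const_mul _ (by fun_prop), lintegral_const_mul _ (by fun_prop),
          lintegral_const_mul _ (by fun_prop), hα.int_sub', lintegral_sub_left_eq_self]
        gcongr
    _ = (c * ∫⁻ x, ρ x) * m⁻¹ + m⁻¹ * (c * R * K) + m⁻¹ * (c * R ^ 2 * K') := by
        rw [lintegral_add_right _ (by fun_prop), lintegral_add_right _ (by fun_prop),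
          lintegral_mul_const _ (by fun_prop), lintegral_mul_const _ (by fun_prop),
          lintegral_mul_const _ (by fun_prop), lintegral_const_mul _ (by fun_prop), hα.int_sub']
    _ ≤ (c * K) * m⁻¹ + m⁻¹ * (c * R * K) + m⁻¹ * (c * R ^ 2 * K') := by gcongr
    _ = _ := by ring

theorem Ker.lintegral_pair_rate_le (hα : Ker c m α) {ρ κ r : EucSp d → ℝ≥0∞}
    {q : EucSp d → ℝ≥0∞} {J : EucSp d → EucSp d → ℝ≥0∞} {C R K K' : ℝ≥0∞}
    (hρ : Measurable ρ) (hκ : Measurable κ) (hρR : ∀ x, ρ x ≤ R)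
    (hρK : ∫⁻ x, ρ x ≤ K) (hκK : ∫⁻ x, κ x ≤ K')
    (hr : ∀ x, r x ≤ 1 + ρ x) (hq : ∀ x, q x ≤ 1 + κ x)
    (hJm : Measurable fun p : EucSp d × EucSp d => J p.1 p.2) (hJC : ∀ x x', J x x' ≤ C)
    (y : EucSp d) :
    ∫⁻ x, ∫⁻ x', (α (x - y) * α (x' - y)) * (r x * r x' * q (x - x')) * J x x' ≤
      (∫⁻ x, ∫⁻ x', (α (x - y) * α (x' - y)) * J x x') +
        c * (m⁻¹ * (K + (1 + R) * K + (1 + R) ^ 2 * K') * C) := by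
  have hm := hα.meas
  have hJ1 : ∀ x, Measurable fun x' => J x x' := fun x =>
    hJm.comp (measurable_const.prodMk measurable_id : Measurable fun x' : EucSp d => (x, x'))
  have hJ2 : Measurable fun x => ∫⁻ x', (α (x - y) * α (x' - y)) * J x x' :=
    Measurable.lintegral_prod_right' (f := fun p : EucSp d × EucSp d =>
      (α (p.1 - y) * α (p.2 - y)) * J p.1 p.2) (by fun_prop)
  have hE : Measurable fun x => ∫⁻ x', (α (x - y) * α (x' - y)) *
      (ρ x + (1 + R) * ρ x' + (1 + R) ^ 2 * κ (x - x')) :=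
    Measurable.lintegral_prod_right' (f := fun p : EucSp d × EucSp d =>
      (α (p.1 - y) * α (p.2 - y)) *
        (ρ p.1 + (1 + R) * ρ p.2 + (1 + R) ^ 2 * κ (p.1 - p.2))) (by fun_prop)
  have hrq : ∀ x x', r x * r x' * q (x - x') ≤
      1 + (ρ x + (1 + R) * ρ x' + (1 + R) ^ 2 * κ (x - x')) := fun x x' => by
    calc r x * r x' * q (x - x') ≤ (1 + ρ x) * (1 + ρ x') * (1 + κ (x - x')) := by
          gcongr <;> solve_by_elim
      _ = 1 + (ρ x + (1 + ρ x) * ρ x' + (1 + ρ x) * (1 + ρ x') * κ (x - x')) := by ring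
      _ ≤ 1 + (ρ x + (1 + R) * ρ x' + (1 + R) * (1 + R) * κ (x - x')) := by
          gcongr <;> exact hρR _
      _ = _ := by ring
  calc ∫⁻ x, ∫⁻ x', (α (x - y) * α (x' - y)) * (r x * r x' * q (x - x')) * J x x'
      ≤ ∫⁻ x, ∫⁻ x', ((α (x - y) * α (x' - y)) * J x x' + ((α (x - y) * α (x' - y)) *
          (ρ x + (1 + R) * ρ x' + (1 + R) ^ 2 * κ (x - x'))) * C) := by
        refine lintegral_mono fun x => lintegral_mono fun x' => ?_
        calc (α (x - y) * α (x' - y)) * (r x * r x' * q (x - x')) * J x x'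
            ≤ (α (x - y) * α (x' - y)) *
              (1 + (ρ x + (1 + R) * ρ x' + (1 + R) ^ 2 * κ (x - x'))) * J x x' := by
              gcongr; exact hrq x x'
          _ = (α (x - y) * α (x' - y)) * J x x' + (α (x - y) * α (x' - y)) *
              (ρ x + (1 + R) * ρ x' + (1 + R) ^ 2 * κ (x - x')) * J x x' := by ring
          _ ≤ _ := by gcongr; exact hJC x x'
    _ = (∫⁻ x, ∫⁻ x', (α (x - y) * α (x' - y)) * J x x') +
        (∫⁻ x, ∫⁻ x', (α (x - y) * α (x' - y)) *
          (ρ x + (1 + R) * ρ x' + (1 + R) ^ 2 * κ (x - x'))) * C := by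
        rw [← lintegral_mul_const _ hE, ← lintegral_add_left hJ2]
        refine lintegral_congr fun x => ?_
        have := hJ1 x
        rw [lintegral_add_left (by fun_prop), lintegral_mul_const _ (by fun_prop)]
    _ ≤ _ := by
        refine add_le_add le_rfl ?_
        rw [← mul_assoc]
        gcongr
        exact hα.lintegral_pair_error_le hρ hκ hρK hκK y

theorem Ker.lintegral_sq_le (hα : Ker c m α) {J : EucSp d → ℝ≥0∞} {C : ℝ≥0∞}
    (hJC : ∀ x, J x ≤ C) (y : EucSp d) :
    ∫⁻ x, α (x - y) ^ 2 * J x ≤ c * (m⁻¹ * C) := by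
  have hm := hα.meas
  calc ∫⁻ x, α (x - y) ^ 2 * J x ≤ ∫⁻ x, c * (α (x - y) * C) := by
        refine lintegral_mono fun x => ?_
        dsimp only
        rw [sq, mul_assoc]
        gcongr
        · exact hα.le _
        · exact hJC x
    _ = _ := by
        rw [lintegral_const_mul _ (by fun_prop), lintegral_mul_const _ (by fun_prop),
          hα.int_sub']

end

namespace Model

variable {d : ℕ} {s z : ℝ} {v : EucSp d → ℝ} {μ : Measure (Config d)} {m : ℝ≥0∞}

theorem measurable_pair_moment (H : Model s z v μ m) {X : Config d → ℝ≥0∞} (hX : Measurable X) :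
    Measurable fun p : EucSp d × EucSp d =>
      ∫⁻ γ, (ex ((s - 1) * En v p.1 γ) * ex ((s - 1) * En v p.2 γ)) * X γ ∂μ := by
  have := H.prob
  have hvm := H.vm
  have h1 : Measurable fun q : (EucSp d × EucSp d) × Config d =>
      ex ((s - 1) * En v q.1.1 q.2) :=
    ((Measurable.En hvm (measurable_fst.comp measurable_fst) measurable_snd).const_mul _).ex
  have h2 : Measurable fun q : (EucSp d × EucSp d) × Config d =>
      ex ((s - 1) * En v q.1.2 q.2) :=
    ((Measurable.En hvm (measurable_snd.comp measurable_fst) measurable_snd).const_mul _).ex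
  exact Measurable.lintegral_prod_right' (f := fun q : (EucSp d × EucSp d) × Config d =>
    ex ((s - 1) * En v q.1.1 q.2) * ex ((s - 1) * En v q.1.2 q.2) * X q.2) (by fun_prop)

theorem measurable_Wt (H : Model s z v μ m) {f : EucSp d → ℝ} (hf : IsC0 f) (y : EucSp d) :
    Measurable fun γ : Config d => Wt s v f y γ :=
  Measurable.Wt H.vm hf.1.measurable measurable_const measurable_id

theorem measurable_Pt (H : Model s z v μ m) {f : EucSp d → ℝ} (hf : IsC0 f)
    {α : EucSp d → ℝ≥0∞} (hα : Measurable α) (y : EucSp d) :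
    Measurable fun γ : Config d => Pt s v f α y γ :=
  Measurable.Pt H.vm hf.1.measurable hα measurable_const measurable_id

theorem exists_Pt_sq_le (H : Model s z v μ m) {f : EucSp d → ℝ} (hf : IsC0 f) :
    ∃ K C : ℝ≥0∞, K ≠ ⊤ ∧ C ≠ ⊤ ∧ ∀ c α, Ker c m α → ∀ y,
      ∫⁻ γ, Av s v α y γ ^ 2 * Wt s v f y γ ^ 2 ∂μ ≤ C ∧
      ∫⁻ γ, Pt s v f α y γ ^ 2 ∂μ ≤ ENNReal.ofReal z ^ 2 *
        ∫⁻ γ, Av s v α y γ ^ 2 * Wt s v f y γ ^ 2 ∂μ + c * K := by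
  have := H.prob
  obtain ⟨ρ, R, K, hR, hK, hρm, hρR, hρK, hup, -⟩ := H.exists_rate_bound hf
  obtain ⟨κ, -, K', -, hK', hκm, -, hκK, hq⟩ := H.exists_pair_bound
  obtain ⟨C₁, hC₁, hCb₁⟩ := H.exists_rate_moment_le hf (a := 1 - 2 * s) (by linarith [H.hs1]) le_rfl
  obtain ⟨C, hC, hCb⟩ := H.exists_rate_moment_le hf (a := 1 - s) (b := 1 - s)
    (by linarith [H.hs1]) (by linarith [H.hs1])
  have hCb₁' : ∀ x y, ∫⁻ γ, ex (-(1 - 2 * s) * En v x γ) * Wt s v f y γ ^ 2 ∂μ ≤ C₁ :=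
    fun x y => by
      have := hCb₁ x x y
      simp only [neg_zero, zero_mul, ex, Real.exp_zero, ENNReal.ofReal_one, mul_one] at this
      exact this
  simp only [neg_sub] at hCb
  have hmi : m⁻¹ ≠ ⊤ := ENNReal.inv_ne_top.2 H.m0
  have hζt : ENNReal.ofReal z ≠ ⊤ := ENNReal.ofReal_ne_top
  refine ⟨ENNReal.ofReal z * (m⁻¹ * C₁) + ENNReal.ofReal z ^ 2 *
      (m⁻¹ * (K + (1 + R) * K + (1 + R) ^ 2 * K') * C),
    m⁻¹ * m⁻¹ * C, by finiteness, by finiteness, fun c α hα y => ?_⟩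
  have hm := hα.meas
  have hW := H.measurable_Wt hf y
  have hJm := H.measurable_pair_moment (X := fun γ => Wt s v f y γ ^ 2) (by fun_prop)
  have hJC := fun x x' => hCb x x' y
  have hA := H.lintegral_Av_sq_mul hα (X := fun γ => Wt s v f y γ ^ 2) (by fun_prop) y
  have h2 := hα.lintegral_pair_rate_le (hρm y) hκm (hρR y) (hρK y) hκK (hup y) hq hJm hJC y
  rw [← hA] at h2
  have h1 := hα.lintegral_sq_le (fun x => hCb₁' x y) y
  refine ⟨hA.trans_le (hα.lintegral_pair_le hJC y), ?_⟩
  have hd : Measurable fun x =>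
      α (x - y) ^ 2 * ∫⁻ γ, ex (-(1 - 2 * s) * En v x γ) * Wt s v f y γ ^ 2 ∂μ := by
    have h3 : Measurable fun p : EucSp d × Config d => ex (-(1 - 2 * s) * En v p.1 p.2) :=
      ((Measurable.En H.vm measurable_fst measurable_snd).const_mul _).ex
    have h4 : Measurable fun x => ∫⁻ γ, ex (-(1 - 2 * s) * En v x γ) * Wt s v f y γ ^ 2 ∂μ :=
      Measurable.lintegral_prod_right' (f := fun p : EucSp d × Config d =>
        ex (-(1 - 2 * s) * En v p.1 p.2) * Wt s v f y p.2 ^ 2) (by fun_prop)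
    fun_prop
  rw [H.lintegral_Pt_sq hf hm, lintegral_add_left hd, lintegral_const_mul' _ _ hζt]
  calc _ ≤ ENNReal.ofReal z * (c * (m⁻¹ * C₁) + ENNReal.ofReal z *
        (∫⁻ γ, Av s v α y γ ^ 2 * Wt s v f y γ ^ 2 ∂μ +
          c * (m⁻¹ * (K + (1 + R) * K + (1 + R) ^ 2 * K') * C))) := by
        gcongr
    _ = _ := by ring

theorem exists_sqd_Pt_le (H : Model s z v μ m) {f : EucSp d → ℝ} (hf : IsC0 f) :
    ∃ K : ℝ≥0∞, K ≠ ⊤ ∧ ∀ c α, Ker c m α → ∀ y,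
      ∫⁻ γ, sqd (Pt s v f α y γ) (ENNReal.ofReal z * Wt s v f y γ) ∂μ ≤ c * K +
        ENNReal.ofReal z ^ 2 * ∫⁻ γ, Wt s v f y γ ^ 2 * sqd (Av s v α y γ) 1 ∂μ := by
  obtain ⟨K₁, C, hK₁, hC, hP⟩ := H.exists_Pt_sq_le hf
  obtain ⟨K₂, hK₂, hX⟩ := H.exists_cross_le hf
  have hζt : ENNReal.ofReal z ≠ ⊤ := ENNReal.ofReal_ne_top
  refine ⟨K₁ + 2 * ENNReal.ofReal z * K₂, by finiteness, fun c α hα y => ?_⟩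
  obtain ⟨hPW, hX⟩ := hX c α hα y
  obtain ⟨-, hP⟩ := hP c α hα y
  have hW := H.measurable_Wt hf y
  have hPm := H.measurable_Pt hf hα.meas y
  have hA := H.measurable_Av hα y
  generalize ENNReal.ofReal z = ζ at *
  have e1 : ∫⁻ γ, sqd (Pt s v f α y γ) (ζ * Wt s v f y γ) ∂μ +
      2 * ζ * ∫⁻ γ, Pt s v f α y γ * Wt s v f y γ ∂μ ≤
      ∫⁻ γ, Pt s v f α y γ ^ 2 ∂μ + ζ ^ 2 * ∫⁻ γ, Wt s v f y γ ^ 2 ∂μ := by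
    rw [← lintegral_const_mul _ (by fun_prop), ← lintegral_const_mul _ (by fun_prop),
      ← lintegral_add_right _ (by fun_prop), ← lintegral_add_right _ (by fun_prop)]
    refine lintegral_mono fun γ => ?_
    have := sqd_add_le (Pt s v f α y γ) (ζ * Wt s v f y γ)
    calc _ = sqd (Pt s v f α y γ) (ζ * Wt s v f y γ) +
          2 * (Pt s v f α y γ * (ζ * Wt s v f y γ)) := by ring
      _ ≤ _ := this
      _ = _ := by ring
  have e2 : ∫⁻ γ, Av s v α y γ ^ 2 * Wt s v f y γ ^ 2 ∂μ + ∫⁻ γ, Wt s v f y γ ^ 2 ∂μ ≤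
      ∫⁻ γ, Wt s v f y γ ^ 2 * sqd (Av s v α y γ) 1 ∂μ +
        2 * ∫⁻ γ, Av s v α y γ * Wt s v f y γ ^ 2 ∂μ := by
    rw [← lintegral_const_mul _ (by fun_prop), ← lintegral_add_right _ (by fun_prop),
      ← lintegral_add_right _ (by fun_prop)]
    refine lintegral_mono fun γ => ?_
    have := sq_add_one_le_sqd (Av s v α y γ)
    calc _ = (Av s v α y γ ^ 2 + 1) * Wt s v f y γ ^ 2 := by ring
      _ ≤ (sqd (Av s v α y γ) 1 + 2 * Av s v α y γ) * Wt s v f y γ ^ 2 := by gcongr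
      _ = _ := by ring
  have hfin : 2 * ζ * ∫⁻ γ, Pt s v f α y γ * Wt s v f y γ ∂μ ≠ ⊤ := by finiteness
  refine (ENNReal.add_le_add_iff_right hfin).1 (e1.trans ?_)
  calc _ ≤ (ζ ^ 2 * ∫⁻ γ, Av s v α y γ ^ 2 * Wt s v f y γ ^ 2 ∂μ + c * K₁) +
        ζ ^ 2 * ∫⁻ γ, Wt s v f y γ ^ 2 ∂μ := by gcongr
    _ = c * K₁ + ζ ^ 2 * (∫⁻ γ, Av s v α y γ ^ 2 * Wt s v f y γ ^ 2 ∂μ +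
        ∫⁻ γ, Wt s v f y γ ^ 2 ∂μ) := by ring
    _ ≤ c * K₁ + ζ ^ 2 * (∫⁻ γ, Wt s v f y γ ^ 2 * sqd (Av s v α y γ) 1 ∂μ +
        2 * ∫⁻ γ, Av s v α y γ * Wt s v f y γ ^ 2 ∂μ) := by gcongr
    _ = c * K₁ + ζ ^ 2 * ∫⁻ γ, Wt s v f y γ ^ 2 * sqd (Av s v α y γ) 1 ∂μ +
        2 * ζ * (ζ * ∫⁻ γ, Av s v α y γ * Wt s v f y γ ^ 2 ∂μ) := by ring
    _ ≤ c * K₁ + ζ ^ 2 * ∫⁻ γ, Wt s v f y γ ^ 2 * sqd (Av s v α y γ) 1 ∂μ +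
        2 * ζ * (∫⁻ γ, Pt s v f α y γ * Wt s v f y γ ∂μ + c * K₂) := by gcongr
    _ = _ := by ring

end Model

namespace Model

variable {d : ℕ} {s z : ℝ} {v : EucSp d → ℝ} {μ : Measure (Config d)} {m : ℝ≥0∞}

theorem sqd_Pt_small (H : Model s z v μ m) {f : EucSp d → ℝ} (hf : IsC0 f) {δ : ℝ≥0∞}
    (hδ : 0 < δ) : ∃ c₀ : ℝ≥0∞, 0 < c₀ ∧ ∀ α, Ker c₀ m α → ∀ y,
      ∫⁻ γ, sqd (Pt s v f α y γ) (ENNReal.ofReal z * Wt s v f y γ) ∂μ ≤ δ := by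
  rcases eq_or_ne δ ⊤ with rfl | hδt
  · exact ⟨1, one_pos, fun _ _ _ => le_top⟩
  obtain ⟨K, hK, hb⟩ := H.exists_sqd_Pt_le hf
  obtain ⟨L, hL, hLb⟩ := H.exists_pow_moment_le (hf.lin hf 2 0) (c := 2 * (1 - s))
    (by linarith [H.hs1]) 4
  have hδ2 : 0 < δ / 2 := ENNReal.half_pos hδ.ne'
  have hζt : ENNReal.ofReal z ≠ ⊤ := ENNReal.ofReal_ne_top
  obtain ⟨c₁, hc₁, hcb⟩ := H.mul_sqd_Av_small (L := L)
    (δ := δ / 2 / (ENNReal.ofReal z ^ 2 + 1)) hL (ENNReal.div_pos hδ2.ne' (by finiteness))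
  refine ⟨min c₁ (δ / 2 / (K + 1)), lt_min hc₁ (ENNReal.div_pos hδ2.ne' (by finiteness)),
    fun α hα y => ?_⟩
  have hW := H.measurable_Wt hf y
  have h1 := hcb α (hα.mono (min_le_left _ _)) y (fun γ => Wt s v f y γ ^ 2) (by fun_prop)
    (by simpa only [Wt_sq hf] using hLb y)
  calc _ ≤ min c₁ (δ / 2 / (K + 1)) * K +
        ENNReal.ofReal z ^ 2 * ∫⁻ γ, Wt s v f y γ ^ 2 * sqd (Av s v α y γ) 1 ∂μ := hb _ α hα y
    _ ≤ δ / 2 / (K + 1) * (K + 1) +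
        (ENNReal.ofReal z ^ 2 + 1) * (δ / 2 / (ENNReal.ofReal z ^ 2 + 1)) := by
        gcongr
        · exact min_le_right _ _
        · exact le_self_add
        · exact le_self_add
    _ ≤ δ / 2 + δ / 2 := by
        rw [mul_comm]
        gcongr <;> exact ENNReal.mul_div_le
    _ = δ := ENNReal.add_halves δ

theorem measurable_uncurry_Wt (H : Model s z v μ m) {f : EucSp d → ℝ} (hf : IsC0 f) :
    Measurable fun p : Config d × EucSp d => Wt s v f p.2 p.1 :=
  Measurable.Wt H.vm hf.1.measurable measurable_snd measurable_fst

theorem measurable_uncurry_Pt (H : Model s z v μ m) {f : EucSp d → ℝ} (hf : IsC0 f)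
    {α : EucSp d → ℝ≥0∞} (hα : Measurable α) :
    Measurable fun p : Config d × EucSp d => Pt s v f α p.2 p.1 :=
  Measurable.Pt H.vm hf.1.measurable hα measurable_snd measurable_fst

theorem lintegral_sq_lintegral_sub_le [SFinite μ] {h : EucSp d → ℝ} (hh : IsC0 h)
    {X Y : EucSp d → Config d → ℝ≥0∞} (hX : Measurable fun p : Config d × EucSp d => X p.2 p.1)
    (hY : Measurable fun p : Config d × EucSp d => Y p.2 p.1) {δ : ℝ≥0∞}
    (hXY : ∀ y, ∫⁻ γ, sqd (X y γ) (Y y γ) ∂μ ≤ δ) :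
    ∫⁻ γ, (∫⁻ y, ENNReal.ofReal (h y) * ‖(X y γ).toReal - (Y y γ).toReal‖ₑ) ^ 2 ∂μ ≤
      (∫⁻ x, ENNReal.ofReal (h x)) ^ 2 * δ := by
  have hI : ∫⁻ x, ENNReal.ofReal (h x) ≠ ⊤ := hh.integrable.lintegral_lt_top.ne
  have hhm : Measurable fun x => ENNReal.ofReal (h x) := hh.1.measurable.ennreal_ofReal
  have hS : Measurable fun p : Config d × EucSp d =>
      ENNReal.ofReal (h p.2) * sqd (X p.2 p.1) (Y p.2 p.1) :=
    (hhm.comp measurable_snd).mul (hX.sqd hY)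
  calc ∫⁻ γ, (∫⁻ y, ENNReal.ofReal (h y) * ‖(X y γ).toReal - (Y y γ).toReal‖ₑ) ^ 2 ∂μ
      ≤ ∫⁻ γ, ((∫⁻ x, ENNReal.ofReal (h x)) *
        ∫⁻ y, ENNReal.ofReal (h y) * sqd (X y γ) (Y y γ)) ∂μ := by
        refine lintegral_mono fun γ => ?_
        have hm : Measurable fun y => ‖(X y γ).toReal - (Y y γ).toReal‖ₑ :=
          (hX.ennreal_toReal.sub hY.ennreal_toReal).enorm.comp measurable_prodMk_left
        simpa only [enorm_sub_sq_eq_sqd] using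
          lintegral_mul_sq_le (ν := volume) hhm.aemeasurable hm.aemeasurable
    _ = (∫⁻ x, ENNReal.ofReal (h x)) * ∫⁻ y, ENNReal.ofReal (h y) *
        ∫⁻ γ, sqd (X y γ) (Y y γ) ∂μ := by
        rw [lintegral_const_mul' _ _ hI, lintegral_lintegral_swap hS.aemeasurable]
        congr 1
        refine lintegral_congr fun y => ?_
        rw [lintegral_const_mul' _ _ ENNReal.ofReal_ne_top]
    _ ≤ (∫⁻ x, ENNReal.ofReal (h x)) * ∫⁻ y, ENNReal.ofReal (h y) * δ := by
        gcongr with y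
        exact hXY y
    _ = _ := by
        rw [lintegral_mul_const _ hhm]; ring

theorem plus_small (H : Model s z v μ m) {f : EucSp d → ℝ} (hf : IsC0 f) {h : EucSp d → ℝ}
    (hh : IsC0 h) {δ : ℝ≥0∞} (hδ : 0 < δ) : ∃ c₀ : ℝ≥0∞, 0 < c₀ ∧ ∀ α, Ker c₀ m α →
      ∫⁻ γ, (∫⁻ y, ENNReal.ofReal (h y) * ‖(Pt s v f α y γ).toReal -
        (ENNReal.ofReal z * Wt s v f y γ).toReal‖ₑ) ^ 2 ∂μ ≤ δ := by
  have := H.prob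
  have hI : ∫⁻ x, ENNReal.ofReal (h x) ≠ ⊤ := hh.integrable.lintegral_lt_top.ne
  obtain ⟨c₀, hc₀, hcb⟩ := H.sqd_Pt_small hf
    (δ := δ / ((∫⁻ x, ENNReal.ofReal (h x)) ^ 2 + 1)) (ENNReal.div_pos hδ.ne' (by finiteness))
  refine ⟨c₀, hc₀, fun α hα => ?_⟩
  refine (lintegral_sq_lintegral_sub_le hh (H.measurable_uncurry_Pt hf hα.meas)
    ((H.measurable_uncurry_Wt hf).const_mul _) (hcb α hα)).trans ?_
  refine le_trans ?_ (ENNReal.mul_div_le (a := (∫⁻ x, ENNReal.ofReal (h x)) ^ 2 + 1))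
  gcongr
  exact le_self_add

theorem le_one_add_sq (a : ℝ≥0∞) : a ≤ 1 + a ^ 2 := by
  rcases le_total a 1 with h | h
  · exact h.trans le_self_add
  · exact (le_self_pow₀ h two_ne_zero).trans le_add_self

theorem ae_lintegral_ne_top (H : Model s z v μ m) {h : EucSp d → ℝ} (hh : IsC0 h)
    {X : EucSp d → Config d → ℝ≥0∞} (hX : Measurable fun p : Config d × EucSp d => X p.2 p.1)
    {C : ℝ≥0∞} (hC : C ≠ ⊤) (hXC : ∀ y, ∫⁻ γ, X y γ ^ 2 ∂μ ≤ C) :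
    ∀ᵐ γ ∂μ, ∫⁻ y, ENNReal.ofReal (h y) * X y γ ≠ ⊤ := by
  have := H.prob
  have hI : ∫⁻ x, ENNReal.ofReal (h x) ≠ ⊤ := hh.integrable.lintegral_lt_top.ne
  have hh' := hh.1.measurable
  have hhm : Measurable fun x => ENNReal.ofReal (h x) := hh'.ennreal_ofReal
  have hS : Measurable fun p : Config d × EucSp d => ENNReal.ofReal (h p.2) * X p.2 p.1 :=
    (hhm.comp measurable_snd).mul hX
  have hS' : Measurable fun γ : Config d => ∫⁻ y, ENNReal.ofReal (h y) * X y γ :=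
    hS.lintegral_prod_right'
  refine (ae_lt_top hS' (ne_top_of_le_ne_top
    (b := (∫⁻ x, ENNReal.ofReal (h x)) * (1 + C)) (by finiteness) ?_)).mono fun γ h => h.ne
  rw [lintegral_lintegral_swap hS.aemeasurable, ← lintegral_mul_const _ hhm]
  refine lintegral_mono fun y => ?_
  dsimp only
  rw [lintegral_const_mul' _ _ ENNReal.ofReal_ne_top]
  gcongr
  calc ∫⁻ γ, X y γ ∂μ ≤ ∫⁻ γ, (1 + X y γ ^ 2) ∂μ := lintegral_mono fun γ => le_one_add_sq _
    _ = 1 + ∫⁻ γ, X y γ ^ 2 ∂μ := by rw [lintegral_add_left measurable_const]; simp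
    _ ≤ _ := by gcongr; exact hXC y

theorem ae_lintegral_Wt_ne_top (H : Model s z v μ m) {f h : EucSp d → ℝ} (hf : IsC0 f)
    (hh : IsC0 h) : ∀ᵐ γ ∂μ, ∫⁻ y, ENNReal.ofReal (h y) * Wt s v f y γ ≠ ⊤ := by
  obtain ⟨C, hC, hCb⟩ := H.exists_lintegral_Wt_sq_le hf
  exact H.ae_lintegral_ne_top hh (H.measurable_uncurry_Wt hf) hC hCb

theorem ae_lintegral_Pt_ne_top (H : Model s z v μ m) {f h : EucSp d → ℝ} (hf : IsC0 f)
    (hh : IsC0 h) {c : ℝ≥0∞} (hc : c ≠ ⊤) {α : EucSp d → ℝ≥0∞} (hα : Ker c m α) :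
    ∀ᵐ γ ∂μ, ∫⁻ y, ENNReal.ofReal (h y) * Pt s v f α y γ ≠ ⊤ := by
  obtain ⟨K, C, hK, hC, hb⟩ := H.exists_Pt_sq_le hf
  have hζt : ENNReal.ofReal z ≠ ⊤ := ENNReal.ofReal_ne_top
  refine H.ae_lintegral_ne_top hh (H.measurable_uncurry_Pt hf hα.meas)
    (C := ENNReal.ofReal z ^ 2 * C + c * K) (by finiteness) fun y => ?_
  obtain ⟨h1, h2⟩ := hb c α hα y
  exact h2.trans (by gcongr)

end Model

theorem ex_toReal (t : ℝ) : (ex t).toReal = Real.exp t :=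
  ENNReal.toReal_ofReal (Real.exp_pos t).le

/-- The configurations on which all energies occurring in the generators are finite. -/
structure FiniteEnergy {d : ℕ} (v : EucSp d → ℝ) (γ : Config d) : Prop where
  del : ∀ x ∈ γ.1, Summable fun u : (γ.del x).1 => v (x - u)
  ae : ∀ᵐ y, Summable fun u : γ.1 => v (y - u)

theorem Model.ae_finiteEnergy {d : ℕ} {s z : ℝ} {v : EucSp d → ℝ} {μ : Measure (Config d)}
    {m : ℝ≥0∞} (H : Model s z v μ m) : ∀ᵐ γ ∂μ, FiniteEnergy v γ := by
  have := H.prob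
  have hS := measurableSet_summable H.vm
  have h1 : ∀ᵐ γ ∂μ, ∀ᵐ y, Summable fun u : γ.1 => v (y - u) :=
    (Measure.ae_ae_comm hS).2 (ae_of_all _ H.summ)
  have h2 : ∫⁻ γ, ∑' x : γ.1,
      {p : Config d × EucSp d | Summable fun u : p.1.1 => v (p.2 - u)}ᶜ.indicator 1
        (γ.del x, (x : EucSp d)) ∂μ = 0 := by
    rw [H.gnz (fun γ x => {p : Config d × EucSp d | Summable fun u : p.1.1 =>
      v (p.2 - u)}ᶜ.indicator 1 (γ, x)) (measurable_one.indicator hS.compl)]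
    refine mul_eq_zero_of_right _ ((lintegral_congr fun x => ?_).trans lintegral_zero)
    refine (lintegral_congr_ae ((H.summ x).mono fun γ hγ => ?_)).trans lintegral_zero
    have hmem : (γ, x) ∉ {p : Config d × EucSp d | Summable fun u : p.1.1 => v (p.2 - u)}ᶜ :=
      fun h => h hγ
    rw [Set.indicator_of_notMem hmem, mul_zero]
  have hm : Measurable fun γ : Config d => ∑' x : γ.1,
      {p : Config d × EucSp d | Summable fun u : p.1.1 => v (p.2 - u)}ᶜ.indicator
        (1 : Config d × EucSp d → ℝ≥0∞) (γ.del x, (x : EucSp d)) :=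
    measurable_id.tsum_config (g := fun (γ : Config d) x =>
      {p : Config d × EucSp d | Summable fun u : p.1.1 => v (p.2 - u)}ᶜ.indicator
        (1 : Config d × EucSp d → ℝ≥0∞) (γ.del x, x)) ((measurable_one.indicator hS.compl).comp
      ((measurable_fst.config_del measurable_snd).prodMk measurable_snd))
  replace h2 := (lintegral_eq_zero_iff hm).1 h2
  filter_upwards [h1, h2] with γ h1 h2
  refine ⟨fun x hx => ?_, h1⟩
  have h3 := ENNReal.tsum_eq_zero.1 h2 ⟨x, hx⟩
  by_contra hc
  rw [Set.indicator_of_mem (show _ ∈ {p : Config d × EucSp d | Summable fun u : p.1.1 =>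
    v (p.2 - u)}ᶜ from hc)] at h3
  exact one_ne_zero h3

section Pathwise

variable {d : ℕ} {s z : ℝ} {φ : EucSp d → EReal} {γ : Config d} {aa f : EucSp d → ℝ}

theorem Config.notMem_del (γ : Config d) (x : EucSp d) : x ∉ (γ.del x).1 := fun h => h.2 rfl

theorem FiniteEnergy.ae_del [NullSingletonClass (volume : Measure (EucSp d))]
    {v : EucSp d → ℝ} (hγ : FiniteEnergy v γ) (x : EucSp d) :
    ∀ᵐ y, y ∉ (γ.del x).1 ∧ Summable fun u : (γ.del x).1 => v (y - u) := by
  filter_upwards [hγ.ae, γ.countable.ae_notMem volume] with y h1 h2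
  refine ⟨fun h => h2 h.1, ?_⟩
  exact h1.comp_injective (i := Set.inclusion (sdiff_subset : γ.1 \ {x} ⊆ γ.1))
    (Set.inclusion_injective _)

theorem rexp_energy (h : IsPairPotential φ) (t : ℝ) {x : EucSp d} (hx : x ∉ γ.1)
    (hsx : Summable fun u : γ.1 => rpot φ (x - u)) :
    rexp ((t : EReal) * energy φ x γ.1) = (ex (t * En (rpot φ) x γ)).toReal := by
  rw [energy_eq h hx hsx, ← EReal.coe_mul, rexp_coe, ex_toReal]

theorem rexp_jump (h : IsPairPotential φ) {x y : EucSp d} (hx : x ∉ γ.1)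
    (hsx : Summable fun u : γ.1 => rpot φ (x - u)) (hy : y ∉ γ.1)
    (hsy : Summable fun u : γ.1 => rpot φ (y - u)) :
    rexp ((s : EReal) * energy φ x γ.1 + ((s - 1 : ℝ) : EReal) * energy φ y γ.1) =
      (ex (s * En (rpot φ) x γ) * ex ((s - 1) * En (rpot φ) y γ)).toReal := by
  rw [energy_eq h hx hsx, energy_eq h hy hsy, ← EReal.coe_mul, ← EReal.coe_mul, ← EReal.coe_add,
    rexp_coe, ← ex_add, ex_toReal]

theorem Dminus_exp {x : EucSp d} (hf : IsC0 f) (hx : x ∈ γ.1) :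
    Dminus (fun γ' => Real.exp (cpair f γ')) x γ =
      Real.exp (cpair f (γ.del x)) * (1 - Real.exp (f x)) := by
  have := cpair_ins (γ.notMem_del x) hf
  rw [Config.ins_del hx] at this
  rw [Dminus, this, Real.exp_add]
  ring

theorem Dplus_exp {x : EucSp d} (hf : IsC0 f) (hx : x ∉ γ.1) :
    Dplus (fun γ' => Real.exp (cpair f γ')) x γ =
      Real.exp (cpair f γ) * (Real.exp (f x) - 1) := by
  rw [Dplus, cpair_ins hx hf, Real.exp_add]
  ring

theorem integral_jump [NullSingletonClass (volume : Measure (EucSp d))]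
    (h : IsPairPotential φ) (ham : Measurable aa) (ha0 : ∀ x, 0 ≤ aa x)
    (hγ : FiniteEnergy (rpot φ) γ) {x : EucSp d} (hx : x ∈ γ.1) :
    ∫ y, aa (x - y) * rexp ((s : EReal) * energy φ x (γ.1 \ {x}) +
        ((s - 1 : ℝ) : EReal) * energy φ y (γ.1 \ {x})) =
      (ex (s * En (rpot φ) x (γ.del x))).toReal *
        (Av s (rpot φ) (fun w => ENNReal.ofReal (aa w)) x (γ.del x)).toReal := by
  have e : ∀ᵐ y, aa (x - y) * rexp ((s : EReal) * energy φ x (γ.1 \ {x}) +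
        ((s - 1 : ℝ) : EReal) * energy φ y (γ.1 \ {x})) =
      (ex (s * En (rpot φ) x (γ.del x))).toReal *
        (ENNReal.ofReal (aa (x - y)) * ex ((s - 1) * En (rpot φ) y (γ.del x))).toReal := by
    filter_upwards [hγ.ae_del x] with y hy
    have := rexp_jump (s := s) h (γ.notMem_del x) (hγ.del x hx) hy.1 hy.2
    rw [ENNReal.toReal_mul] at this ⊢
    rw [ENNReal.toReal_ofReal (ha0 _)]
    calc _ = aa (x - y) * _ := congrArg _ this
      _ = _ := by ring
  have hE : Measurable fun y => En (rpot φ) y (γ.del x) :=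
    Measurable.En (measurable_rpot h) measurable_id measurable_const
  rw [integral_congr_ae e, integral_const_mul, integral_toReal (Measurable.aemeasurable
    (by fun_prop)) (ae_of_all _ fun y => (ENNReal.mul_ne_top ENNReal.ofReal_ne_top
      (ex_ne_top _)).lt_top), Av]

theorem enorm_minus_sub_le [NullSingletonClass (volume : Measure (EucSp d))]
    (h : IsPairPotential φ) (ham : Measurable aa) (ha0 : ∀ x, 0 ≤ aa x) (hf : IsC0 f)
    (hγ : FiniteEnergy (rpot φ) γ) :
    ‖HepsMinus s aa φ (fun γ' => Real.exp (cpair f γ')) γ -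
        H0Minus s φ (fun γ' => Real.exp (cpair f γ')) γ‖ₑ ≤
      ∑' x : γ.1, ENNReal.ofReal |1 - Real.exp (f x)| *
        (ex (cpair f (γ.del x)) * ex (s * En (rpot φ) x (γ.del x)) *
          ‖(Av s (rpot φ) (fun w => ENNReal.ofReal (aa w)) x (γ.del x)).toReal - 1‖ₑ) := by
  have hsupp : ∀ T : γ.1 → ℝ, (∀ x : γ.1, |1 - Real.exp (f x)| = 0 → T x = 0) → Summable T :=
    fun T hT => by
      have h1 := (γ.2 _ hf.abs_one_sub_exp.2).preimage (f := ((↑) : γ.1 → EucSp d))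
        Subtype.val_injective.injOn
      refine summable_of_hasFiniteSupport (h1.subset fun u hu => ⟨u.2, subset_tsupport _ ?_⟩)
      exact fun h0 => hu (hT u h0)
  have hz : ∀ x : EucSp d, |1 - Real.exp (f x)| = 0 → 1 - Real.exp (f x) = 0 :=
    fun x hx => abs_eq_zero.1 hx
  rw [HepsMinus, H0Minus, neg_sub_neg, ← Summable.tsum_sub]
  · refine enorm_tsum_le_tsum_enorm.trans (ENNReal.tsum_le_tsum fun x => le_of_eq ?_)
    have h2 := rexp_energy h s (γ.notMem_del x) (hγ.del x x.2)
    have h2' : rexp ((s : EReal) * energy φ x (γ.1 \ {x.1})) = _ := h2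
    rw [integral_jump h ham ha0 hγ x.2, Dminus_exp hf x.2, h2', ex_toReal]
    rw [show ∀ E D w A : ℝ, E * (D * w) - D * w * (E * A) = w * (D * E * -(A - 1)) from
      fun _ _ _ _ => by ring, enorm_mul, enorm_mul, enorm_mul, enorm_neg, ← Real.enorm_abs,
      Real.enorm_of_nonneg (abs_nonneg _), Real.enorm_of_nonneg (Real.exp_pos _).le,
      Real.enorm_of_nonneg (Real.exp_pos _).le]
    rfl
  · exact hsupp _ fun x hx => by rw [Dminus_exp hf x.2, hz _ hx, mul_zero, mul_zero]
  · exact hsupp _ fun x hx => by rw [Dminus_exp hf x.2, hz _ hx, mul_zero, zero_mul]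

end Pathwise

section Pathwise

variable {d : ℕ} {s z : ℝ} {φ : EucSp d → EReal} {γ : Config d} {aa f : EucSp d → ℝ}

theorem Wt_ne_top {v : EucSp d → ℝ} {y : EucSp d} : Wt s v f y γ ≠ ⊤ :=
  ENNReal.mul_ne_top (ex_ne_top _) (ex_ne_top _)

theorem enorm_toReal_mul {a : ℝ≥0∞} (ha : a ≠ ⊤) (t : ℝ) :
    ‖a.toReal * (Real.exp t - 1)‖ₑ = ENNReal.ofReal |1 - Real.exp t| * a := by
  rw [enorm_mul, Real.enorm_of_nonneg ENNReal.toReal_nonneg, ENNReal.ofReal_toReal ha, mul_comm,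
    ← Real.enorm_abs, Real.enorm_of_nonneg (abs_nonneg _), abs_sub_comm]

theorem integrable_toReal_mul {a : EucSp d → ℝ≥0∞} (ha : Measurable a) (hf : IsC0 f)
    (h : ∫⁻ y, ENNReal.ofReal |1 - Real.exp (f y)| * a y ≠ ⊤) :
    Integrable fun y => (a y).toReal * (Real.exp (f y) - 1) := by
  have hf' := hf.1.measurable
  refine ⟨Measurable.aestronglyMeasurable (by fun_prop), lt_of_le_of_lt ?_ h.lt_top⟩
  refine lintegral_mono fun y => ?_
  rcases eq_or_ne (a y) ⊤ with h0 | h0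
  · simp [h0]
  · exact (enorm_toReal_mul h0 _).le

theorem integral_jump_plus [NullSingletonClass (volume : Measure (EucSp d))]
    (h : IsPairPotential φ) (ha0 : ∀ x, 0 ≤ aa x) (hf : IsC0 f)
    (hγ : FiniteEnergy (rpot φ) γ) {x : EucSp d} (hx : x ∈ γ.1) :
    ∫ y, aa (x - y) * rexp ((s : EReal) * energy φ x (γ.1 \ {x}) +
        ((s - 1 : ℝ) : EReal) * energy φ y (γ.1 \ {x})) *
        Dplus (fun γ' => Real.exp (cpair f γ')) y (γ.del x) =
      ∫ y, (pk s (rpot φ) f (fun w => ENNReal.ofReal (aa w)) y x (γ.del x)).toReal *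
        (Real.exp (f y) - 1) := by
  refine integral_congr_ae ?_
  filter_upwards [hγ.ae_del x] with y hy
  have := rexp_jump (s := s) h (γ.notMem_del x) (hγ.del x hx) hy.1 hy.2
  rw [Dplus_exp hf hy.1, pk, Wt]
  simp only [ENNReal.toReal_mul, ex_toReal, ENNReal.toReal_ofReal (ha0 _)] at this ⊢
  calc _ = aa (x - y) * _ * _ := congrArg (fun t => aa (x - y) * t * _) this
    _ = _ := by ring

theorem HepsPlus_exp [NullSingletonClass (volume : Measure (EucSp d))]
    (h : IsPairPotential φ) (ham : Measurable aa) (ha0 : ∀ x, 0 ≤ aa x) (hf : IsC0 f)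
    (hγ : FiniteEnergy (rpot φ) γ) (hP : ∫⁻ y, ENNReal.ofReal |1 - Real.exp (f y)| *
      Pt s (rpot φ) f (fun w => ENNReal.ofReal (aa w)) y γ ≠ ⊤) :
    HepsPlus s aa φ (fun γ' => Real.exp (cpair f γ')) γ =
      -∫ y, (Pt s (rpot φ) f (fun w => ENNReal.ofReal (aa w)) y γ).toReal *
        (Real.exp (f y) - 1) := by
  have := γ.countable
  have hf' := hf.1.measurable
  have hpm : ∀ x : EucSp d, Measurable fun y =>
      pk s (rpot φ) f (fun w => ENNReal.ofReal (aa w)) y x (γ.del x) := fun x =>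
    Measurable.pk (measurable_rpot h) hf' ham.ennreal_ofReal measurable_id measurable_const
      measurable_const
  have hpt : ∀ x y : EucSp d,
      pk s (rpot φ) f (fun w => ENNReal.ofReal (aa w)) y x (γ.del x) ≠ ⊤ := fun x y =>
    ENNReal.mul_ne_top (ENNReal.mul_ne_top ENNReal.ofReal_ne_top (ex_ne_top _)) Wt_ne_top
  rw [HepsPlus, tsum_congr fun x : γ.1 => integral_jump_plus h ha0 hf hγ x.2, ← integral_tsum]
  · refine congrArg _ (integral_congr_ae (ae_of_all _ fun y => ?_))
    dsimp only
    rw [tsum_mul_right, Pt, ENNReal.tsum_toReal_eq fun x : γ.1 => hpt x y]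
  · intro x
    have := hpm x
    exact Measurable.aestronglyMeasurable (by fun_prop)
  · rw [← lintegral_tsum]
    · refine ne_of_eq_of_ne (lintegral_congr fun y => ?_) hP
      rw [Pt, ← ENNReal.tsum_mul_left]
      exact tsum_congr fun x => enorm_toReal_mul (hpt x y) _
    · intro x
      have := hpm x
      exact Measurable.aemeasurable (by fun_prop)

theorem H0Plus_exp [NullSingletonClass (volume : Measure (EucSp d))]
    (h : IsPairPotential φ) (hz : 0 ≤ z) (hf : IsC0 f) (hγ : FiniteEnergy (rpot φ) γ) :
    H0Plus s z φ (fun γ' => Real.exp (cpair f γ')) γ =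
      -∫ y, (ENNReal.ofReal z * Wt s (rpot φ) f y γ).toReal * (Real.exp (f y) - 1) := by
  rw [H0Plus]
  refine congrArg _ (integral_congr_ae ?_)
  filter_upwards [hγ.ae, γ.countable.ae_notMem volume] with y h1 h2
  rw [rexp_energy h (s - 1) h2 h1, Dplus_exp hf h2, Wt]
  simp only [ENNReal.toReal_mul, ex_toReal, ENNReal.toReal_ofReal hz]
  ring

theorem enorm_plus_sub_le [NullSingletonClass (volume : Measure (EucSp d))]
    (h : IsPairPotential φ) (ham : Measurable aa) (ha0 : ∀ x, 0 ≤ aa x) (hz : 0 ≤ z)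
    (hf : IsC0 f) (hγ : FiniteEnergy (rpot φ) γ)
    (hP : ∫⁻ y, ENNReal.ofReal |1 - Real.exp (f y)| *
      Pt s (rpot φ) f (fun w => ENNReal.ofReal (aa w)) y γ ≠ ⊤)
    (hW : ∫⁻ y, ENNReal.ofReal |1 - Real.exp (f y)| * Wt s (rpot φ) f y γ ≠ ⊤) :
    ‖HepsPlus s aa φ (fun γ' => Real.exp (cpair f γ')) γ -
        H0Plus s z φ (fun γ' => Real.exp (cpair f γ')) γ‖ₑ ≤
      ∫⁻ y, ENNReal.ofReal |1 - Real.exp (f y)| *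
        ‖(Pt s (rpot φ) f (fun w => ENNReal.ofReal (aa w)) y γ).toReal -
          (ENNReal.ofReal z * Wt s (rpot φ) f y γ).toReal‖ₑ := by
  have hv := measurable_rpot h
  have hf' := hf.1.measurable
  have hPm : Measurable fun y => Pt s (rpot φ) f (fun w => ENNReal.ofReal (aa w)) y γ :=
    Measurable.Pt hv hf' ham.ennreal_ofReal measurable_id measurable_const
  have hWm : Measurable fun y => ENNReal.ofReal z * Wt s (rpot φ) f y γ :=
    (Measurable.Wt hv hf' measurable_id measurable_const).const_mul _
  have hW' : ∫⁻ y, ENNReal.ofReal |1 - Real.exp (f y)| *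
      (ENNReal.ofReal z * Wt s (rpot φ) f y γ) ≠ ⊤ := by
    simp only [mul_left_comm _ (ENNReal.ofReal z)]
    rw [lintegral_const_mul' _ _ ENNReal.ofReal_ne_top]
    exact ENNReal.mul_ne_top ENNReal.ofReal_ne_top hW
  rw [HepsPlus_exp h ham ha0 hf hγ hP, H0Plus_exp h hz hf hγ, neg_sub_neg,
    ← integral_sub (integrable_toReal_mul hWm hf hW') (integrable_toReal_mul hPm hf hP)]
  refine (enorm_integral_le_lintegral_enorm _).trans (lintegral_mono fun y => le_of_eq ?_)
  dsimp only
  rw [← sub_mul, mul_comm, enorm_mul, ← enorm_neg (_ - _ : ℝ), neg_sub, ← Real.enorm_abs,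
    Real.enorm_of_nonneg (abs_nonneg _), ← enorm_neg (_ - _ : ℝ), neg_sub]

end Pathwise

theorem aScaled_nonneg {d : ℕ} {a : EucSp d → ℝ} (ha : GoodA a) {ε : ℝ} (hε : 0 < ε)
    (x : EucSp d) : 0 ≤ aScaled a ε x :=
  mul_nonneg (by positivity) (ha.nonneg _)

theorem measurable_aScaled {d : ℕ} {a : EucSp d → ℝ} (ha : GoodA a) (ε : ℝ) :
    Measurable (aScaled a ε) :=
  (ha.meas.comp (measurable_const_smul ε)).const_mul _

theorem integral_aScaled {d : ℕ} (a : EucSp d → ℝ) {ε : ℝ} (hε : 0 < ε) :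
    ∫ x, aScaled a ε x = ∫ x, a x := by
  unfold aScaled
  rw [integral_const_mul, Measure.integral_comp_smul, finrank_euclideanSpace_fin, smul_eq_mul,
    abs_of_pos (by positivity), mul_inv_cancel_left₀ (by positivity)]

theorem GoodA.ker {d : ℕ} {a : EucSp d → ℝ} (ha : GoodA a) {m : ℝ≥0∞} (m0 : m ≠ 0)
    (hm : ∫ x, a x = m.toReal⁻¹) {C : ℝ} (hC : ∀ x, a x ≤ C) {ε : ℝ} (hε : 0 < ε) :
    Ker (ENNReal.ofReal (ε ^ d * C)) m fun x => ENNReal.ofReal (aScaled a ε x) where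
  meas := (measurable_aScaled ha ε).ennreal_ofReal
  even x := by rw [aScaled, aScaled, smul_neg, ha.even]
  le x := ENNReal.ofReal_le_ofReal (mul_le_mul_of_nonneg_left (hC _) (by positivity))
  int := by
    have hi : Integrable (aScaled a ε) := (ha.int.comp_smul hε.ne').const_mul _
    rw [← ofReal_integral_eq_lintegral_ofReal hi (ae_of_all _ (aScaled_nonneg ha hε)),
      integral_aScaled a hε, hm, ← ENNReal.toReal_inv, ENNReal.ofReal_toReal (by finiteness)]

theorem sq_enorm_add_le (a b : ℝ) : ‖(a + b) ^ 2‖ₑ ≤ 3 * (‖a‖ₑ ^ 2 + ‖b‖ₑ ^ 2) := by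
  rw [enorm_pow]
  calc ‖a + b‖ₑ ^ 2 ≤ (‖a‖ₑ + ‖b‖ₑ) ^ 2 := by gcongr; exact enorm_add_le _ _
    _ = ‖a‖ₑ ^ 2 + ‖b‖ₑ ^ 2 + 2 * (‖a‖ₑ * ‖b‖ₑ) := by ring
    _ ≤ ‖a‖ₑ ^ 2 + ‖b‖ₑ ^ 2 + 2 * (‖a‖ₑ ^ 2 + ‖b‖ₑ ^ 2) := by
      gcongr; exact mul_le_sq_add_sq _ _
    _ = _ := by ring

/-- main theorem: if `φ(x) → 0` at infinity and `a` is normalized by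
`∫ a = (∫_Γ exp[(s-1)∑_{u∈γ}φ(u)] dμ)⁻¹`, then for every `f ∈ C_0(ℝ^d)`, with
`F = e^{⟨f,·⟩}`, one has `H_ε F → H_0 F` in `L²(Γ,μ)` as `ε → 0+`. -/
theorem statement10 (d : ℕ) (s z B ξ : ℝ) (φ : EucSp d → EReal) (μ : Measure (Config d))
    (k u : ∀ n : ℕ, (Fin n → EucSp d) → ℝ) (hset : Setting d s z B ξ φ μ k u)
    (hvan : PhiVanishes φ)
    (a : EucSp d → ℝ) (ha : GoodA a) (hnorm : NormalizedA s a φ μ)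
    (f : EucSp d → ℝ) (hf : IsC0 f) :
    Tendsto (fun ε : ℝ => ∫ γ,
        ((HepsMinus s (aScaled a ε) φ (fun γ' => Real.exp (cpair f γ')) γ +
            HepsPlus s (aScaled a ε) φ (fun γ' => Real.exp (cpair f γ')) γ) -
          (H0Minus s φ (fun γ' => Real.exp (cpair f γ')) γ +
            H0Plus s z φ (fun γ' => Real.exp (cpair f γ')) γ)) ^ 2 ∂μ)
      (nhdsWithin (0 : ℝ) (Set.Ioi 0)) (nhds 0) := by
  obtain ⟨m, H, hm⟩ := hset.exists_model hvan
  have hna := H.noatoms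
  obtain ⟨C, hC⟩ := ha.bdd
  have hh := hf.abs_one_sub_exp
  rw [NormalizedA, hm] at hnorm
  rw [tendsto_zero_iff_enorm_tendsto_zero, ENNReal.tendsto_nhds_zero]
  intro δ hδ
  have hδ6 : 0 < δ / 6 := ENNReal.div_pos hδ.ne' (by simp)
  obtain ⟨c₁, hc₁, h1⟩ := H.minus_small hf hδ6
  obtain ⟨c₂, hc₂, h2⟩ := H.plus_small hf hh hδ6
  have hlim : Tendsto (fun ε : ℝ => ENNReal.ofReal (ε ^ d * C)) (nhdsWithin 0 (Set.Ioi 0))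
      (nhds 0) := by
    have : Continuous fun ε : ℝ => ENNReal.ofReal (ε ^ d * C) :=
      ENNReal.continuous_ofReal.comp (by fun_prop)
    simpa [hset.hd.ne'] using (this.tendsto 0).mono_left nhdsWithin_le_nhds
  filter_upwards [self_mem_nhdsWithin, hlim.eventually_le_const hc₁,
    hlim.eventually_le_const hc₂] with ε hε hε₁ hε₂
  have hK := ha.ker H.m0 hnorm hC hε
  have ha0 := aScaled_nonneg ha hε
  have ham := measurable_aScaled ha ε
  have hmeas : Measurable fun γ : Config d => ∫⁻ y, ENNReal.ofReal |1 - Real.exp (f y)| *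
      ‖(Pt s (rpot φ) f (fun w => ENNReal.ofReal (aScaled a ε w)) y γ).toReal -
        (ENNReal.ofReal z * Wt s (rpot φ) f y γ).toReal‖ₑ :=
    ((hh.1.measurable.comp measurable_snd).ennreal_ofReal.mul
      ((H.measurable_uncurry_Pt hf hK.meas).ennreal_toReal.sub
        ((H.measurable_uncurry_Wt hf).const_mul _).ennreal_toReal).enorm).lintegral_prod_right'
  refine (enorm_integral_le_lintegral_enorm _).trans ?_
  calc _ ≤ ∫⁻ γ, 3 * ((∑' x : γ.1, ENNReal.ofReal |1 - Real.exp (f x)| *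
          (ex (cpair f (γ.del x)) * ex (s * En (rpot φ) x (γ.del x)) * ‖(Av s (rpot φ)
            (fun w => ENNReal.ofReal (aScaled a ε w)) x (γ.del x)).toReal - 1‖ₑ)) ^ 2 +
        (∫⁻ y, ENNReal.ofReal |1 - Real.exp (f y)| *
          ‖(Pt s (rpot φ) f (fun w => ENNReal.ofReal (aScaled a ε w)) y γ).toReal -
            (ENNReal.ofReal z * Wt s (rpot φ) f y γ).toReal‖ₑ) ^ 2) ∂μ := by
        refine lintegral_mono_ae ?_
        filter_upwards [H.ae_finiteEnergy, H.ae_lintegral_Wt_ne_top hf hh,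
          H.ae_lintegral_Pt_ne_top hf hh ENNReal.ofReal_ne_top hK] with γ hγ hW hP
        rw [add_sub_add_comm]
        refine (sq_enorm_add_le _ _).trans ?_
        gcongr
        · exact enorm_minus_sub_le hset.pp ham ha0 hf hγ
        · exact enorm_plus_sub_le hset.pp ham ha0 hset.hz.le hf hγ hP hW
    _ ≤ 3 * (δ / 6 + δ / 6) := by
        rw [lintegral_const_mul' _ _ (by simp)]
        gcongr
        rw [lintegral_add_right _ (hmeas.pow_const 2)]
        exact add_le_add (h1 _ (hK.mono hε₁)) (h2 _ (hK.mono hε₂))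
    _ = δ := by
        rw [← two_mul, ← mul_assoc, show (3 * 2 : ℝ≥0∞) = 6 by norm_num,
          ENNReal.mul_div_cancel (by simp) (by simp)]

end
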